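/- There exists n0 ∈ ℕ such that the following holds for all n ≥ n0. Let r, s be nonnegative integers with n = 3r + s and 1 ≤ s ≤ 3. If H is a 3-partite 3-graph with vertex classes V1, V2, V3, each of size n, and δ1(H) > δ(n,r,s), then H has a perfect matching (a set of n pairwise disjoint edges covering all vertices). -/

import Mathlib

open Finset

/-- The number of edges of `E` containing the vertex `v` (the vertex degree). -/
def hdeg {α : Type} [DecidableEq α] (E : Finset (Finset α)) (v : α) : ℕ :=
  (E.filter (fun e => v ∈ e)).card

/-- `E` is the edge set of a 3-partite 3-graph with vertex classes `V1, V2, V3`: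
every edge has exactly one vertex in each class. -/
def IsPartite3 {α : Type} [DecidableEq α] (V1 V2 V3 : Finset α)
    (E : Finset (Finset α)) : Prop :=
  ∀ e ∈ E, e ⊆ V1 ∪ V2 ∪ V3 ∧
    (e ∩ V1).card = 1 ∧ (e ∩ V2).card = 1 ∧ (e ∩ V3).card = 1

/-- The degree bound `δ(n,r,s)` from the paper. -/
def deltaLM (n r s : ℕ) : ℕ :=
  if s = 1 then n ^ 2 - (n - r) ^ 2
  else if s = 2 then n ^ 2 - (n - r + 1) * (n - r - 1)
  else n ^ 2 - (n - r) * (n - r - 1)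


namespace LM

/-- Matchings in a tripartite 3-graph given as a set of maps `Fin 3 → Fin n`. -/
def IsMat {n : ℕ} (H M : Finset (Fin 3 → Fin n)) : Prop :=
  M ⊆ H ∧ ∀ e ∈ M, ∀ f ∈ M, ∀ i, e i = f i → e = f

/-- Vertex degree. -/
def dg {n : ℕ} (H : Finset (Fin 3 → Fin n)) (i : Fin 3) (v : Fin n) : ℕ :=
  #{e ∈ H | e i = v}

lemma IsMat.image_card {n : ℕ} {H M : Finset (Fin 3 → Fin n)} (h : IsMat H M) (i : Fin 3) :
    #(M.image (fun e => e i)) = #M :=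
  card_image_of_injOn (fun e he f hf hef => h.2 e he f hf i hef)

lemma IsMat.union {n : ℕ} {H M M' : Finset (Fin 3 → Fin n)} (h : IsMat H M) (h' : IsMat H M')
    (hd : ∀ e ∈ M, ∀ f ∈ M', ∀ i, e i ≠ f i) : IsMat H (M ∪ M') ∧ #(M ∪ M') = #M + #M' := by
  refine ⟨⟨union_subset h.1 h'.1, ?_⟩, ?_⟩
  · intro e he f hf i hi
    rcases mem_union.1 he with he | he <;> rcases mem_union.1 hf with hf | hf
    · exact h.2 e he f hf i hi
    · exact absurd hi (hd e he f hf i)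
    · exact absurd hi.symm (hd f hf e he i)
    · exact h'.2 e he f hf i hi
  · refine card_union_of_disjoint (disjoint_left.2 fun e he he' => hd e he e he' 0 rfl)

lemma IsMat.insert {n : ℕ} {H M : Finset (Fin 3 → Fin n)} (h : IsMat H M) {g : Fin 3 → Fin n}
    (hg : g ∈ H) (hd : ∀ e ∈ M, ∀ i, e i ≠ g i) :
    IsMat H (insert g M) ∧ #(insert g M) = #M + 1 := by
  have hs : IsMat H {g} := ⟨by simpa using hg, by
    intro e he f hf i _; rw [mem_singleton.1 he, mem_singleton.1 hf]⟩
  have := IsMat.union h hs (fun e he f hf i => by rw [mem_singleton.1 hf]; exact hd e he i)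
  rw [union_comm, ← Finset.insert_eq, card_singleton] at this
  exact this

lemma IsMat.mono {n : ℕ} {H H' M : Finset (Fin 3 → Fin n)} (h : IsMat H M) (hs : H ⊆ H') :
    IsMat H' M := ⟨h.1.trans hs, h.2⟩

lemma IsMat.sub {n : ℕ} {H M M' : Finset (Fin 3 → Fin n)} (h : IsMat H M) (hs : M' ⊆ M) :
    IsMat H M' := ⟨hs.trans h.1, fun e he f hf => h.2 e (hs he) f (hs hf)⟩

lemma IsMat.empty {n : ℕ} (H : Finset (Fin 3 → Fin n)) : IsMat H ∅ := ⟨by simp, by simp⟩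

/-- A maximum matching. -/
lemma exists_max {n : ℕ} (H : Finset (Fin 3 → Fin n)) :
    ∃ M, IsMat H M ∧ ∀ M', IsMat H M' → #M' ≤ #M := by
  classical
  obtain ⟨M, hM, hmax⟩ := Finset.exists_max_image (univ.filter (fun M => IsMat H M)) card
    ⟨∅, by simpa using IsMat.empty H⟩
  exact ⟨M, by simpa using hM, fun M' h' => hmax M' (by simpa using h')⟩

lemma IsMat.card_le {n : ℕ} {H M : Finset (Fin 3 → Fin n)} (h : IsMat H M) : #M ≤ n := by
  rw [← h.image_card 0]
  simpa using card_le_univ (M.image (fun e => e 0))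

lemma card_pi {n : ℕ} (s : Fin 3 → Finset (Fin n)) :
    #(Fintype.piFinset s) = #(s 0) * #(s 1) * #(s 2) := by
  rw [Fintype.card_piFinset, Fin.prod_univ_three]

lemma card_fix {n : ℕ} (i : Fin 3) (v : Fin n) :
    #{e : Fin 3 → Fin n | e i = v} = n ^ 2 := by
  have : ({e : Fin 3 → Fin n | e i = v} : Finset _) =
      Fintype.piFinset (Function.update (fun _ => univ) i ({v} : Finset (Fin n))) := by
    ext e
    simp only [mem_filter, mem_univ, true_and, Fintype.mem_piFinset]
    constructor
    · rintro h j
      by_cases hj : j = i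
      · subst hj; simp [h]
      · simp [hj]
    · intro h; simpa using h i
  rw [this, card_pi]
  fin_cases i <;> simp <;> ring

lemma card_in {n : ℕ} (i : Fin 3) (S : Finset (Fin n)) :
    #{e : Fin 3 → Fin n | e i ∈ S} = #S * n ^ 2 := by
  have : ({e : Fin 3 → Fin n | e i ∈ S} : Finset _) =
      Fintype.piFinset (Function.update (fun _ => univ) i S) := by
    ext e
    simp only [mem_filter, mem_univ, true_and, Fintype.mem_piFinset]
    constructor
    · rintro h j
      by_cases hj : j = i
      · subst hj; simp [h]
      · simp [hj]
    · intro h; simpa using h i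
  rw [this, card_pi]
  fin_cases i <;> simp <;> ring

lemma card_fix_in {n : ℕ} {i j : Fin 3} (hij : i ≠ j) (v : Fin n) (S : Finset (Fin n)) :
    #{e : Fin 3 → Fin n | e i = v ∧ e j ∈ S} = #S * n := by
  have : ({e : Fin 3 → Fin n | e i = v ∧ e j ∈ S} : Finset _) =
      Fintype.piFinset (Function.update (Function.update (fun _ => univ) i ({v} : Finset (Fin n))) j S) := by
    ext e
    simp only [mem_filter, mem_univ, true_and, Fintype.mem_piFinset]
    constructor
    · rintro h k
      by_cases hj : k = j
      · subst hj; simp [h]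
      · by_cases hi : k = i
        · subst hi; simp [hj, h]
        · simp [hi, hj]
    · intro h
      have h1 := h i
      have h2 := h j
      simp [hij] at h1 h2
      exact ⟨h1, h2⟩
  rw [this, card_pi]
  fin_cases i <;> fin_cases j <;> simp at hij ⊢ <;> ring

end LM

namespace LM

def Abs {n : ℕ} (H : Finset (Fin 3 → Fin n)) (T : Fin 3 → Fin n)
    (p : (Fin 3 → Fin n) × (Fin 3 → Fin n)) : Prop :=
  ![T 0, p.1 1, p.2 2] ∈ H ∧ Function.update p.1 1 (T 1) ∈ H ∧ Function.update p.2 2 (T 2) ∈ H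

def Good {n : ℕ} (H : Finset (Fin 3 → Fin n)) (p : (Fin 3 → Fin n) × (Fin 3 → Fin n)) : Prop :=
  p.1 ∈ H ∧ p.2 ∈ H ∧ ∀ i, p.1 i ≠ p.2 i

lemma common {n : ℕ} (H : Finset (Fin 3 → Fin n)) (i : Fin 3) (u v : Fin n) (d : ℕ)
    (h : ∀ i v, d ≤ dg H i v) :
    2 * d ≤ #{e ∈ H | e i = u ∧ Function.update e i v ∈ H} + n ^ 2 := by
  classical
  set X : Finset (Fin 3 → Fin n) := {e ∈ H | e i = u} with hX
  set Y : Finset (Fin 3 → Fin n) := {e | e i = u ∧ Function.update e i v ∈ H} with hY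
  have h1 : X ∩ Y = {e ∈ H | e i = u ∧ Function.update e i v ∈ H} := by
    ext e; simp [hX, hY]; tauto
  have h2 : #(X ∪ Y) ≤ n ^ 2 := by
    rw [← card_fix i u]
    apply card_le_card
    intro e; simp [hX, hY]; tauto
  have h3 : dg H i v ≤ #Y := by
    unfold dg
    apply card_le_card_of_injOn (fun e => Function.update e i u)
    · intro e he
      simp only [coe_filter, Set.mem_ofPred_eq] at he
      obtain ⟨he, rfl⟩ := he
      simp [hY, he]
    · intro e he f hf hef
      simp only [coe_filter, Set.mem_ofPred_eq] at he hf
      funext j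
      by_cases hj : j = i
      · subst hj; rw [he.2, hf.2]
      · have := congrFun hef j; simpa [hj] using this
  have h4 : #X = dg H i u := rfl
  have := card_union_add_card_inter X Y
  rw [h1] at this
  have h5 := h i u
  have h6 := h i v
  omega

lemma count_abs {n : ℕ} (H : Finset (Fin 3 → Fin n)) (d c : ℕ) (hc : n ^ 2 + c ≤ 2 * d)
    (h : ∀ i v, d ≤ dg H i v) (T : Fin 3 → Fin n) [DecidablePred (Abs H T)]
    [DecidablePred (Good H)] :
    d * (c * c) ≤ #{p : (Fin 3 → Fin n) × (Fin 3 → Fin n) | Good H p ∧ Abs H T p} + 3 * n ^ 5 := by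
  classical
  set P : Finset (Fin 3 → Fin n) := {g ∈ H | g 0 = T 0} with hP
  let Eg : (Fin 3 → Fin n) → Finset (Fin 3 → Fin n) := fun g =>
    {e ∈ H | e 1 = g 1 ∧ Function.update e 1 (T 1) ∈ H}
  let Fg : (Fin 3 → Fin n) → Finset (Fin 3 → Fin n) := fun g =>
    {e ∈ H | e 2 = g 2 ∧ Function.update e 2 (T 2) ∈ H}
  have hE : ∀ g, c ≤ #(Eg g) := fun g => by
    have := common H 1 (g 1) (T 1) d h; change c ≤ #{e ∈ H | _}; omega
  have hF : ∀ g, c ≤ #(Fg g) := fun g => by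
    have := common H 2 (g 2) (T 2) d h; change c ≤ #{e ∈ H | _}; omega
  have h1 : d * (c * c) ≤ #(P.sigma (fun g => Eg g ×ˢ Fg g)) := by
    rw [card_sigma]
    calc d * (c * c) ≤ #P * (c * c) := Nat.mul_le_mul_right _ (h 0 (T 0))
      _ = ∑ g ∈ P, c * c := by simp
      _ ≤ _ := sum_le_sum fun g _ => by
        rw [card_product]; exact Nat.mul_le_mul (hE g) (hF g)
  set Z : Finset ((Fin 3 → Fin n) × (Fin 3 → Fin n)) := {p | p.1 ∈ H ∧ p.2 ∈ H ∧ Abs H T p}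
  have h2 : #(P.sigma (fun g => Eg g ×ˢ Fg g)) ≤ #Z := by
    apply card_le_card_of_injOn (fun x => x.2)
    · rintro ⟨g, e, f⟩ hx
      simp only [coe_sigma, Set.mem_sigma_iff, coe_product, Set.mem_prod, mem_coe, P, Eg, Fg,
        mem_filter] at hx
      simp only [Z, coe_filter, Set.mem_ofPred_eq, mem_univ, true_and]
      refine ⟨hx.2.1.1, hx.2.2.1, ?_, hx.2.1.2.2, hx.2.2.2.2⟩
      have : ![T 0, e 1, f 2] = g := by
        funext j; fin_cases j
        · exact hx.1.2.symm
        · exact hx.2.1.2.1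
        · exact hx.2.2.2.1
      simpa [this] using hx.1.1
    · rintro ⟨g, e, f⟩ hx ⟨g', e', f'⟩ hx' hh
      simp only [coe_sigma, Set.mem_sigma_iff, coe_product, Set.mem_prod, mem_coe, P, Eg, Fg,
        mem_filter] at hx hx'
      simp only [Prod.mk.injEq] at hh
      obtain ⟨rfl, rfl⟩ := hh
      have : g = g' := by
        funext j; fin_cases j
        · exact hx.1.2.trans hx'.1.2.symm
        · exact hx.2.1.2.1.symm.trans hx'.2.1.2.1
        · exact hx.2.2.2.1.symm.trans hx'.2.2.2.1
      rw [this]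
  have h3 : Z ⊆ ({p | Good H p ∧ Abs H T p} : Finset _) ∪
      (univ : Finset (Fin 3)).biUnion (fun i =>
        ({p | p.1 i = p.2 i} : Finset ((Fin 3 → Fin n) × (Fin 3 → Fin n)))) := by
    intro p hp
    simp only [Z, mem_filter, mem_univ, true_and] at hp
    by_cases hh : ∃ a, p.1 a = p.2 a
    · obtain ⟨a, ha⟩ := hh
      exact mem_union_right _ (mem_biUnion.2 ⟨a, mem_univ _, mem_filter.2 ⟨mem_univ _, ha⟩⟩)
    · push Not at hh
      exact mem_union_left _ (mem_filter.2 ⟨mem_univ _, ⟨hp.1, hp.2.1, hh⟩, hp.2.2⟩)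
  have h4 : ∀ i : Fin 3,
      #({p | p.1 i = p.2 i} : Finset ((Fin 3 → Fin n) × (Fin 3 → Fin n))) ≤ n ^ 5 := by
    intro i
    have : #({p | p.1 i = p.2 i} : Finset ((Fin 3 → Fin n) × (Fin 3 → Fin n))) ≤
        #((univ : Finset (Fin 3 → Fin n)).sigma
          (fun e => ({f | f i = e i} : Finset (Fin 3 → Fin n)))) := by
      apply card_le_card_of_injOn (fun p => ⟨p.1, p.2⟩)
      · intro p hp
        simp at hp ⊢; exact hp.symm
      · intro p _ q _ h
        simp at h
        exact Prod.ext h.1 h.2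
    refine this.trans ?_
    rw [card_sigma]
    simp only [card_fix]
    simp
    exact le_of_eq (by ring)
  have h5 := (card_le_card h3).trans (card_union_le _ _)
  have h6 : #((univ : Finset (Fin 3)).biUnion (fun i =>
        ({p | p.1 i = p.2 i} : Finset ((Fin 3 → Fin n) × (Fin 3 → Fin n))))) ≤ 3 * n ^ 5 := by
    refine card_biUnion_le.trans ?_
    refine (sum_le_sum fun i _ => h4 i).trans ?_
    simp
  omega

def IsAF {n : ℕ} (H : Finset (Fin 3 → Fin n))
    (A : Finset ((Fin 3 → Fin n) × (Fin 3 → Fin n))) : Prop :=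
  (∀ p ∈ A, Good H p) ∧ ∀ p ∈ A, ∀ q ∈ A, p ≠ q → ∀ i,
    p.1 i ≠ q.1 i ∧ p.1 i ≠ q.2 i ∧ p.2 i ≠ q.1 i ∧ p.2 i ≠ q.2 i

def vs {n : ℕ} (A : Finset ((Fin 3 → Fin n) × (Fin 3 → Fin n))) (i : Fin 3) : Finset (Fin n) :=
  A.image (fun p => p.1 i) ∪ A.image (fun p => p.2 i)

lemma card_vs {n : ℕ} (A : Finset ((Fin 3 → Fin n) × (Fin 3 → Fin n))) (i : Fin 3) :
    #(vs A i) ≤ 2 * #A := by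
  unfold vs
  have h1 := card_image_le (s := A) (f := fun p => p.1 i)
  have h2 := card_image_le (s := A) (f := fun p => p.2 i)
  have := card_union_le (A.image (fun p => p.1 i)) (A.image (fun p => p.2 i))
  omega

lemma IsAF.erase {n : ℕ} {H : Finset (Fin 3 → Fin n)} {A} (h : IsAF H A) (p) :
    IsAF H (A.erase p) :=
  ⟨fun q hq => h.1 q (mem_of_mem_erase hq), fun q hq q' hq' =>
    h.2 q (mem_of_mem_erase hq) q' (mem_of_mem_erase hq')⟩

lemma IsAF.mat {n : ℕ} {H : Finset (Fin 3 → Fin n)} {A} (h : IsAF H A) :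
    ∃ M, IsMat H M ∧ ∀ i, M.image (fun e => e i) = vs A i := by
  classical
  refine ⟨A.image Prod.fst ∪ A.image Prod.snd, ⟨?_, ?_⟩, ?_⟩
  · intro e he
    simp only [mem_union, mem_image] at he
    rcases he with ⟨p, hp, rfl⟩ | ⟨p, hp, rfl⟩
    · exact (h.1 p hp).1
    · exact (h.1 p hp).2.1
  · intro e he f hf i hi
    simp only [mem_union, mem_image] at he hf
    rcases he with ⟨p, hp, rfl⟩ | ⟨p, hp, rfl⟩ <;> rcases hf with ⟨q, hq, rfl⟩ | ⟨q, hq, rfl⟩ <;>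
    · by_cases hpq : p = q
      · subst hpq
        first | rfl | exact absurd hi ((h.1 p hp).2.2 i) | exact absurd hi.symm ((h.1 p hp).2.2 i)
      · have := h.2 p hp q hq hpq i
        tauto
  · intro i
    simp [vs, image_union, image_image, Function.comp_def]

lemma insert3_mat {n : ℕ} {H M : Finset (Fin 3 → Fin n)} (h : IsMat H M) {a b c : Fin 3 → Fin n}
    (ha : a ∈ H) (hb : b ∈ H) (hc : c ∈ H)
    (hd : ∀ e ∈ M, ∀ i, e i ≠ a i ∧ e i ≠ b i ∧ e i ≠ c i)
    (hab : ∀ i, a i ≠ b i ∧ a i ≠ c i ∧ b i ≠ c i) :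
    IsMat H (insert c (insert b (insert a M))) ∧
      #(insert c (insert b (insert a M))) = #M + 3 := by
  obtain ⟨m1, c1⟩ := h.insert ha (fun e he i => (hd e he i).1)
  obtain ⟨m2, c2⟩ := m1.insert hb (fun e he i => by
    rcases mem_insert.1 he with rfl | he
    · exact (hab i).1
    · exact (hd e he i).2.1)
  obtain ⟨m3, c3⟩ := m2.insert hc (fun e he i => by
    rcases mem_insert.1 he with rfl | he
    · exact (hab i).2.2
    rcases mem_insert.1 he with rfl | he
    · exact (hab i).2.1
    · exact (hd e he i).2.2)
  exact ⟨m3, by omega⟩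

lemma abs_ne {n : ℕ} {T : Fin 3 → Fin n} {p : (Fin 3 → Fin n) × (Fin 3 → Fin n)} (i : Fin 3)
    {x : Fin n} (h1 : x ≠ p.1 i) (h2 : x ≠ p.2 i) (h3 : x ≠ T i) :
    x ≠ ![T 0, p.1 1, p.2 2] i ∧ x ≠ Function.update p.1 1 (T 1) i ∧
      x ≠ Function.update p.2 2 (T 2) i := by
  fin_cases i
  · exact ⟨h3, h1, h2⟩
  · exact ⟨h1, h3, h2⟩
  · exact ⟨h2, h1, h3⟩

lemma abs_dist {n : ℕ} {T : Fin 3 → Fin n} {p : (Fin 3 → Fin n) × (Fin 3 → Fin n)}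
    (h : ∀ i, p.1 i ≠ p.2 i) (h1 : ∀ i, T i ≠ p.1 i) (h2 : ∀ i, T i ≠ p.2 i) (i : Fin 3) :
    ![T 0, p.1 1, p.2 2] i ≠ Function.update p.1 1 (T 1) i ∧
    ![T 0, p.1 1, p.2 2] i ≠ Function.update p.2 2 (T 2) i ∧
    Function.update p.1 1 (T 1) i ≠ Function.update p.2 2 (T 2) i := by
  fin_cases i
  · exact ⟨h1 0, h2 0, h 0⟩
  · exact ⟨(h1 1).symm, h 1, h2 1⟩
  · exact ⟨(h 2).symm, (h2 2).symm, (h1 2).symm⟩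

lemma abs_img {n : ℕ} {T : Fin 3 → Fin n} {p : (Fin 3 → Fin n) × (Fin 3 → Fin n)} (i : Fin 3)
    (X : Finset (Fin n)) :
    insert (Function.update p.2 2 (T 2) i) (insert (Function.update p.1 1 (T 1) i)
      (insert (![T 0, p.1 1, p.2 2] i) X)) = insert (T i) (insert (p.1 i) (insert (p.2 i) X)) := by
  fin_cases i
  · change insert (p.2 0) (insert (p.1 0) (insert (T 0) X)) = insert (T 0) (insert (p.1 0) (insert (p.2 0) X))
    ext x; simp only [mem_insert]; tauto
  · change insert (p.2 1) (insert (T 1) (insert (p.1 1) X)) = insert (T 1) (insert (p.1 1) (insert (p.2 1) X))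
    ext x; simp only [mem_insert]; tauto
  · change insert (T 2) (insert (p.1 2) (insert (p.2 2) X)) = insert (T 2) (insert (p.1 2) (insert (p.2 2) X))
    rfl

/-- Absorbing a small balanced set. -/
lemma absorb {n : ℕ} (H : Finset (Fin 3 → Fin n)) [∀ T, DecidablePred (Abs H T)] (w : ℕ) :
    ∀ (A : Finset ((Fin 3 → Fin n) × (Fin 3 → Fin n))) (W : Fin 3 → Finset (Fin n)),
      IsAF H A → (∀ i, #(W i) = w) → (∀ i, Disjoint (W i) (vs A i)) →
      (∀ T, w ≤ #{p ∈ A | Abs H T p}) →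
      ∃ M, IsMat H M ∧ ∀ i, M.image (fun e => e i) = vs A i ∪ W i := by
  classical
  induction w with
  | zero =>
    intro A W hA hW _ _
    obtain ⟨M, hM, h⟩ := hA.mat
    refine ⟨M, hM, fun i => ?_⟩
    rw [h i, card_eq_zero.1 (hW i), union_empty]
  | succ w ih =>
    intro A W hA hW hd hT
    have hne : ∀ i, (W i).Nonempty := fun i => card_pos.1 (by rw [hW i]; omega)
    choose T hTW using hne
    have := hT T
    obtain ⟨p, hp⟩ : ({p ∈ A | Abs H T p}).Nonempty := card_pos.1 (by omega)
    rw [mem_filter] at hp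
    obtain ⟨hpA, hpT⟩ := hp
    have hvsub : ∀ i, vs (A.erase p) i ⊆ vs A i := by
      intro i
      unfold vs
      exact union_subset_union (image_subset_image (erase_subset _ _))
        (image_subset_image (erase_subset _ _))
    obtain ⟨M, hM, hMi⟩ := ih (A.erase p) (fun i => (W i).erase (T i)) (hA.erase p)
      (fun i => by rw [card_erase_of_mem (hTW i), hW i]; rfl)
      (fun i => (hd i).mono (erase_subset _ _) (hvsub i))
      (fun T' => by
        have h1 := hT T'
        have h2 : #{q ∈ A | Abs H T' q} ≤ #{q ∈ A.erase p | Abs H T' q} + 1 := by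
          have : ({q ∈ A | Abs H T' q}).erase p ⊆ {q ∈ A.erase p | Abs H T' q} := by
            intro q; simp; tauto
          have := card_le_card this
          have h3 := pred_card_le_card_erase (s := {q ∈ A | Abs H T' q}) (a := p)
          omega
        omega)
    have hp1 : ∀ i, p.1 i ∈ vs A i := fun i =>
      mem_union_left _ (mem_image_of_mem (fun q => q.1 i) hpA)
    have hp2 : ∀ i, p.2 i ∈ vs A i := fun i =>
      mem_union_right _ (mem_image_of_mem (fun q => q.2 i) hpA)
    have hp12 := (hA.1 p hpA).2.2
    have hnp1 : ∀ i, p.1 i ∉ vs (A.erase p) i := by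
      intro i hi
      simp only [vs, mem_union, mem_image, mem_erase] at hi
      rcases hi with ⟨q, ⟨hq, hqA⟩, h⟩ | ⟨q, ⟨hq, hqA⟩, h⟩
      · exact (hA.2 q hqA p hpA hq i).1 h
      · exact (hA.2 q hqA p hpA hq i).2.2.1 h
    have hnp2 : ∀ i, p.2 i ∉ vs (A.erase p) i := by
      intro i hi
      simp only [vs, mem_union, mem_image, mem_erase] at hi
      rcases hi with ⟨q, ⟨hq, hqA⟩, h⟩ | ⟨q, ⟨hq, hqA⟩, h⟩
      · exact (hA.2 q hqA p hpA hq i).2.1 h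
      · exact (hA.2 q hqA p hpA hq i).2.2.2 h
    have hW1 : ∀ i, p.1 i ∉ W i := fun i h => disjoint_left.1 (hd i) h (hp1 i)
    have hW2 : ∀ i, p.2 i ∉ W i := fun i h => disjoint_left.1 (hd i) h (hp2 i)
    have hT1 : ∀ i, T i ≠ p.1 i := fun i h => hW1 i (h ▸ hTW i)
    have hT2 : ∀ i, T i ≠ p.2 i := fun i h => hW2 i (h ▸ hTW i)
    have hTv : ∀ i, T i ∉ vs (A.erase p) i := fun i h =>
      disjoint_left.1 (hd i) (hTW i) (hvsub i h)
    have key : ∀ i, ∀ x ∈ M.image (fun e => e i), x ≠ p.1 i ∧ x ≠ p.2 i ∧ x ≠ T i := by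
      intro i x hx
      rw [hMi i, mem_union, mem_erase] at hx
      refine ⟨?_, ?_, ?_⟩ <;> rintro rfl <;> rcases hx with hx | hx
      · exact hnp1 i hx
      · exact hW1 i hx.2
      · exact hnp2 i hx
      · exact hW2 i hx.2
      · exact hTv i hx
      · exact hx.1 rfl
    have key' : ∀ e ∈ M, ∀ i, e i ≠ p.1 i ∧ e i ≠ p.2 i ∧ e i ≠ T i := fun e he i =>
      key i _ (mem_image_of_mem (fun e => e i) he)
    obtain ⟨ha1, ha2, ha3⟩ := hpT
    obtain ⟨m3, -⟩ := insert3_mat hM ha1 ha2 ha3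
      (fun e he i => abs_ne (T := T) (p := p) i (key' e he i).1 (key' e he i).2.1 (key' e he i).2.2)
      (fun i => abs_dist hp12 hT1 hT2 i)
    refine ⟨_, m3, fun i => ?_⟩
    have hvs : vs A i = insert (p.1 i) (insert (p.2 i) (vs (A.erase p) i)) := by
      conv_lhs => rw [← insert_erase hpA]
      simp only [vs, image_insert]
      ext x; simp only [mem_union, mem_insert]; tauto
    have hWi : W i = insert (T i) ((W i).erase (T i)) := (insert_erase (hTW i)).symm
    rw [image_insert, image_insert, image_insert, hMi i, hvs, abs_img]
    conv_rhs => rw [hWi]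
    rw [union_insert, insert_union, insert_union]

end LM

namespace LM

open Classical in
/-- Pairs disjoint from the vertices of `A`. -/
lemma card_bad {n : ℕ} (A : Finset ((Fin 3 → Fin n) × (Fin 3 → Fin n))) :
    #{p : (Fin 3 → Fin n) × (Fin 3 → Fin n) | ∃ i, p.1 i ∈ vs A i ∨ p.2 i ∈ vs A i}
      ≤ 12 * #A * n ^ 5 := by
  have h1 : ({p : (Fin 3 → Fin n) × (Fin 3 → Fin n) | ∃ i, p.1 i ∈ vs A i ∨ p.2 i ∈ vs A i} :
      Finset _) ⊆ (univ : Finset (Fin 3)).biUnion (fun i =>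
        (({e : Fin 3 → Fin n | e i ∈ vs A i} : Finset _) ×ˢ (univ : Finset (Fin 3 → Fin n))) ∪
        ((univ : Finset (Fin 3 → Fin n)) ×ˢ ({e : Fin 3 → Fin n | e i ∈ vs A i} : Finset _))) := by
    intro p hp
    obtain ⟨i, hi⟩ := (mem_filter.1 hp).2
    refine mem_biUnion.2 ⟨i, mem_univ _, ?_⟩
    simpa using hi
  refine (card_le_card h1).trans (card_biUnion_le.trans ?_)
  have h2 : ∀ i ∈ (univ : Finset (Fin 3)), #((({e : Fin 3 → Fin n | e i ∈ vs A i} : Finset _) ×ˢ (univ : Finset (Fin 3 → Fin n))) ∪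
        ((univ : Finset (Fin 3 → Fin n)) ×ˢ ({e : Fin 3 → Fin n | e i ∈ vs A i} : Finset _)))
        ≤ 4 * #A * n ^ 5 := by
    intro i _
    refine (card_union_le _ _).trans ?_
    rw [card_product, card_product, card_in]
    have : #(univ : Finset (Fin 3 → Fin n)) = n ^ 3 := by simp
    rw [this]
    have h3 := card_vs A i
    calc #(vs A i) * n ^ 2 * n ^ 3 + n ^ 3 * (#(vs A i) * n ^ 2) = #(vs A i) * (2 * n ^ 5) := by ring
      _ ≤ (2 * #A) * (2 * n ^ 5) := Nat.mul_le_mul_right _ h3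
      _ = _ := by ring
  refine (sum_le_sum h2).trans ?_
  simp
  exact le_of_eq (by ring)

open Classical in
lemma step {n : ℕ} (hn : 0 < n) (H : Finset (Fin 3 → Fin n))
    (A : Finset ((Fin 3 → Fin n) × (Fin 3 → Fin n))) (hA : IsAF H A)
    (hk : 6000 * #A ≤ n)
    (hc : ∀ T, (1 / 250 : ℝ) * n ^ 6 ≤ #{p : (Fin 3 → Fin n) × (Fin 3 → Fin n) | Good H p ∧ Abs H T p}) :
    ∃ A', IsAF H A' ∧ #A' = #A + 1 ∧
      (∑ T : Fin 3 → Fin n, (1 / 2 : ℝ) ^ #{p ∈ A' | Abs H T p}) ≤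
        (999 / 1000) * ∑ T : Fin 3 → Fin n, (1 / 2 : ℝ) ^ #{p ∈ A | Abs H T p} := by
  set w : (Fin 3 → Fin n) → ℝ := fun T => (1 / 2 : ℝ) ^ #{p ∈ A | Abs H T p} with hw
  have hw0 : ∀ T, 0 < w T := fun T => by positivity
  set V : Finset ((Fin 3 → Fin n) × (Fin 3 → Fin n)) :=
    {p | Good H p ∧ ¬ ∃ i, p.1 i ∈ vs A i ∨ p.2 i ∈ vs A i} with hV
  have hn0 : (0:ℝ) < n := by exact_mod_cast hn
  have hVc : ∀ T, (1 / 500 : ℝ) * n ^ 6 ≤ #{p ∈ V | Abs H T p} := by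
    intro T
    have h1 : ({p : (Fin 3 → Fin n) × (Fin 3 → Fin n) | Good H p ∧ Abs H T p} : Finset _) ⊆
        {p ∈ V | Abs H T p} ∪ ({p : (Fin 3 → Fin n) × (Fin 3 → Fin n) | ∃ i, p.1 i ∈ vs A i ∨ p.2 i ∈ vs A i} : Finset _) := by
      intro p hp
      have hp := (mem_filter.1 hp).2
      by_cases hh : ∃ i, p.1 i ∈ vs A i ∨ p.2 i ∈ vs A i
      · exact mem_union_right _ (mem_filter.2 ⟨mem_univ _, hh⟩)
      · exact mem_union_left _ (mem_filter.2 ⟨mem_filter.2 ⟨mem_univ _, hp.1, hh⟩, hp.2⟩)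
    have h2 := (card_le_card h1).trans (card_union_le _ _)
    have h3 := card_bad A
    have h4 := hc T
    have h5 : (#{p : (Fin 3 → Fin n) × (Fin 3 → Fin n) | Good H p ∧ Abs H T p} : ℝ) ≤
      #{p ∈ V | Abs H T p} + 12 * #A * n ^ 5 := by exact_mod_cast h2.trans (Nat.add_le_add_left h3 _)
    have h6 : (12 : ℝ) * #A * n ^ 5 ≤ (1 / 500) * n ^ 6 := by
      have : (6000 : ℝ) * #A ≤ n := by exact_mod_cast hk
      have h7 : (0:ℝ) ≤ n ^ 5 := by positivity
      nlinarith [mul_le_mul_of_nonneg_right this h7]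
    linarith
  have hsum : ∑ p ∈ V, ∑ T : Fin 3 → Fin n, (if Abs H T p then w T else 0) =
      ∑ T : Fin 3 → Fin n, w T * #{p ∈ V | Abs H T p} := by
    rw [sum_comm]
    refine sum_congr rfl fun T _ => ?_
    rw [← sum_filter, sum_const, nsmul_eq_mul, mul_comm]
  have hlow : (1 / 500 : ℝ) * n ^ 6 * ∑ T, w T ≤
      ∑ p ∈ V, ∑ T : Fin 3 → Fin n, (if Abs H T p then w T else 0) := by
    rw [hsum, mul_sum]
    refine sum_le_sum fun T _ => ?_
    rw [mul_comm]
    exact mul_le_mul_of_nonneg_left (hVc T) (hw0 T).le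
  have hVn : (#V : ℝ) ≤ n ^ 6 := by
    have : #V ≤ n ^ 6 := by
      refine (card_le_univ V).trans ?_
      simp
      exact le_of_eq (by ring)
    exact_mod_cast this
  have hS0 : 0 ≤ ∑ T, w T := sum_nonneg fun T _ => (hw0 T).le
  have hVne : V.Nonempty := by
    have := hVc (fun _ => ⟨0, hn⟩)
    have h1 : (0:ℝ) < #{p ∈ V | Abs H (fun _ => ⟨0, hn⟩) p} := lt_of_lt_of_le (by positivity) this
    have h2 : 0 < #{p ∈ V | Abs H (fun _ => ⟨0, hn⟩) p} := by exact_mod_cast h1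
    obtain ⟨p, hp⟩ := card_pos.1 h2
    exact ⟨p, (mem_filter.1 hp).1⟩
  obtain ⟨p, hpV, hp⟩ : ∃ p ∈ V, (1 / 500 : ℝ) * ∑ T, w T ≤
      ∑ T : Fin 3 → Fin n, (if Abs H T p then w T else 0) := by
    apply exists_le_of_sum_le hVne
    rw [sum_const, nsmul_eq_mul]
    refine le_trans ?_ hlow
    have : 0 ≤ (1 / 500 : ℝ) * ∑ T, w T := by positivity
    nlinarith [mul_le_mul_of_nonneg_right hVn this]
  have hpV' := (mem_filter.1 hpV).2
  have hpg := hpV'.1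
  have hpd : ∀ i, p.1 i ∉ vs A i ∧ p.2 i ∉ vs A i := by
    have := hpV'.2; push Not at this; exact this
  have hq1 : ∀ q ∈ A, ∀ i, q.1 i ∈ vs A i := fun q hq i =>
    mem_union_left _ (mem_image_of_mem (fun q => q.1 i) hq)
  have hq2 : ∀ q ∈ A, ∀ i, q.2 i ∈ vs A i := fun q hq i =>
    mem_union_right _ (mem_image_of_mem (fun q => q.2 i) hq)
  have hpA : p ∉ A := fun h => (hpd 0).1 (hq1 p h 0)
  refine ⟨insert p A, ⟨?_, ?_⟩, card_insert_of_notMem hpA, ?_⟩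
  · intro q hq
    rcases mem_insert.1 hq with rfl | hq
    · exact hpg
    · exact hA.1 q hq
  · have hx : ∀ q ∈ A, ∀ i, p.1 i ≠ q.1 i ∧ p.1 i ≠ q.2 i ∧ p.2 i ≠ q.1 i ∧ p.2 i ≠ q.2 i := by
      intro q hq i
      refine ⟨?_, ?_, ?_, ?_⟩ <;> intro h
      · exact (hpd i).1 (h ▸ hq1 q hq i)
      · exact (hpd i).1 (h ▸ hq2 q hq i)
      · exact (hpd i).2 (h ▸ hq1 q hq i)
      · exact (hpd i).2 (h ▸ hq2 q hq i)
    intro q hq q' hq' hne i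
    rcases mem_insert.1 hq with hqp | hq <;> rcases mem_insert.1 hq' with hqp' | hq'
    · exact absurd (hqp.trans hqp'.symm) hne
    · rw [hqp]; exact hx q' hq' i
    · rw [hqp']
      have := hx q hq i
      exact ⟨this.1.symm, this.2.2.1.symm, this.2.1.symm, this.2.2.2.symm⟩
    · exact hA.2 q hq q' hq' hne i
  · have : ∀ T : Fin 3 → Fin n, (1 / 2 : ℝ) ^ #{q ∈ insert p A | Abs H T q} =
        w T - (1 / 2) * (if Abs H T p then w T else 0) := by
      intro T
      rw [filter_insert]
      split_ifs with h
      · rw [card_insert_of_notMem (by simp [hpA]), pow_succ]; simp only [hw]; ring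
      · simp [hw]
    rw [sum_congr rfl fun T _ => this T, sum_sub_distrib, ← mul_sum]
    linarith

open Classical in
lemma absorbing (γ : ℝ) (hγ : 0 < γ) : ∃ η : ℝ, 0 < η ∧ ∃ n0 : ℕ, ∀ n ≥ n0,
    ∀ H : Finset (Fin 3 → Fin n), (∀ i v, (55 / 100 : ℝ) * n ^ 2 ≤ dg H i v) →
    ∃ A, IsAF H A ∧ (#A : ℝ) ≤ γ * n ∧ ∀ T, η * n ≤ #{p ∈ A | Abs H T p} := by
  obtain ⟨Q0, hQ0⟩ := exists_nat_gt (1 / γ)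
  obtain ⟨Q, hQ⟩ : ∃ Q, Q = Q0 + 6000 := ⟨_, rfl⟩
  have hQpos : (0:ℝ) < Q := by exact_mod_cast (by omega : 0 < Q)
  have hQγ : 1 / (Q:ℝ) ≤ γ := by
    rw [div_le_iff₀ hQpos]
    have : (Q0:ℝ) ≤ Q := by exact_mod_cast (by omega)
    have h2 : 1 < Q0 * γ := by rwa [div_lt_iff₀ hγ] at hQ0
    nlinarith
  have hlim := tendsto_pow_const_mul_const_pow_of_abs_lt_one 3 (r := (999/1000 : ℝ)) (by norm_num [abs_of_pos])
  have hev := hlim.eventually (gt_mem_nhds (show (0:ℝ) < 1 / (4 * Q) ^ 3 by positivity))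
  obtain ⟨t0, ht0⟩ := Filter.eventually_atTop.1 hev
  refine ⟨1 / (2000 * Q), by positivity, 2 * Q * (t0 + 1) + 100000, fun n hn H hH => ?_⟩
  have hn0 : (100000:ℝ) ≤ n := by exact_mod_cast (by omega)
  -- counting
  have hc : ∀ T, (1 / 250 : ℝ) * n ^ 6 ≤ #{p : (Fin 3 → Fin n) × (Fin 3 → Fin n) | Good H p ∧ Abs H T p} := by
    intro T
    have hd : ∀ i v, ⌈(55 / 100 : ℝ) * n ^ 2⌉₊ ≤ dg H i v := fun i v => Nat.ceil_le.2 (hH i v)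
    have hdl := Nat.le_ceil ((55 / 100 : ℝ) * n ^ 2)
    have hcl := Nat.lt_floor_add_one ((1 / 10 : ℝ) * n ^ 2)
    have hcl' := Nat.floor_le (show 0 ≤ (1 / 10 : ℝ) * n ^ 2 by positivity)
    have := count_abs H ⌈(55 / 100 : ℝ) * n ^ 2⌉₊ ⌊(1 / 10 : ℝ) * n ^ 2⌋₊ (by
      have : ((n ^ 2 + ⌊(1 / 10 : ℝ) * n ^ 2⌋₊ : ℕ) : ℝ) ≤ (2 * ⌈(55 / 100 : ℝ) * n ^ 2⌉₊ : ℕ) := by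
        push_cast; linarith
      exact_mod_cast this) hd T
    have h1 : (⌈(55 / 100 : ℝ) * n ^ 2⌉₊ : ℝ) * (⌊(1 / 10 : ℝ) * n ^ 2⌋₊ * ⌊(1 / 10 : ℝ) * n ^ 2⌋₊) ≤
      #{p : (Fin 3 → Fin n) × (Fin 3 → Fin n) | Good H p ∧ Abs H T p} + 3 * n ^ 5 := by exact_mod_cast this
    have h2 : (9 / 100 : ℝ) * n ^ 2 ≤ ⌊(1 / 10 : ℝ) * n ^ 2⌋₊ := by nlinarith
    have h3 : (55 / 100 : ℝ) * n ^ 2 * ((9 / 100 : ℝ) * n ^ 2 * ((9 / 100 : ℝ) * n ^ 2)) ≤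
      (⌈(55 / 100 : ℝ) * n ^ 2⌉₊ : ℝ) * (⌊(1 / 10 : ℝ) * n ^ 2⌋₊ * ⌊(1 / 10 : ℝ) * n ^ 2⌋₊) := by
      gcongr
    have h4 : (100000 : ℝ) * n ^ 5 ≤ n ^ 6 := by
      have : (0:ℝ) ≤ n ^ 5 := by positivity
      nlinarith
    nlinarith
  -- iterate
  have iter : ∀ k : ℕ, 6000 * k ≤ n + 6000 → ∃ A, IsAF H A ∧ #A = k ∧
      (∑ T : Fin 3 → Fin n, (1 / 2 : ℝ) ^ #{p ∈ A | Abs H T p}) ≤ (999 / 1000) ^ k * n ^ 3 := by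
    intro k
    induction k with
    | zero =>
      intro _
      refine ⟨∅, ⟨by simp, by simp⟩, rfl, ?_⟩
      simp
    | succ k ih =>
      intro hk
      obtain ⟨A, hA, hAk, hs⟩ := ih (by omega)
      obtain ⟨A', hA', hk', hs'⟩ := step (by omega) H A hA (by omega) hc
      refine ⟨A', hA', by omega, hs'.trans ?_⟩
      rw [pow_succ]
      linarith
  set t := n / (2 * Q) with ht
  have htn : 2 * Q * t ≤ n := Nat.mul_div_le n (2 * Q)
  have htn' : n < 2 * Q * (t + 1) := by
    have := Nat.lt_mul_div_succ n (show 0 < 2 * Q by omega)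
    simpa using this
  have htt : t0 + 1 ≤ t := (Nat.le_div_iff_mul_le (by omega)).2 (by nlinarith)
  obtain ⟨A, hA, hAk, hs⟩ := iter (2 * t) (by nlinarith)
  refine ⟨A, hA, ?_, ?_⟩
  · rw [hAk]
    have h1 : (2 * Q * t : ℝ) ≤ n := by exact_mod_cast htn
    have h2 : ((2 * t : ℕ) : ℝ) ≤ 1 / Q * n := by
      rw [div_mul_eq_mul_div, le_div_iff₀ hQpos]; push_cast; linarith
    exact h2.trans (by gcongr)
  · intro T
    by_contra hlt
    push Not at hlt
    set a := #{p ∈ A | Abs H T p} with ha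
    have h1 : (n : ℝ) < 2 * Q * (t + 1) := by exact_mod_cast htn'
    have h2 : 1000 * a < t + 1 := by
      have : (1000 * a : ℝ) < t + 1 := by
        have h3 : 1 / (2000 * Q) * n < 1 / (2000 * Q) * (2 * Q * (t + 1 : ℝ)) := by gcongr
        have h4 : 1 / (2000 * Q) * (2 * Q * (t + 1 : ℝ)) = (t + 1) / 1000 := by
          field_simp; ring
        linarith
      exact_mod_cast this
    have h3 : (1 / 2 : ℝ) ^ a ≤ (999 / 1000) ^ (2 * t) * n ^ 3 := by
      refine le_trans ?_ hs
      exact single_le_sum (f := fun T => (1 / 2 : ℝ) ^ #{p ∈ A | Abs H T p})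
        (fun T _ => by positivity) (mem_univ T)
    have h4 : (999 / 1000 : ℝ) ^ 1000 ≤ 1 / 2 := by
      have h0 : (999 / 1000 : ℝ) ^ 250 ≤ 4 / 5 := by norm_num
      calc (999 / 1000 : ℝ) ^ 1000 = ((999 / 1000 : ℝ) ^ 250) ^ 4 := by rw [← pow_mul]
        _ ≤ (4 / 5) ^ 4 := pow_le_pow_left₀ (by positivity) h0 4
        _ ≤ _ := by norm_num
    have h5 : (999 / 1000 : ℝ) ^ t ≤ (1 / 2) ^ a := by
      calc (999 / 1000 : ℝ) ^ t ≤ (999 / 1000 : ℝ) ^ (1000 * a) :=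
            pow_le_pow_of_le_one (by norm_num) (by norm_num) (by omega)
        _ = ((999 / 1000 : ℝ) ^ 1000) ^ a := pow_mul _ _ _
        _ ≤ _ := pow_le_pow_left₀ (by positivity) h4 a
    have h6 : (999 / 1000 : ℝ) ^ t ≤ (999 / 1000) ^ t * ((999 / 1000) ^ t * n ^ 3) := by
      refine (h5.trans h3).trans (le_of_eq ?_); rw [two_mul, pow_add]; ring
    have hp : (0:ℝ) < (999 / 1000) ^ t := by positivity
    have h7 : 1 ≤ (999 / 1000 : ℝ) ^ t * n ^ 3 := by
      by_contra h; push Not at h; nlinarith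
    have h8 := ht0 t (by omega)
    have h9 : (n : ℝ) ≤ 4 * Q * t := by
      have : (1:ℝ) ≤ t := by exact_mod_cast (by omega)
      nlinarith
    have h10 : (n:ℝ) ^ 3 ≤ (4 * Q * t) ^ 3 := by gcongr
    have h11 : (t : ℝ) ^ 3 * (999 / 1000) ^ t * (4 * Q) ^ 3 < 1 := by
      rwa [lt_div_iff₀ (by positivity)] at h8
    have h12 : (999 / 1000 : ℝ) ^ t * n ^ 3 ≤ (999 / 1000 : ℝ) ^ t * (4 * Q * t) ^ 3 := by gcongr
    have h13 : (999 / 1000 : ℝ) ^ t * (4 * Q * t) ^ 3 = (t : ℝ) ^ 3 * (999 / 1000) ^ t * (4 * Q) ^ 3 := by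
      ring
    linarith

end LM

namespace LM

/-- A set of ordered pairs forming a graph matching. -/
def GM {V : Type*} (G : SimpleGraph V) (F : Finset (V × V)) : Prop :=
  (∀ p ∈ F, G.Adj p.1 p.2) ∧
    ∀ p ∈ F, ∀ q ∈ F, p ≠ q → p.1 ≠ q.1 ∧ p.1 ≠ q.2 ∧ p.2 ≠ q.1 ∧ p.2 ≠ q.2

/-- Adding `d` universal vertices. -/
def addU {V : Type} (G : SimpleGraph V) (d : ℕ) : SimpleGraph (V ⊕ Fin d) where
  Adj x y := x ≠ y ∧ ∀ a b, x = Sum.inl a → y = Sum.inl b → G.Adj a b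
  symm := ⟨fun x y h => ⟨h.1.symm, fun a b ha hb => (h.2 b a hb ha).symm⟩⟩
  loopless := ⟨fun x h => h.1 rfl⟩

lemma gm_of_pm {V : Type} [Fintype V] (G : SimpleGraph V) (t d : ℕ)
    (hd : d + 2 * t = Fintype.card V) (M : (addU G d).Subgraph) (hM : M.IsPerfectMatching) :
    ∃ F, GM G F ∧ #F = t := by
  classical
  let _ : LinearOrder V := linearOrderOfSTO (WellOrderingRel (α := V))
  have hex : ∀ x, ∃ y, M.Adj x y := fun x => (hM.1 (hM.2 x)).exists
  have hun : ∀ {x y z}, M.Adj x y → M.Adj x z → y = z := fun h1 h2 => hM.1.eq_of_adj_left h1 h2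
  set F : Finset (V × V) := {p | M.Adj (Sum.inl p.1) (Sum.inl p.2) ∧ p.1 < p.2} with hF
  have hgm : GM G F := by
    constructor
    · intro p hp
      have := ((mem_filter.1 hp).2.1).adj_sub
      exact this.2 _ _ rfl rfl
    · intro p hp q hq hpq
      have hp' := (mem_filter.1 hp).2
      have hq' := (mem_filter.1 hq).2
      refine ⟨fun h => hpq ?_, fun h => ?_, fun h => ?_, fun h => hpq ?_⟩
      · refine Prod.ext h ?_
        have := hp'.1; rw [h] at this
        exact Sum.inl_injective (hun this hq'.1)
      · have := hp'.1; rw [h] at this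
        have h2 := Sum.inl_injective (hun this hq'.1.symm)
        exact absurd (hp'.2.trans (h2 ▸ h ▸ hq'.2)) (lt_irrefl _)
      · have := hp'.1.symm; rw [h] at this
        have h2 := Sum.inl_injective (hun this hq'.1)
        have h3 := hp'.2
        have h4 := hq'.2
        rw [h2, h] at h3
        exact absurd (h3.trans h4) (lt_irrefl _)
      · refine Prod.ext ?_ h
        have := hp'.1.symm; rw [h] at this
        exact Sum.inl_injective (hun this hq'.1.symm)
  set X : Finset V := {a | ∃ b, M.Adj (Sum.inl a) (Sum.inl b)} with hX
  have hXF : X ⊆ F.image Prod.fst ∪ F.image Prod.snd := by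
    intro a ha
    obtain ⟨b, hb⟩ := (mem_filter.1 ha).2
    have hne : a ≠ b := fun h => by
      subst h; exact hb.ne rfl
    rcases lt_or_gt_of_ne hne with h | h
    · exact mem_union_left _ (mem_image.2 ⟨(a, b), mem_filter.2 ⟨mem_univ _, hb, h⟩, rfl⟩)
    · exact mem_union_right _ (mem_image.2 ⟨(b, a), mem_filter.2 ⟨mem_univ _, hb.symm, h⟩, rfl⟩)
  have hXc : #Xᶜ ≤ d := by
    have : ∀ a ∈ Xᶜ, ∃ j : Fin d, M.Adj (Sum.inl a) (Sum.inr j) := by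
      intro a ha
      obtain ⟨y, hy⟩ := hex (Sum.inl a)
      cases y with
      | inl b => exact absurd (mem_filter.2 ⟨mem_univ _, b, hy⟩) (mem_compl.1 ha)
      | inr j => exact ⟨j, hy⟩
    rcases Nat.eq_zero_or_pos d with h0 | h0
    · subst h0
      rw [Nat.le_zero, card_eq_zero, eq_empty_iff_forall_notMem]
      intro a ha
      obtain ⟨j, _⟩ := this a ha
      exact j.elim0
    have _ne : Nonempty (Fin d) := ⟨⟨0, h0⟩⟩
    choose! j hj using this
    have h1 : #Xᶜ ≤ #(univ : Finset (Fin d)) := by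
      apply card_le_card_of_injOn j (fun _ _ => mem_univ _)
      intro a ha b hb hab
      have h1 := (hj a ha).symm
      have h2 := (hj b hb).symm
      rw [hab] at h1
      exact Sum.inl_injective (hun h1 h2)
    simpa using h1
  have h1 := card_compl X
  have h2 := card_le_univ X
  have h3 := (card_le_card hXF).trans (card_union_le _ _)
  have h4 := card_image_le (s := F) (f := Prod.fst)
  have h5 := card_image_le (s := F) (f := Prod.snd)
  obtain ⟨F', hF', hc⟩ := exists_subset_card_eq (show t ≤ #F by omega)
  exact ⟨F', ⟨fun p hp => hgm.1 p (hF' hp), fun p hp q hq => hgm.2 p (hF' hp) q (hF' hq)⟩, hc⟩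

lemma tutte_berge {V : Type} [Fintype V] [DecidableEq V] (G : SimpleGraph V) [DecidableRel G.Adj]
    (t d K : ℕ) (hd : d + 2 * t = Fintype.card V)
    (hno : ¬ ∃ F, GM G F ∧ #F = t) :
    ∃ S R : Finset V, Disjoint S R ∧ K * (#S + d) ≤ K * #R + Fintype.card V ∧
      ∀ x ∈ R, #{y | y ∉ S ∧ G.Adj x y} ≤ K := by
  classical
  have hno' : ¬ ∃ M : (addU G d).Subgraph, M.IsPerfectMatching := fun ⟨M, hM⟩ =>
    hno (gm_of_pm G t d hd M hM)
  rw [SimpleGraph.tutte] at hno'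
  push Not at hno'
  obtain ⟨u, hu⟩ := hno'
  unfold SimpleGraph.IsTutteViolator at hu
  set C := ((⊤ : (addU G d).Subgraph).deleteVerts u).coe with hC
  have hmem : ∀ x, x ∈ ((⊤ : (addU G d).Subgraph).deleteVerts u).verts ↔ x ∉ u := by
    intro x; simp
  have hadj : ∀ x y (hx : x ∉ u) (hy : y ∉ u), (addU G d).Adj x y →
      C.Adj ⟨x, (hmem x).2 hx⟩ ⟨y, (hmem y).2 hy⟩ := by
    intro x y hx hy h
    simp [hC, SimpleGraph.Subgraph.deleteVerts_adj, hx, hy, h]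
  -- all universal vertices lie in u
  have huniv : ∀ j : Fin d, Sum.inr j ∈ u := by
    intro j
    by_contra hj
    have hall : ∀ x, C.connectedComponentMk x = C.connectedComponentMk ⟨Sum.inr j, (hmem _).2 hj⟩ := by
      rintro ⟨x, hx⟩
      by_cases hxj : x = Sum.inr j
      · subst hxj; rfl
      · refine SimpleGraph.ConnectedComponent.sound (SimpleGraph.Adj.reachable ?_)
        refine hadj x _ ((hmem x).1 hx) hj ⟨hxj, ?_⟩
        intro a b _ hb; cases hb
    have hsub : C.oddComponents.Subsingleton := by
      intro c _ c' _
      induction c using SimpleGraph.ConnectedComponent.ind with | _ x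
      induction c' using SimpleGraph.ConnectedComponent.ind with | _ y
      rw [hall x, hall y]
    have h1 : C.oddComponents.ncard ≤ 1 := Set.ncard_le_one_iff_subsingleton.2 hsub
    have h2 : u.ncard = 0 := by omega
    have h3 : C.oddComponents.ncard = 1 := by omega
    have h4 := (SimpleGraph.odd_ncard_oddComponents (G := C)).1 (by rw [h3]; exact odd_one)
    have h5 : u = ∅ := (Set.ncard_eq_zero (Set.toFinite u)).1 h2
    subst h5
    have h6 : Nat.card ↥((⊤ : (addU G d).Subgraph).deleteVerts ∅).verts = Fintype.card V + d := by
      simp [Nat.card_eq_fintype_card]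
    rw [h6, ← hd] at h4
    rcases h4 with ⟨m, hm⟩; omega
  set S : Finset V := {a | Sum.inl a ∈ u} with hS
  have hSu : #S + d ≤ u.ncard := by
    rw [Set.ncard_eq_toFinset_card']
    have : S.disjSum (univ : Finset (Fin d)) ⊆ u.toFinset := by
      intro x hx
      rw [Set.mem_toFinset]
      rcases x with a | j
      · simpa [hS] using hx
      · exact huniv j
    have := card_le_card this
    simpa using this
  have hrep : ∀ c : C.ConnectedComponent, ∃ a : V, ∃ h : Sum.inl a ∉ u,
      C.connectedComponentMk ⟨Sum.inl a, (hmem _).2 h⟩ = c := by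
    intro c
    induction c using SimpleGraph.ConnectedComponent.ind with | _ x
    obtain ⟨x, hx⟩ := x
    rcases x with a | j
    · exact ⟨a, (hmem _).1 hx, rfl⟩
    · exact absurd (huniv j) ((hmem _).1 hx)
  choose rep hrepu hrepc using hrep
  have hrinj : Function.Injective rep := by
    intro c c' h
    rw [← hrepc c, ← hrepc c']
    congr 1
    exact Subtype.ext (congrArg Sum.inl h)
  let T : C.ConnectedComponent → Finset V := fun c =>
    {a | ∃ h : Sum.inl a ∉ u, C.connectedComponentMk ⟨Sum.inl a, (hmem _).2 h⟩ = c}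
  set O : Finset C.ConnectedComponent := C.oddComponents.toFinset with hO
  have hOc : C.oddComponents.ncard = #O := Set.ncard_eq_toFinset_card' _
  set sm := {c ∈ O | #(T c) ≤ K} with hsm
  set bg := {c ∈ O | ¬ #(T c) ≤ K} with hbg
  have hsb : #sm + #bg = #O := card_filter_add_card_filter_not _
  have hbgK : K * #bg ≤ Fintype.card V := by
    have h1 : #(bg.biUnion T) = ∑ c ∈ bg, #(T c) := by
      apply card_biUnion
      intro c _ c' _ hcc
      rw [Function.onFun, disjoint_left]
      intro a ha ha'
      obtain ⟨h, h'⟩ := (mem_filter.1 ha).2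
      obtain ⟨k, k'⟩ := (mem_filter.1 ha').2
      exact hcc (h'.symm.trans k')
    have h2 : ∑ c ∈ bg, K ≤ ∑ c ∈ bg, #(T c) := sum_le_sum fun c hc => by
      have := (mem_filter.1 hc).2; omega
    have h3 := card_le_univ (bg.biUnion T)
    simp only [sum_const, smul_eq_mul] at h2
    rw [mul_comm]; omega
  refine ⟨S, sm.image rep, ?_, ?_, ?_⟩
  · rw [disjoint_left]
    intro a ha ha'
    obtain ⟨c, _, rfl⟩ := mem_image.1 ha'
    exact hrepu c (mem_filter.1 ha).2
  · rw [card_image_of_injective _ hrinj]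
    have : #S + d ≤ #sm + #bg := by omega
    calc K * (#S + d) ≤ K * (#sm + #bg) := Nat.mul_le_mul_left _ this
      _ = K * #sm + K * #bg := by ring
      _ ≤ _ := by omega
  · intro x hx
    obtain ⟨c, hc, rfl⟩ := mem_image.1 hx
    refine le_trans (card_le_card ?_) (mem_filter.1 hc).2
    intro y hy
    obtain ⟨hyS, hya⟩ := (mem_filter.1 hy).2
    have hyu : Sum.inl y ∉ u := fun h => hyS (mem_filter.2 ⟨mem_univ _, h⟩)
    refine mem_filter.2 ⟨mem_univ _, hyu, ?_⟩
    rw [← hrepc c]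
    refine SimpleGraph.ConnectedComponent.sound (SimpleGraph.Adj.reachable ?_)
    refine hadj _ _ hyu (hrepu c) ⟨fun h => hya.ne (Sum.inl_injective h).symm, ?_⟩
    intro a b ha hb
    cases ha; cases hb; exact hya.symm

end LM

namespace LM

section chunk
variable {ι : Type*} {N : ℕ} (E : Finset ι) (a b : ι → Fin N)

/-- edges inside S -/
def eI (S : Finset (Fin N)) : ℕ := #{f ∈ E | a f ∈ S ∧ b f ∈ S}
/-- edges between S and T -/
def eX (S T : Finset (Fin N)) : ℕ := #{f ∈ E | (a f ∈ S ∧ b f ∈ T) ∨ (a f ∈ T ∧ b f ∈ S)}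

lemma eI_union {S T : Finset (Fin N)} (h : Disjoint S T) :
    eI E a b (S ∪ T) = eI E a b S + eI E a b T + eX E a b S T := by
  classical
  unfold eI eX
  rw [← card_union_of_disjoint, ← card_union_of_disjoint]
  · congr 1
    ext f
    simp only [mem_filter, mem_union]
    tauto
  · rw [disjoint_left]
    intro f hf hf'
    simp only [mem_filter, mem_union] at hf hf'
    have h1 := fun x (hx : x ∈ S) => disjoint_left.1 h hx
    rcases hf with hf | hf <;> rcases hf' with ⟨_, hf' | hf'⟩
    · exact h1 _ hf.2.2 hf'.2
    · exact h1 _ hf.2.1 hf'.1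
    · exact h1 _ hf'.1 hf.2.1
    · exact h1 _ hf'.2 hf.2.2
  · rw [disjoint_left]
    intro f hf hf'
    simp only [mem_filter] at hf hf'
    exact disjoint_left.1 h hf.2.1 hf'.2.1

lemma eX_mono {S T T' : Finset (Fin N)} (h : T ⊆ T') : eX E a b S T ≤ eX E a b S T' := by
  classical
  unfold eX
  apply card_le_card
  intro f
  simp only [mem_filter]
  rintro ⟨h1, h2 | h2⟩
  · exact ⟨h1, Or.inl ⟨h2.1, h h2.2⟩⟩
  · exact ⟨h1, Or.inr ⟨h h2.1, h2.2⟩⟩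

lemma eX_union_le {S T T' : Finset (Fin N)} :
    eX E a b S (T ∪ T') ≤ eX E a b S T + eX E a b S T' := by
  classical
  unfold eX
  refine le_trans (card_le_card ?_) (card_union_le _ _)
  intro f
  simp only [mem_filter, mem_union]
  tauto

lemma eX_biUnion_le {κ : Type*} [DecidableEq κ] {S : Finset (Fin N)} (P : Finset κ)
    (T : κ → Finset (Fin N)) (m : ℕ) (hm : ∀ x ∈ P, eX E a b S (T x) ≤ m) :
    eX E a b S (P.biUnion T) ≤ #P * m := by
  induction P using Finset.induction_on with
  | empty => simp [eX]
  | insert x P hx ih =>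
    rw [biUnion_insert, card_insert_of_notMem hx]
    have h1 := eX_union_le E a b (S := S) (T := T x) (T' := P.biUnion T)
    have h2 := hm x (mem_insert_self _ _)
    have h3 := ih fun y hy => hm y (mem_insert_of_mem hy)
    have : (#P + 1) * m = #P * m + m := by ring
    omega

/-- class of a label -/
def cls (lab : Fin N → Fin N) (x : Fin N) : Finset (Fin N) := {k | lab k = x}

lemma cls_disj (lab : Fin N → Fin N) {x y : Fin N} (h : x ≠ y) :
    Disjoint (cls lab x) (cls lab y) := by
  rw [disjoint_left]
  intro k hk hk'
  simp only [cls, mem_filter, mem_univ, true_and] at hk hk'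
  exact h (hk.symm.trans hk')

lemma cls_disj_bi (lab : Fin N → Fin N) {x : Fin N} {P : Finset (Fin N)} (h : x ∉ P) :
    Disjoint (cls lab x) (P.biUnion (cls lab)) := by
  rw [disjoint_biUnion_right]
  intro y hy
  exact cls_disj lab fun hh => h (hh ▸ hy)

lemma exists_lab (L : ℕ) (hL : 1 ≤ L) : ∃ lab : Fin N → Fin N,
    (∀ x, #(cls lab x) ≤ L ∧ #(cls lab x) ≤ eI E a b (cls lab x) + 1) ∧
    ∀ x y, x ≠ y → 0 < eX E a b (cls lab x) (cls lab y) → L < #(cls lab x) + #(cls lab y) := by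
  classical
  obtain ⟨lab, hlab, hmin⟩ := exists_min_image
    ({lab | ∀ x, #(cls lab x) ≤ L ∧ #(cls lab x) ≤ eI E a b (cls lab x) + 1} : Finset (Fin N → Fin N))
    (fun lab => #(univ.image lab)) ⟨id, by
      simp only [mem_filter, mem_univ, true_and]
      intro x
      have : cls id x = {x} := by ext k; simp [cls]
      rw [this, card_singleton]; omega⟩
  simp only [mem_filter, mem_univ, true_and] at hlab hmin
  refine ⟨lab, hlab, fun x y hxy hpos => ?_⟩
  by_contra hle
  push Not at hle
  let lab' : Fin N → Fin N := fun k => if lab k = y then x else lab k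
  have cx : cls lab' x = cls lab x ∪ cls lab y := by
    ext k
    simp only [cls, mem_filter, mem_univ, true_and, mem_union, lab']
    split_ifs with h
    · simp [h]
    · simp [h]
  have cy : cls lab' y = ∅ := by
    ext k
    simp only [cls, mem_filter, mem_univ, true_and, lab', notMem_empty, iff_false]
    split_ifs with h
    · exact hxy
    · exact h
  have cz : ∀ z, z ≠ x → z ≠ y → cls lab' z = cls lab z := by
    intro z hzx hzy
    ext k
    simp only [cls, mem_filter, mem_univ, true_and, lab']
    split_ifs with h
    · rw [h]; exact ⟨fun h => absurd h.symm hzx, fun h => absurd h.symm hzy⟩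
    · rfl
  have hgood : ∀ z, #(cls lab' z) ≤ L ∧ #(cls lab' z) ≤ eI E a b (cls lab' z) + 1 := by
    intro z
    by_cases hzx : z = x
    · subst hzx
      rw [cx, eI_union E a b (cls_disj lab hxy), card_union_of_disjoint (cls_disj lab hxy)]
      have h1 := (hlab z).2
      have h2 := (hlab y).2
      omega
    by_cases hzy : z = y
    · subst hzy; rw [cy]; simp
    · rw [cz z hzx hzy]; exact hlab z
  have hm := hmin lab' hgood
  have hxe : (cls lab x).Nonempty ∧ (cls lab y).Nonempty := by
    obtain ⟨f, hf⟩ := card_pos.1 hpos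
    simp only [mem_filter] at hf
    rcases hf.2 with h | h
    · exact ⟨⟨_, h.1⟩, ⟨_, h.2⟩⟩
    · exact ⟨⟨_, h.2⟩, ⟨_, h.1⟩⟩
  obtain ⟨⟨kx, hkx⟩, ⟨ky, hky⟩⟩ := hxe
  simp only [cls, mem_filter, mem_univ, true_and] at hkx hky
  have hlt : univ.image lab' ⊂ univ.image lab := by
    refine (Finset.ssubset_iff_of_subset ?_).2 ⟨y, mem_image.2 ⟨ky, mem_univ _, hky⟩, ?_⟩
    · intro z hz
      obtain ⟨k, _, rfl⟩ := mem_image.1 hz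
      simp only [lab']
      split_ifs
      · exact mem_image.2 ⟨kx, mem_univ _, hkx⟩
      · exact mem_image_of_mem _ (mem_univ _)
    · intro hy
      obtain ⟨k, _, hk⟩ := mem_image.1 hy
      have : k ∈ cls lab' y := by simp [cls, hk]
      rw [cy] at this
      exact absurd this (notMem_empty _)
  have := card_lt_card hlt
  omega

set_option maxHeartbeats 1000000 in
lemma chunk_aux (L g : ℕ) (hL : 1 ≤ L) (hg : 2 * N ≤ g * L)
    (hE : N + 2 * g ^ 2 + 4 * g ^ 3 < #E) :
    ∃ S : Finset (Fin N), #S ≤ 4 * L ∧ #S < eI E a b S := by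
  classical
  by_contra hcon
  push Not at hcon
  obtain ⟨C, hCd, hCdb, hCu, hlab, hadj⟩ : ∃ C : Fin N → Finset (Fin N),
      (∀ {x y}, x ≠ y → Disjoint (C x) (C y)) ∧
      (∀ {x : Fin N} {P : Finset (Fin N)}, x ∉ P → Disjoint (C x) (P.biUnion C)) ∧
      (univ : Finset (Fin N)).biUnion C = univ ∧
      (∀ x, #(C x) ≤ L ∧ #(C x) ≤ eI E a b (C x) + 1) ∧
      ∀ x y, x ≠ y → 0 < eX E a b (C x) (C y) → L < #(C x) + #(C y) := by
    obtain ⟨lab, hlab, hadj⟩ := exists_lab E a b L hL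
    exact ⟨cls lab, fun h => cls_disj lab h, fun h => cls_disj_bi lab h,
      by ext k; simp [cls], hlab, hadj⟩
  set B : Finset (Fin N) := {x | L < 2 * #(C x)} with hB
  have hsum : ∀ P : Finset (Fin N), ∑ x ∈ P, #(C x) = #(P.biUnion C) := by
    intro P
    rw [card_biUnion]
    intro x _ y _ h
    exact hCd h
  have hBg : #B ≤ g := by
    have h1 : ∑ x ∈ B, L ≤ ∑ x ∈ B, 2 * #(C x) := sum_le_sum fun x hx => (mem_filter.1 hx).2.le
    rw [← mul_sum, hsum, sum_const, smul_eq_mul] at h1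
    have h2 := card_le_univ (B.biUnion C)
    rw [Fintype.card_fin] at h2
    have : #B * L ≤ g * L := by omega
    exact Nat.le_of_mul_le_mul_right this (by omega)
  -- at most two edges between two classes
  have hX2 : ∀ x y, x ≠ y → eX E a b (C x) (C y) ≤ 2 := by
    intro x y hxy
    have h1 := hcon (C x ∪ C y)
    rw [eI_union E a b (hCd hxy), card_union_of_disjoint (hCd hxy)] at h1
    have h2 := hlab x
    have h3 := hlab y
    have := h1 (by omega)
    omega
  have hI : ∀ x, eI E a b (C x) ≤ #(C x) := fun x => hcon (C x) (by have := hlab x; omega)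
  have hss : ∀ x y, x ≠ y → x ∉ B → y ∉ B → eX E a b (C x) (C y) = 0 := by
    intro x y hxy hx hy
    by_contra h
    have := hadj x y hxy (Nat.pos_of_ne_zero h)
    simp only [hB, mem_filter, mem_univ, true_and] at hx hy
    omega
  -- bad classes
  set bad : Finset (Fin N) := {x | x ∉ B ∧ #(C x) < eI E a b (C x) + eX E a b (C x) (B.biUnion C)} with hbad
  have hpair : ∀ x ∈ bad, ∃ p ∈ B ×ˢ B,
      #(C x) < eI E a b (C x) + eX E a b (C x) (C p.1 ∪ C p.2) := by
    intro x hx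
    obtain ⟨hxB, hxe⟩ := (mem_filter.1 hx).2
    have h1 := hlab x
    have hother : ∀ f ∈ E, (a f ∈ C x ∧ b f ∈ B.biUnion C) ∨ (a f ∈ B.biUnion C ∧ b f ∈ C x) →
        ∃ D ∈ B, (a f ∈ C x ∧ b f ∈ C D) ∨ (a f ∈ C D ∧ b f ∈ C x) := by
      intro f _ hf
      simp only [mem_biUnion] at hf
      rcases hf with ⟨h, D, hD, h'⟩ | ⟨⟨D, hD, h'⟩, h⟩
      · exact ⟨D, hD, Or.inl ⟨h, h'⟩⟩
      · exact ⟨D, hD, Or.inr ⟨h', h⟩⟩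
    by_cases hc : #(C x) ≤ eI E a b (C x)
    · have : 0 < eX E a b (C x) (B.biUnion C) := by have := hI x; omega
      obtain ⟨f, hf⟩ := card_pos.1 this
      obtain ⟨hfE, hf⟩ := mem_filter.1 hf
      obtain ⟨D, hD, hfD⟩ := hother f hfE hf
      refine ⟨(D, D), mem_product.2 ⟨hD, hD⟩, ?_⟩
      have : 0 < eX E a b (C x) (C D ∪ C D) := card_pos.2 ⟨f, mem_filter.2 ⟨hfE, by simpa using hfD⟩⟩
      change _ < _ + eX E a b (C x) (C D ∪ C D)
      omega
    · have : 1 < eX E a b (C x) (B.biUnion C) := by omega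
      obtain ⟨f, hf, f', hf', hne⟩ := one_lt_card.1 this
      obtain ⟨hfE, hf⟩ := mem_filter.1 hf
      obtain ⟨hfE', hf'⟩ := mem_filter.1 hf'
      obtain ⟨D, hD, hfD⟩ := hother f hfE hf
      obtain ⟨D', hD', hfD'⟩ := hother f' hfE' hf'
      refine ⟨(D, D'), mem_product.2 ⟨hD, hD'⟩, ?_⟩
      have : 1 < eX E a b (C x) (C D ∪ C D') := one_lt_card.2
        ⟨f, mem_filter.2 ⟨hfE, hfD.imp (fun h => ⟨h.1, mem_union_left _ h.2⟩) (fun h => ⟨mem_union_left _ h.1, h.2⟩)⟩,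
         f', mem_filter.2 ⟨hfE', hfD'.imp (fun h => ⟨h.1, mem_union_right _ h.2⟩) (fun h => ⟨mem_union_right _ h.1, h.2⟩)⟩, hne⟩
      change _ < _ + eX E a b (C x) (C D ∪ C D')
      omega
  choose! pr hprB hpr using hpair
  have hbadc : #bad ≤ 2 * g ^ 2 := by
    by_contra hlt
    push Not at hlt
    have h1 : #(B ×ˢ B) * 2 < #bad := by
      rw [card_product]
      have := Nat.mul_le_mul hBg hBg
      nlinarith
    obtain ⟨p, hp, hfib⟩ := exists_lt_card_fiber_of_mul_lt_card_of_maps_to hprB h1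
    obtain ⟨x, y, z, hx, hy, hz, hxy, hxz, hyz⟩ := two_lt_card_iff.1 hfib
    obtain ⟨hp1, hp2⟩ := mem_product.1 hp
    have hgain : ∀ w, w ∈ ({x ∈ bad | pr x = p} : Finset _) → w ∉ B ∧ 2 * #(C w) ≤ L ∧
        ∀ S, Disjoint (C w) S → C p.1 ∪ C p.2 ⊆ S →
        eI E a b S + #(C w) + 1 ≤ eI E a b (C w ∪ S) := by
      intro w hw
      obtain ⟨hwb, hwp⟩ := mem_filter.1 hw
      have h2 := hpr w hwb
      rw [hwp] at h2
      have hwB := (mem_filter.1 hwb).2.1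
      refine ⟨hwB, by simpa [hB] using hwB, ?_⟩
      intro S hS hsub
      rw [eI_union E a b hS]
      have := eX_mono E a b (S := C w) hsub
      omega
    obtain ⟨hxB, hxL, hxg⟩ := hgain x hx
    obtain ⟨hyB, hyL, hyg⟩ := hgain y hy
    obtain ⟨hzB, hzL, hzg⟩ := hgain z hz
    have hne : ∀ w, w ∉ B → w ≠ p.1 ∧ w ≠ p.2 := fun w hw =>
      ⟨fun h => hw (h ▸ hp1), fun h => hw (h ▸ hp2)⟩
    set S0 := C p.1 ∪ C p.2 with hS0
    have h00 : #S0 ≤ eI E a b S0 + 2 := by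
      by_cases hpp : p.1 = p.2
      · rw [hS0, hpp, union_self]
        have := (hlab p.2).2
        omega
      · rw [hS0, eI_union E a b (hCd hpp), card_union_of_disjoint (hCd hpp)]
        have h1 := (hlab p.1).2
        have h2 := (hlab p.2).2
        omega
    have hS0c : #S0 ≤ 2 * L := by
      have h1 := (hlab p.1).1
      have h2 := (hlab p.2).1
      have h3 : #S0 ≤ #(C p.1) + #(C p.2) := card_union_le (C p.1) (C p.2)
      omega
    have hd : ∀ w, w ∉ B → Disjoint (C w) S0 := fun w hw => by
      rw [hS0, disjoint_union_right]
      exact ⟨hCd (hne w hw).1, hCd (hne w hw).2⟩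
    have d1 := hd x hxB
    have d2 : Disjoint (C y) (C x ∪ S0) := disjoint_union_right.2 ⟨hCd hxy.symm, hd y hyB⟩
    have d3 : Disjoint (C z) (C y ∪ (C x ∪ S0)) := disjoint_union_right.2
      ⟨hCd hyz.symm, disjoint_union_right.2 ⟨hCd hxz.symm, hd z hzB⟩⟩
    have g1 := hxg S0 d1 subset_rfl
    have g2 := hyg _ d2 subset_union_right
    have g3 := hzg _ d3 (subset_union_right.trans subset_union_right)
    have c1 := card_union_of_disjoint d1
    have c2 := card_union_of_disjoint d2
    have c3 := card_union_of_disjoint d3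
    have := hcon (C z ∪ (C y ∪ (C x ∪ S0))) (by omega)
    omega
  -- total count
  have hXB : ∀ x, x ∉ B → eX E a b (C x) (B.biUnion C) ≤ 2 * g := by
    intro x hx
    have := eX_biUnion_le E a b B C 2 (S := C x) (fun y hy => hX2 x y fun h => hx (h ▸ hy))
    omega
  have hPB : ∀ P : Finset (Fin N), P ⊆ B → eI E a b (P.biUnion C) ≤ ∑ x ∈ P, (#(C x) + 2 * g) := by
    intro P
    induction P using Finset.induction_on with
    | empty => intro _; simp [eI]
    | insert x P hx ih =>
      intro hP
      rw [biUnion_insert, eI_union E a b (hCdb hx), sum_insert hx]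
      have h1 := ih fun y hy => hP (mem_insert_of_mem hy)
      have h2 := eX_biUnion_le E a b P C 2 (S := C x) (fun y hy => hX2 x y fun h => hx (h ▸ hy))
      have h3 := hI x
      have h4 : #P ≤ #B := card_le_card fun y hy => hP (mem_insert_of_mem hy)
      omega
  have hQ : ∀ Q : Finset (Fin N), Disjoint Q B → eI E a b ((Q ∪ B).biUnion C) ≤
      eI E a b (B.biUnion C) + ∑ x ∈ Q, (#(C x) + if x ∈ bad then 2 * g else 0) := by
    intro Q
    induction Q using Finset.induction_on with
    | empty => intro _; simp
    | insert x Q hx ih =>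
      intro hP
      rw [disjoint_insert_left] at hP
      have hx' : x ∉ Q ∪ B := by simp [hx, hP.1]
      rw [insert_union, biUnion_insert, eI_union E a b (hCdb hx'), sum_insert hx]
      have h1 := ih hP.2
      have h2 : eX E a b (C x) ((Q ∪ B).biUnion C) ≤ eX E a b (C x) (B.biUnion C) := by
        rw [union_biUnion]
        refine (eX_union_le E a b).trans ?_
        have := eX_biUnion_le E a b Q C 0 (S := C x) (fun y hy => (hss x y (fun h => hx (h ▸ hy))
          hP.1 (fun h => disjoint_left.1 hP.2 hy h)).le)
        omega
      have h3 := hI x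
      have h4 := hXB x hP.1
      split_ifs with hb
      · omega
      · have : ¬ (#(C x) < eI E a b (C x) + eX E a b (C x) (B.biUnion C)) := fun h =>
          hb (mem_filter.2 ⟨mem_univ _, hP.1, h⟩)
        omega
  have hU : ((Bᶜ ∪ B).biUnion C) = univ := by
    rw [union_comm, union_compl]
    exact hCu
  have t1 := hQ Bᶜ disjoint_compl_left
  have t2 := hPB B subset_rfl
  rw [hU] at t1
  have t3 : eI E a b univ = #E := by simp [eI]
  rw [sum_add_distrib] at t1 t2
  have t4 : ∑ x ∈ Bᶜ, (if x ∈ bad then 2 * g else 0) ≤ #bad * (2 * g) := by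
    rw [← sum_filter, sum_const, smul_eq_mul]
    exact Nat.mul_le_mul_right _ (card_le_card fun x hx => (mem_filter.1 hx).2)
  have t5 : ∑ x ∈ B, #(C x) + ∑ x ∈ Bᶜ, #(C x) = N := by
    rw [sum_add_sum_compl, hsum]
    rw [hCu]; simp
  rw [sum_const, smul_eq_mul] at t2
  have t6 : #B * (2 * g) ≤ g * (2 * g) := Nat.mul_le_mul_right _ hBg
  have t7 : #bad * (2 * g) ≤ 2 * g ^ 2 * (2 * g) := Nat.mul_le_mul_right _ hbadc
  have t8 : 2 * g ^ 2 * (2 * g) = 4 * g ^ 3 := by ring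
  have t9 : g * (2 * g) = 2 * g ^ 2 := by ring
  omega

end chunk

lemma chunk (δ c : ℝ) (hδ : 0 < δ) (hc : 0 < c) : ∃ N0 : ℕ, ∀ N ≥ N0, ∀ {ι : Type*}
    (E : Finset ι) (a b : ι → Fin N), (1 + δ) * N ≤ #E →
    ∃ S : Finset (Fin N), (#S : ℝ) ≤ c * N ∧ #S < eI E a b S := by
  obtain ⟨g, hg⟩ := exists_nat_gt (16 / c)
  obtain ⟨N0, hN0⟩ := exists_nat_gt (max (8 / c) ((2 * g ^ 2 + 4 * g ^ 3) / δ))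
  refine ⟨N0, fun N hN ι E a b hE => ?_⟩
  have h1 : max (8 / c) ((2 * g ^ 2 + 4 * g ^ 3) / δ) < N := hN0.trans_le (by exact_mod_cast hN)
  obtain ⟨h2, h3⟩ := max_lt_iff.1 h1
  rw [div_lt_iff₀ hc] at h2 hg
  rw [div_lt_iff₀ hδ] at h3
  set L := ⌊c * N / 4⌋₊ with hL
  have l1 : (L : ℝ) ≤ c * N / 4 := Nat.floor_le (by positivity)
  have l2 : c * N / 4 < L + 1 := Nat.lt_floor_add_one _
  have l3 : 1 ≤ L := Nat.le_floor (by push_cast; linarith)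
  have l3' : (1:ℝ) ≤ L := by exact_mod_cast l3
  obtain ⟨S, hS, hS'⟩ := chunk_aux E a b L g l3 (by
      have : (2 * N : ℝ) ≤ g * L := by
        have : c * N / 8 ≤ L := by linarith
        have h4 : (g:ℝ) * (c * N / 8) ≤ g * L := by gcongr
        have h5 : (0:ℝ) ≤ N := by positivity
        nlinarith
      exact_mod_cast this) (by
      have : ((N + 2 * g ^ 2 + 4 * g ^ 3 : ℕ) : ℝ) < #E := by push_cast; nlinarith
      exact_mod_cast this)
  refine ⟨S, ?_, hS'⟩
  have : (#S : ℝ) ≤ 4 * L := by exact_mod_cast hS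
  linarith

end LM

namespace LM

lemma exact_aux (u v w p q r : ℝ) (hu : u ≤ 1) (huv : v ≤ u) (huw : w ≤ u)
    (hp : 0 ≤ p) (hq : 0 ≤ q) (hr : 0 ≤ r)
    (h1 : u * v - p * q ≤ 4 / 9) (h2 : u * w - p * r ≤ 4 / 9)
    (h3 : 4 ≤ 2 * u - p + (2 * v - q) + (2 * w - r)) :
    u = 2 / 3 ∧ v = 2 / 3 ∧ w = 2 / 3 ∧ p = 0 ∧ q = 0 ∧ r = 0 := by
  obtain ⟨t, ht⟩ : ∃ t, t = (p + q + r) / 2 := ⟨_, rfl⟩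
  have ht0 : 0 ≤ t := by linarith
  have hs : 2 + t ≤ u + v + w := by linarith
  have hu3 : 2 + t ≤ 3 * u := by linarith
  have ht1 : t ≤ 1 := by linarith
  have htu : t ≤ u := by linarith
  have h4 : p * (q + r) ≤ t ^ 2 := by rw [ht]; nlinarith [sq_nonneg (p - (q + r))]
  have h5 : u * (2 + t - u) ≤ u * (v + w) := mul_le_mul_of_nonneg_left (by linarith) (by linarith)
  have h6 : (u - 2 / 3) * (4 / 3 - u) + t * (u - t) ≤ 0 := by nlinarith
  have h7 : 0 ≤ t * (u - t) := mul_nonneg ht0 (by linarith)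
  have h8 : (u - 2 / 3) * (4 / 3 - u) ≤ 0 := by linarith
  have h9 : u = 2 / 3 := by nlinarith
  subst h9
  have h10 : t = 0 := by linarith
  refine ⟨rfl, ?_, ?_, ?_, ?_, ?_⟩ <;> linarith

lemma exact_case (u q : Fin 3 → ℝ) (hu : ∀ i, u i ≤ 1) (hq : ∀ i, 0 ≤ q i)
    (h : ∀ i j, i ≠ j → u i * u j - q i * q j ≤ 4 / 9)
    (hs : 4 ≤ ∑ i, (2 * u i - q i)) : ∀ i, u i = 2 / 3 ∧ q i = 0 := by
  rw [Fin.sum_univ_three] at hs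
  have h01 := h 0 1 (by decide)
  have h02 := h 0 2 (by decide)
  have h12 := h 1 2 (by decide)
  have h10 := h 1 0 (by decide)
  have h20 := h 2 0 (by decide)
  have h21 := h 2 1 (by decide)
  have key : u 0 = 2 / 3 ∧ u 1 = 2 / 3 ∧ u 2 = 2 / 3 ∧ q 0 = 0 ∧ q 1 = 0 ∧ q 2 = 0 := by
    rcases le_total (u 1) (u 0) with a | a <;> rcases le_total (u 2) (u 0) with b | b <;>
      rcases le_total (u 2) (u 1) with c | c
    · exact exact_aux _ _ _ _ _ _ (hu 0) a b (hq 0) (hq 1) (hq 2) h01 h02 (by linarith)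
    · exact exact_aux _ _ _ _ _ _ (hu 0) a b (hq 0) (hq 1) (hq 2) h01 h02 (by linarith)
    · have := exact_aux _ _ _ _ _ _ (hu 0) a (c.trans a) (hq 0) (hq 1) (hq 2) h01 h02 (by linarith)
      exact this
    · have := exact_aux _ _ _ _ _ _ (hu 2) b c (hq 2) (hq 0) (hq 1) h20 h21 (by linarith)
      tauto
    · have := exact_aux _ _ _ _ _ _ (hu 1) a c (hq 1) (hq 0) (hq 2) h10 h12 (by linarith)
      tauto
    · have := exact_aux _ _ _ _ _ _ (hu 2) (a.trans c) c (hq 2) (hq 0) (hq 1) h20 h21 (by linarith)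
      tauto
    · have := exact_aux _ _ _ _ _ _ (hu 1) a c (hq 1) (hq 0) (hq 2) h10 h12 (by linarith)
      tauto
    · have := exact_aux _ _ _ _ _ _ (hu 2) b c (hq 2) (hq 0) (hq 1) h20 h21 (by linarith)
      tauto
  intro i
  fin_cases i
  · exact ⟨key.1, key.2.2.2.1⟩
  · exact ⟨key.2.1, key.2.2.2.2.1⟩
  · exact ⟨key.2.2.1, key.2.2.2.2.2⟩

lemma stab (κ : ℝ) (hκ : 0 < κ) : ∃ ε : ℝ, 0 < ε ∧ ∀ u q : Fin 3 → ℝ,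
    (∀ i, 0 ≤ u i) → (∀ i, u i ≤ 1) → (∀ i, 0 ≤ q i) → (∀ i, q i ≤ 1) →
    (∀ i j, i ≠ j → u i * u j - q i * q j ≤ 4 / 9 + ε) →
    4 - ε ≤ ∑ i, (2 * u i - q i) → ∀ i, |u i - 2 / 3| ≤ κ ∧ q i ≤ κ := by
  by_contra hcon
  push Not at hcon
  have hseq : ∀ n : ℕ, ∃ x : (Fin 3 → ℝ) × (Fin 3 → ℝ), x ∈ Set.Icc (0, 0) (1, 1) ∧
      (∀ i j, i ≠ j → x.1 i * x.1 j - x.2 i * x.2 j ≤ 4 / 9 + 1 / ((n : ℝ) + 1)) ∧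
      4 - 1 / ((n : ℝ) + 1) ≤ ∑ i, (2 * x.1 i - x.2 i) ∧
      ∃ i, |x.1 i - 2 / 3| ≤ κ → κ < x.2 i := by
    intro n
    obtain ⟨u, q, h1, h2, h3, h4, h5, h6, h7⟩ := hcon (1 / ((n : ℝ) + 1)) (by positivity)
    exact ⟨(u, q), ⟨⟨h1, h3⟩, ⟨h2, h4⟩⟩, h5, h6, h7⟩
  choose x hxI hx1 hx2 hx3 using hseq
  obtain ⟨y, hy, φ, hφ, hlim⟩ := (isCompact_Icc (a := ((0, 0) : (Fin 3 → ℝ) × (Fin 3 → ℝ))) (b := (1, 1))).tendsto_subseq hxI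
  have l1 : ∀ i, Filter.Tendsto (fun n => (x (φ n)).1 i) Filter.atTop (nhds (y.1 i)) := fun i =>
    (((continuous_apply i).comp continuous_fst).tendsto y).comp hlim
  have l2 : ∀ i, Filter.Tendsto (fun n => (x (φ n)).2 i) Filter.atTop (nhds (y.2 i)) := fun i =>
    (((continuous_apply i).comp continuous_snd).tendsto y).comp hlim
  have l0 : Filter.Tendsto (fun n => 1 / ((φ n : ℝ) + 1)) Filter.atTop (nhds 0) :=
    tendsto_one_div_add_atTop_nhds_zero_nat.comp hφ.tendsto_atTop
  have hex := exact_case y.1 y.2 (fun i => hy.2.1 i) (fun i => hy.1.2 i)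
    (fun i j hij => by
      have a1 := ((l1 i).mul (l1 j)).sub ((l2 i).mul (l2 j))
      have a2 := (tendsto_const_nhds (x := (4 / 9 : ℝ))).add l0
      rw [add_zero] at a2
      exact le_of_tendsto_of_tendsto' a1 a2 fun n => hx1 _ i j hij)
    (by
      have a1 := tendsto_finsetSum (univ : Finset (Fin 3)) fun i _ =>
        ((l1 i).const_mul 2).sub (l2 i)
      have a2 := (tendsto_const_nhds (x := (4 : ℝ))).sub l0
      rw [sub_zero] at a2
      exact le_of_tendsto_of_tendsto' a2 a1 fun n => hx2 _)
  have e1 : ∀ i, ∀ᶠ n in Filter.atTop, |(x (φ n)).1 i - 2 / 3| ≤ κ := by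
    intro i
    have := ((l1 i).sub_const (2 / 3)).abs
    rw [(hex i).1, sub_self, abs_zero] at this
    exact (this.eventually (gt_mem_nhds hκ)).mono fun n hn => le_of_lt hn
  have e2 : ∀ i, ∀ᶠ n in Filter.atTop, (x (φ n)).2 i < κ := by
    intro i
    have := l2 i
    rw [(hex i).2] at this
    exact this.eventually (gt_mem_nhds hκ)
  have e3 := (Filter.eventually_all.2 e1).and (Filter.eventually_all.2 e2)
  obtain ⟨n, hn1, hn2⟩ := e3.exists
  obtain ⟨i, hi⟩ := hx3 (φ n)
  have := hi (hn1 i)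
  have := hn2 i
  linarith

end LM

namespace LM

structure MM {n N : ℕ} (H : Finset (Fin 3 → Fin n)) (m : Fin N → Fin 3 → Fin n) : Prop where
  hmH : ∀ k, m k ∈ H
  hinj : ∀ i k l, m k i = m l i → k = l
  hmax : ∀ M', IsMat H M' → #M' ≤ N

variable {n N : ℕ}

lemma exists_MM (H : Finset (Fin 3 → Fin n)) : ∃ N, ∃ m : Fin N → Fin 3 → Fin n, MM H m := by
  obtain ⟨M, hM, hmax⟩ := exists_max H
  refine ⟨#M, fun k => (M.equivFin.symm k).1, ⟨fun k => hM.1 (M.equivFin.symm k).2, ?_, hmax⟩⟩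
  intro i k l h
  have := hM.2 _ (M.equivFin.symm k).2 _ (M.equivFin.symm l).2 i h
  exact M.equivFin.symm.injective (Subtype.ext this)

/-- The uncovered vertices in class `i`. -/
def Lf (m : Fin N → Fin 3 → Fin n) (i : Fin 3) : Finset (Fin n) := {v | ∀ k, m k i ≠ v}

lemma MM.card_L {H : Finset (Fin 3 → Fin n)} {m : Fin N → Fin 3 → Fin n} (h : MM H m) (i : Fin 3) :
    #(Lf m i) + N = n := by
  have h1 : Lf m i = (univ.image (fun k => m k i))ᶜ := by
    ext v; simp [Lf]
  have h2 : #(univ.image (fun k => m k i)) = N := by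
    rw [card_image_of_injective _ (fun k l hkl => h.hinj i k l hkl)]; simp
  have h3 := card_compl_add_card (univ.image (fun k => m k i))
  rw [h2, ← h1] at h3
  simpa using h3

/-- The edge through two matching vertices and `x`. -/
def tr (m : Fin N → Fin 3 → Fin n) (p q : Fin 3 × Fin N) (x : Fin n) : Fin 3 → Fin n :=
  fun s => if s = p.1 then m p.2 s else if s = q.1 then m q.2 s else x

lemma tr_symm (m : Fin N → Fin 3 → Fin n) (p q : Fin 3 × Fin N) (x : Fin n) (h : p.1 ≠ q.1) :
    tr m p q x = tr m q p x := by
  funext s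
  unfold tr
  split_ifs with h1 h2
  · exact absurd (h1.symm.trans h2) h
  · rfl
  · rfl
  · rfl

/-- The third index. -/
lemma third_eq : ∀ i j s : Fin 3, i ≠ j → (s ≠ i ∧ s ≠ j ↔ s = -(i + j)) := by decide

open Classical in
/-- The auxiliary link graph. -/
noncomputable def LG (H : Finset (Fin 3 → Fin n)) (m : Fin N → Fin 3 → Fin n) (D : ℕ) :
    SimpleGraph (Fin 3 × Fin N) where
  Adj p q := p.1 ≠ q.1 ∧ D ≤ #{x ∈ Lf m (-(p.1 + q.1)) | tr m p q x ∈ H}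
  symm := ⟨fun p q h => ⟨h.1.symm, by
    have h2 := h.2
    simp only [tr_symm m p q _ h.1] at h2
    rw [add_comm q.1 p.1]
    convert h2⟩⟩
  loopless := ⟨fun x h => h.1 rfl⟩

lemma MM.aug0 {H : Finset (Fin 3 → Fin n)} {m : Fin N → Fin 3 → Fin n} (h : MM H m)
    (J : Finset (Fin N)) (N' : Finset (Fin 3 → Fin n)) (hN : IsMat H N')
    (hc : ∀ e ∈ N', ∀ i, e i ∈ Lf m i ∨ ∃ k ∈ J, e i = m k i) : #N' ≤ #J := by
  have h1 : IsMat H (Jᶜ.image m) := by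
    refine ⟨?_, ?_⟩
    · intro e he
      obtain ⟨k, _, rfl⟩ := mem_image.1 he
      exact h.hmH k
    · intro e he f hf i hi
      obtain ⟨k, _, rfl⟩ := mem_image.1 he
      obtain ⟨l, _, rfl⟩ := mem_image.1 hf
      rw [h.hinj i k l hi]
  have h2 : #(Jᶜ.image m) = #Jᶜ :=
    card_image_of_injective _ (fun k l hkl => h.hinj 0 k l (congrFun hkl 0))
  obtain ⟨h3, h4⟩ := hN.union h1 (by
    intro e he f hf i hi
    obtain ⟨k, hk, rfl⟩ := mem_image.1 hf
    rcases hc e he i with h5 | ⟨l, hl, h5⟩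
    · exact (mem_filter.1 h5).2 k hi.symm
    · have := h.hinj i l k (h5.symm.trans hi)
      subst this
      exact (mem_compl.1 hk) hl)
  have h5 := h.hmax _ h3
  have h6 := card_compl_add_card J
  rw [Fintype.card_fin] at h6
  omega

lemma MM.aug1 {H : Finset (Fin 3 → Fin n)} {m : Fin N → Fin 3 → Fin n} (h : MM H m) {D : ℕ}
    (J : Finset (Fin N)) (F : Finset ((Fin 3 × Fin N) × (Fin 3 × Fin N))) (hF : GM (LG H m D) F)
    (hFJ : ∀ p ∈ F, p.1.2 ∈ J ∧ p.2.2 ∈ J) (hFD : #F ≤ D)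
    (E' : Finset (Fin 3 → Fin N)) (hE : ∀ κ ∈ E', (∀ i, κ i ∈ J) ∧ (fun i => m (κ i) i) ∈ H)
    (hE2 : ∀ κ ∈ E', ∀ κ' ∈ E', ∀ i, κ i = κ' i → κ = κ')
    (hEF : ∀ κ ∈ E', ∀ p ∈ F, ∀ i, p.1 ≠ (i, κ i) ∧ p.2 ≠ (i, κ i)) :
    #F + #E' ≤ #J := by
  classical
  have hall : ∃ g : F → Fin 3 × Fin n, Function.Injective g ∧ ∀ p : F, g p ∈
      ({x ∈ Lf m (-(p.1.1.1 + p.1.2.1)) | tr m p.1.1 p.1.2 x ∈ H}).image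
        (fun x => (-(p.1.1.1 + p.1.2.1), x)) := by
    rw [← Finset.all_card_le_biUnion_card_iff_exists_injective]
    intro s
    rcases s.eq_empty_or_nonempty with rfl | ⟨p, hp⟩
    · simp
    · have h1 := card_le_card (subset_biUnion_of_mem (fun p : F =>
        ({x ∈ Lf m (-(p.1.1.1 + p.1.2.1)) | tr m p.1.1 p.1.2 x ∈ H}).image
        (fun x => (-(p.1.1.1 + p.1.2.1), x))) hp)
      rw [card_image_of_injective _ (fun x y hxy => (Prod.ext_iff.1 hxy).2)] at h1
      have h2 := (hF.1 p.1 p.2).2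
      have h3 := card_le_univ s
      rw [Fintype.card_coe] at h3
      have h4 : D ≤ #{x ∈ Lf m (-(p.1.1.1 + p.1.2.1)) | tr m p.1.1 p.1.2 x ∈ H} := by
        convert h2
      omega
  obtain ⟨g, hg, hg2⟩ := hall
  have hg3 : ∀ p : F, (g p).1 = -(p.1.1.1 + p.1.2.1) ∧ (g p).2 ∈ Lf m (-(p.1.1.1 + p.1.2.1)) ∧
      tr m p.1.1 p.1.2 (g p).2 ∈ H := by
    intro p
    obtain ⟨x, hx, hx2⟩ := mem_image.1 (hg2 p)
    rw [← hx2]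
    exact ⟨rfl, (mem_filter.1 hx).1, (mem_filter.1 hx).2⟩
  -- description of coordinates
  have hco : ∀ (p : F) (s : Fin 3),
      (∃ k, (p.1.1 = (s, k) ∨ p.1.2 = (s, k)) ∧ tr m p.1.1 p.1.2 (g p).2 s = m k s) ∨
      (tr m p.1.1 p.1.2 (g p).2 s = (g p).2 ∧ (g p).1 = s ∧ (g p).2 ∈ Lf m s) := by
    intro p s
    unfold tr
    split_ifs with h1 h2
    · exact Or.inl ⟨p.1.1.2, Or.inl (by rw [h1]), rfl⟩
    · exact Or.inl ⟨p.1.2.2, Or.inr (by rw [h2]), rfl⟩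
    · have := (third_eq p.1.1.1 p.1.2.1 s (hF.1 p.1 p.2).1).1 ⟨h1, h2⟩
      right
      rw [this]
      exact ⟨rfl, (hg3 p).1, (hg3 p).2.1⟩
  have hdis : ∀ (p q : F) (s : Fin 3),
      tr m p.1.1 p.1.2 (g p).2 s = tr m q.1.1 q.1.2 (g q).2 s → p = q := by
    intro p q s hs
    by_contra hpq
    have hd := hF.2 p.1 p.2 q.1 q.2 (fun h => hpq (Subtype.ext h))
    rcases hco p s with ⟨k, hk, hk2⟩ | ⟨hk, hk2, hk3⟩ <;>
      rcases hco q s with ⟨l, hl, hl2⟩ | ⟨hl, hl2, hl3⟩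
    · have : k = l := h.hinj s k l (hk2.symm.trans (hs.trans hl2))
      subst this
      rcases hk with hk | hk <;> rcases hl with hl | hl
      · exact hd.1 (hk.trans hl.symm)
      · exact hd.2.1 (hk.trans hl.symm)
      · exact hd.2.2.1 (hk.trans hl.symm)
      · exact hd.2.2.2 (hk.trans hl.symm)
    · exact (mem_filter.1 hl3).2 k (hk2.symm.trans (hs.trans hl))
    · exact (mem_filter.1 hk3).2 l (hl2.symm.trans (hs.symm.trans hk))
    · exact hpq (hg (Prod.ext (hk2.trans hl2.symm) (hk.symm.trans (hs.trans hl))))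
  have hI1 : IsMat H (univ.image (fun p : F => tr m p.1.1 p.1.2 (g p).2)) := by
    refine ⟨?_, ?_⟩
    · intro e he
      obtain ⟨p, _, rfl⟩ := mem_image.1 he
      exact (hg3 p).2.2
    · intro e he f hf i hi
      obtain ⟨p, _, rfl⟩ := mem_image.1 he
      obtain ⟨q, _, rfl⟩ := mem_image.1 hf
      rw [hdis p q i hi]
  have hc1 : #(univ.image (fun p : F => tr m p.1.1 p.1.2 (g p).2)) = #F := by
    rw [card_image_of_injective _ (fun p q hpq => hdis p q 0 (congrFun hpq 0))]
    simp
  have hI2 : IsMat H (E'.image (fun κ i => m (κ i) i)) := by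
    refine ⟨?_, ?_⟩
    · intro e he
      obtain ⟨κ, hκ, rfl⟩ := mem_image.1 he
      exact (hE κ hκ).2
    · intro e he f hf i hi
      obtain ⟨κ, hκ, rfl⟩ := mem_image.1 he
      obtain ⟨κ', hκ', rfl⟩ := mem_image.1 hf
      rw [hE2 κ hκ κ' hκ' i (h.hinj i _ _ hi)]
  have hc2 : #(E'.image (fun κ i => m (κ i) i)) = #E' := by
    rw [card_image_of_injOn]
    intro κ hκ κ' hκ' hkk
    exact hE2 κ hκ κ' hκ' 0 (h.hinj 0 _ _ (congrFun hkk 0))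
  obtain ⟨h3, h4⟩ := hI1.union hI2 (by
    intro e he f hf i hi
    obtain ⟨p, _, rfl⟩ := mem_image.1 he
    obtain ⟨κ, hκ, rfl⟩ := mem_image.1 hf
    rcases hco p i with ⟨k, hk, hk2⟩ | ⟨hk, hk2, hk3⟩
    · have : k = κ i := h.hinj i _ _ (hk2.symm.trans hi)
      subst this
      rcases hk with hk | hk
      · exact (hEF κ hκ p.1 p.2 i).1 hk
      · exact (hEF κ hκ p.1 p.2 i).2 hk
    · exact (mem_filter.1 hk3).2 (κ i) (hi.symm.trans hk))
  rw [← hc1, ← hc2, ← h4]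
  refine h.aug0 J _ h3 ?_
  intro e he i
  rcases mem_union.1 he with he | he
  · obtain ⟨p, _, rfl⟩ := mem_image.1 he
    rcases hco p i with ⟨k, hk, hk2⟩ | ⟨hk, hk2, hk3⟩
    · right
      refine ⟨k, ?_, hk2⟩
      rcases hk with hk | hk
      · have := (hFJ p.1 p.2).1; rw [hk] at this; exact this
      · have := (hFJ p.1 p.2).2; rw [hk] at this; exact this
    · left
      show tr m p.1.1 p.1.2 (g p).2 i ∈ _
      rw [hk]; exact hk3
  · obtain ⟨κ, hκ, rfl⟩ := mem_image.1 he
    exact Or.inr ⟨κ i, (hE κ hκ).1 i, rfl⟩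

end LM

namespace LM
variable {n N : ℕ}

lemma notin_L {m : Fin N → Fin 3 → Fin n} {i : Fin 3} {v : Fin n} (h : v ∉ Lf m i) :
    ∃ k, v = m k i := by
  by_contra hc
  push Not at hc
  exact h (by simp only [Lf, mem_filter, mem_univ, true_and]; exact fun k => (hc k).symm)

lemma L_ne {m : Fin N → Fin 3 → Fin n} {i : Fin 3} {v : Fin n} (h : v ∈ Lf m i) (k : Fin N) :
    v ≠ m k i := fun heq => (mem_filter.1 h).2 k heq.symm

/-- Edges at `m k i` with the other two coordinates uncovered. -/
def TT (H : Finset (Fin 3 → Fin n)) (m : Fin N → Fin 3 → Fin n) (i : Fin 3) (k : Fin N) :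
    Finset (Fin 3 → Fin n) := {e ∈ H | e i = m k i ∧ ∀ s, s ≠ i → e s ∈ Lf m s}

lemma fin3_cases : ∀ i j s : Fin 3, i ≠ j → s = i ∨ s = j ∨ s = -(i + j) := by decide
lemma third_ne : ∀ i j : Fin 3, i ≠ j → -(i + j) ≠ i ∧ -(i + j) ≠ j := by decide

lemma card_TT_le {H : Finset (Fin 3 → Fin n)} {m : Fin N → Fin 3 → Fin n} (h : MM H m)
    {i j : Fin 3} (hij : i ≠ j) (k : Fin N) : #(TT H m i k) ≤ (n - N) ^ 2 := by
  have hL : ∀ s, #(Lf m s) = n - N := fun s => by have := h.card_L s; omega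
  calc #(TT H m i k) ≤ #(Lf m j ×ˢ Lf m (-(i + j))) := by
        refine card_le_card_of_injOn (fun e => (e j, e (-(i + j)))) ?_ ?_
        · intro e he
          have he := (mem_filter.1 (mem_coe.1 he)).2.2
          exact mem_coe.2 (mem_product.2 ⟨he _ hij.symm, he _ (third_ne i j hij).1⟩)
        · intro e he f hf hef
          have he := (mem_filter.1 (mem_coe.1 he)).2
          have hf := (mem_filter.1 (mem_coe.1 hf)).2
          funext s
          rcases fin3_cases i j s hij with rfl | rfl | rfl
          · exact he.1.trans hf.1.symm
          · exact (Prod.ext_iff.1 hef).1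
          · exact (Prod.ext_iff.1 hef).2
    _ = (n - N) ^ 2 := by rw [card_product, hL, hL, sq]

lemma card_TT_le' {H : Finset (Fin 3 → Fin n)} {m : Fin N → Fin 3 → Fin n} (h : MM H m)
    {i j : Fin 3} (hij : i ≠ j) (k : Fin N) (w : Fin n)
    (hw : ∀ e ∈ TT H m i k, e (-(i + j)) = w) : #(TT H m i k) ≤ n - N := by
  have hL : ∀ s, #(Lf m s) = n - N := fun s => by have := h.card_L s; omega
  calc #(TT H m i k) ≤ #(Lf m j) := by
        refine card_le_card_of_injOn (fun e => e j) ?_ ?_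
        · intro e he
          have he := (mem_filter.1 (mem_coe.1 he)).2.2
          exact mem_coe.2 (he _ hij.symm)
        · intro e he0 f hf0 hef
          have he := (mem_filter.1 (mem_coe.1 he0)).2
          have hf := (mem_filter.1 (mem_coe.1 hf0)).2
          funext s
          rcases fin3_cases i j s hij with rfl | rfl | rfl
          · exact he.1.trans hf.1.symm
          · exact hef
          · exact (hw e he0).trans (hw f hf0).symm
    _ = (n - N) := hL _

lemma TT_third {H : Finset (Fin 3 → Fin n)} {m : Fin N → Fin 3 → Fin n} (h : MM H m)
    {i j : Fin 3} (hij : i ≠ j) (k : Fin N) {e f : Fin 3 → Fin n} (he0 : e ∈ TT H m i k)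
    (hf0 : f ∈ TT H m j k) : e (-(i + j)) = f (-(i + j)) := by
  obtain ⟨heH, he1, he2⟩ := mem_filter.1 he0
  obtain ⟨hfH, hf1, hf2⟩ := mem_filter.1 hf0
  by_contra hne
  have hd : ∀ s, e s ≠ f s := by
    intro s
    rcases fin3_cases i j s hij with rfl | rfl | rfl
    · rw [he1]; exact (L_ne (hf2 _ hij) k).symm
    · rw [hf1]; exact (L_ne (he2 _ hij.symm) k)
    · exact hne
  have h1 : IsMat H {e} := ⟨by simpa using heH, by
    intro a ha b hb _ _; rw [mem_singleton.1 ha, mem_singleton.1 hb]⟩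
  obtain ⟨h2, h3⟩ := h1.insert hfH (by
    intro a ha s; rw [mem_singleton.1 ha]; exact hd s)
  have := h.aug0 {k} _ h2 (by
    intro a ha s
    rw [mem_insert, mem_singleton] at ha
    rcases ha with rfl | rfl
    · by_cases hs : s = j
      · subst hs; exact Or.inr ⟨k, by simp, hf1⟩
      · exact Or.inl (hf2 s hs)
    · by_cases hs : s = i
      · subst hs; exact Or.inr ⟨k, by simp, he1⟩
      · exact Or.inl (he2 s hs))
  rw [h3] at this
  simp at this

lemma TT_sum {H : Finset (Fin 3 → Fin n)} {m : Fin N → Fin 3 → Fin n} (h : MM H m)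
    {i j : Fin 3} (hij : i ≠ j) (k : Fin N) :
    #(TT H m i k) + #(TT H m j k) ≤ (n - N) ^ 2 + (n - N) := by
  have h1 := card_TT_le h hij k
  have h2 := card_TT_le h hij.symm k
  rcases (TT H m i k).eq_empty_or_nonempty with h3 | ⟨e, he⟩
  · rw [h3, card_empty]; omega
  rcases (TT H m j k).eq_empty_or_nonempty with h3 | ⟨f, hf⟩
  · rw [h3, card_empty]; omega
  have h4 := card_TT_le' h hij k (f (-(i + j))) (fun e' he' => TT_third h hij k he' hf)
  have h5 := card_TT_le' h hij.symm k (e (-(j + i))) (fun f' hf' => by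
    rw [add_comm]; exact (TT_third h hij k he hf').symm)
  rcases Nat.eq_zero_or_pos (n - N) with h6 | h6
  · rw [h6] at h4 h5; omega
  · nlinarith

open Classical in
lemma dens {H : Finset (Fin 3 → Fin n)} {m : Fin N → Fin 3 → Fin n} (h : MM H m) (D d : ℕ)
    (hd : ∀ i v, d ≤ dg H i v) {i j : Fin 3} (hij : i ≠ j) :
    (n - N) * d ≤ #{p : Fin N × Fin N | (LG H m D).Adj (i, p.1) (j, p.2)} * (n - N) + N ^ 2 * D
      + N * ((n - N) ^ 2 + (n - N)) := by
  have hL : ∀ s, #(Lf m s) = n - N := fun s => by have := h.card_L s; omega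
  obtain ⟨t, ht⟩ : ∃ t, t = -(i + j) := ⟨_, rfl⟩
  have htn := third_ne i j hij
  rw [← ht] at htn
  let X : Fin N × Fin N → Finset (Fin n) := fun p => {x ∈ Lf m t | tr m (i, p.1) (j, p.2) x ∈ H}
  have h1 : (n - N) * d ≤ #{e ∈ H | e t ∈ Lf m t} := by
    have : ({e ∈ H | e t ∈ Lf m t} : Finset _) = (Lf m t).biUnion (fun v => {e ∈ H | e t = v}) := by
      ext e; simp [and_comm]
    rw [this, card_biUnion]
    · rw [← hL t, ← smul_eq_mul]
      exact card_nsmul_le_sum _ _ _ (fun v _ => hd t v)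
    · intro v _ w _ hvw
      refine disjoint_left.2 fun e he hf => hvw ?_
      exact (mem_filter.1 he).2.symm.trans (mem_filter.1 hf).2
  have h2 : ({e ∈ H | e t ∈ Lf m t} : Finset _) ⊆
      (univ.biUnion (fun k => TT H m i k ∪ TT H m j k)) ∪
      (univ.biUnion (fun p : Fin N × Fin N => (X p).image (tr m (i, p.1) (j, p.2)))) := by
    intro e he
    obtain ⟨heH, het⟩ := mem_filter.1 he
    rw [mem_union, mem_biUnion, mem_biUnion]
    by_cases hei : e i ∈ Lf m i
    · by_cases hej : e j ∈ Lf m j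
      · exfalso
        have h1 : IsMat H {e} := ⟨by simpa using heH, by
          intro a ha b hb _ _; rw [mem_singleton.1 ha, mem_singleton.1 hb]⟩
        have := h.aug0 ∅ _ h1 (by
          intro a ha s
          rw [mem_singleton.1 ha]
          left
          rcases fin3_cases i j s hij with rfl | rfl | rfl
          · exact hei
          · exact hej
          · exact ht ▸ het)
        simp at this
      · obtain ⟨k, hk⟩ := notin_L hej
        left
        refine ⟨k, mem_univ _, mem_union_right _ (mem_filter.2 ⟨heH, hk, ?_⟩)⟩
        intro s hs
        rcases fin3_cases i j s hij with rfl | rfl | rfl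
        · exact hei
        · exact absurd rfl hs
        · exact ht ▸ het
    · obtain ⟨k, hk⟩ := notin_L hei
      by_cases hej : e j ∈ Lf m j
      · left
        refine ⟨k, mem_univ _, mem_union_left _ (mem_filter.2 ⟨heH, hk, ?_⟩)⟩
        intro s hs
        rcases fin3_cases i j s hij with rfl | rfl | rfl
        · exact absurd rfl hs
        · exact hej
        · exact ht ▸ het
      · obtain ⟨l, hl⟩ := notin_L hej
        right
        have hE : tr m (i, k) (j, l) (e t) = e := by
          funext s
          unfold tr
          rcases fin3_cases i j s hij with rfl | rfl | h3
          · simp [hk]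
          · simp [hij.symm, hl]
          · rw [← ht] at h3; subst h3; simp [htn]
        refine ⟨(k, l), mem_univ _, mem_image.2 ⟨e t, mem_filter.2 ⟨het, ?_⟩, hE⟩⟩
        rw [hE]; exact heH
  have h3 : #(univ.biUnion (fun k => TT H m i k ∪ TT H m j k)) ≤ N * ((n - N) ^ 2 + (n - N)) := by
    refine card_biUnion_le.trans ?_
    refine (sum_le_card_nsmul univ _ ((n - N) ^ 2 + (n - N)) ?_).trans (by simp)
    intro k _
    exact (card_union_le _ _).trans (TT_sum h hij k)
  have h4 : #(univ.biUnion (fun p : Fin N × Fin N => (X p).image (tr m (i, p.1) (j, p.2)))) ≤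
      #{p : Fin N × Fin N | (LG H m D).Adj (i, p.1) (j, p.2)} * (n - N) + N ^ 2 * D := by
    refine card_biUnion_le.trans ?_
    calc _ ≤ ∑ p : Fin N × Fin N, ((if (LG H m D).Adj (i, p.1) (j, p.2) then (n - N) else 0) + D) := by
          refine sum_le_sum fun p _ => ?_
          refine card_image_le.trans ?_
          split_ifs with hp
          · have : #(X p) ≤ #(Lf m t) := card_le_card (filter_subset _ _)
            rw [hL] at this; omega
          · have : ¬ D ≤ #(X p) := by
              intro hD
              apply hp
              refine ⟨hij, ?_⟩
              simp only [X] at hD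
              rw [ht] at hD
              convert hD
            omega
      _ = _ := by
          rw [sum_add_distrib, ← sum_filter, sum_const, sum_const]
          simp only [smul_eq_mul, card_univ, Fintype.card_prod, Fintype.card_fin]; ring
  have h5 := (card_le_card h2).trans (card_union_le _ _)
  omega

end LM

namespace LM
variable {n N : ℕ}

lemma nu_bound (δ c : ℝ) (hδ : 0 < δ) (hc : 0 < c) : ∃ N0 : ℕ, ∀ N ≥ N0, ∀ n D : ℕ,
    ∀ (H : Finset (Fin 3 → Fin n)) (m : Fin N → Fin 3 → Fin n), MM H m → c * N + 1 ≤ D →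
    ∀ F, GM (LG H m D) F → (#F : ℝ) < (1 + δ) * N := by
  obtain ⟨N0, h0⟩ := chunk δ c hδ hc
  refine ⟨N0, fun N hN n D H m hm hD F hF => ?_⟩
  by_contra hcon
  push Not at hcon
  obtain ⟨S, hS1, hS2⟩ := h0 N hN F (fun p => p.1.2) (fun p => p.2.2) hcon
  obtain ⟨F', hF1, hF2⟩ := exists_subset_card_eq (show #S + 1 ≤ _ from hS2)
  have hle : #F' ≤ D := by
    rw [hF2]
    have : ((#S + 1 : ℕ) : ℝ) ≤ D := by push_cast; linarith
    exact_mod_cast this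
  have hsub : F' ⊆ F := hF1.trans (filter_subset _ _)
  have := hm.aug1 S F' ⟨fun p hp => hF.1 p (hsub hp),
    fun p hp q hq => hF.2 p (hsub hp) q (hsub hq)⟩
    (fun p hp => (mem_filter.1 (hF1 hp)).2) hle ∅ (by simp) (by simp) (by simp)
  simp at this
  omega

open Classical in
lemma adj_avoid (G : SimpleGraph (Fin 3 × Fin N)) (S R : Finset (Fin 3 × Fin N)) (K : ℕ)
    (hK : ∀ x ∈ R, #{y | y ∉ S ∧ G.Adj x y} ≤ K) (i j : Fin 3) :
    #{p : Fin N × Fin N | ((i, p.1) ∉ S ∧ (j, p.2) ∉ S) ∧ G.Adj (i, p.1) (j, p.2)} ≤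
      #{k | (i, k) ∉ S ∧ (i, k) ∉ R} * #{k | (j, k) ∉ S ∧ (j, k) ∉ R} + 2 * (K * N) := by
  have key : ∀ i j : Fin 3, #{p : Fin N × Fin N | (i, p.1) ∈ R ∧ (j, p.2) ∉ S ∧
      G.Adj (i, p.1) (j, p.2)} ≤ K * N := by
    intro i j
    calc _ ≤ #(univ.biUnion (fun k : Fin N => ({l : Fin N | (i, k) ∈ R ∧ (j, l) ∉ S ∧
            G.Adj (i, k) (j, l)} : Finset _).image (fun l => (k, l)))) := by
          apply card_le_card
          intro p hp
          simp only [mem_filter, mem_univ, true_and] at hp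
          simp only [mem_biUnion, mem_univ, true_and, mem_image, mem_filter]
          exact ⟨p.1, p.2, hp, rfl⟩
      _ ≤ ∑ k : Fin N, K := by
          refine card_biUnion_le.trans (sum_le_sum fun k _ => ?_)
          refine card_image_le.trans ?_
          by_cases hk : (i, k) ∈ R
          · refine le_trans ?_ (hK _ hk)
            refine card_le_card_of_injOn (fun l => (j, l)) ?_ ?_
            · intro l hl
              have := (mem_filter.1 (mem_coe.1 hl)).2
              simp only [coe_filter, mem_univ, true_and, Set.mem_ofPred_eq]
              exact this.2
            · intro a _ b _ hab
              exact (Prod.ext_iff.1 hab).2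
          · simp [hk]
      _ = K * N := by simp [mul_comm]
  have h2 : #{p : Fin N × Fin N | (j, p.2) ∈ R ∧ (i, p.1) ∉ S ∧
      G.Adj (j, p.2) (i, p.1)} ≤ K * N := by
    refine le_trans ?_ (key j i)
    refine card_le_card_of_injOn Prod.swap ?_ (Prod.swap_injective.injOn)
    intro p hp
    simpa using hp
  have h1 := key i j
  have h3 : ({p : Fin N × Fin N | ((i, p.1) ∉ S ∧ (j, p.2) ∉ S) ∧ G.Adj (i, p.1) (j, p.2)} :
      Finset _) ⊆ (({k | (i, k) ∉ S ∧ (i, k) ∉ R} : Finset (Fin N)) ×ˢ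
        ({k | (j, k) ∉ S ∧ (j, k) ∉ R} : Finset (Fin N))) ∪
      (({p : Fin N × Fin N | (i, p.1) ∈ R ∧ (j, p.2) ∉ S ∧ G.Adj (i, p.1) (j, p.2)} : Finset _) ∪
      ({p : Fin N × Fin N | (j, p.2) ∈ R ∧ (i, p.1) ∉ S ∧ G.Adj (j, p.2) (i, p.1)} : Finset _)) := by
    intro p hp
    simp only [mem_filter, mem_univ, true_and] at hp
    simp only [mem_union, mem_product, mem_filter, mem_univ, true_and]
    by_cases h4 : (i, p.1) ∈ R
    · exact Or.inr (Or.inl ⟨h4, hp.1.2, hp.2⟩)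
    by_cases h5 : (j, p.2) ∈ R
    · exact Or.inr (Or.inr ⟨h5, hp.1.1, hp.2.symm⟩)
    exact Or.inl ⟨⟨hp.1.1, h4⟩, hp.1.2, h5⟩
  have h4 := (card_le_card h3).trans ((card_union_le _ _).trans
    (Nat.add_le_add_left (card_union_le _ _) _))
  rw [card_product] at h4
  omega

lemma card_slices (S : Finset (Fin 3 × Fin N)) : #S = ∑ i, #{k | (i, k) ∈ S} := by
  rw [card_eq_sum_card_fiberwise (f := Prod.fst) (t := univ) (fun _ _ => by simp)]
  refine sum_congr rfl fun i _ => ?_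
  symm
  refine card_nbij (fun k => (i, k)) ?_ ?_ ?_
  · intro k hk; simpa using hk
  · intro a _ b _ hab; exact (Prod.ext_iff.1 hab).2
  · intro p hp
    simp only [coe_filter, Set.mem_ofPred_eq] at hp
    refine ⟨p.2, ?_, ?_⟩
    · simp only [coe_filter, mem_univ, true_and, Set.mem_ofPred_eq]
      rw [← hp.2]; exact hp.1
    · rw [← hp.2]

open Classical in
lemma adj_split (G : SimpleGraph (Fin 3 × Fin N)) (S : Finset (Fin 3 × Fin N)) (i j : Fin 3) :
    #{p : Fin N × Fin N | ((i, p.1) ∈ S ∨ (j, p.2) ∈ S) ∧ ¬ G.Adj (i, p.1) (j, p.2)} +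
      #{p : Fin N × Fin N | G.Adj (i, p.1) (j, p.2)} +
      #{k | (i, k) ∉ S} * #{k | (j, k) ∉ S} = N ^ 2 +
    #{p : Fin N × Fin N | ((i, p.1) ∉ S ∧ (j, p.2) ∉ S) ∧ G.Adj (i, p.1) (j, p.2)} := by
  have hp : #{k | (i, k) ∉ S} * #{k | (j, k) ∉ S} =
      #{p : Fin N × Fin N | (i, p.1) ∉ S ∧ (j, p.2) ∉ S} := by
    rw [← card_product]
    congr 1
    ext p; simp
  have hN : N ^ 2 = ∑ _p : Fin N × Fin N, 1 := by simp [sq]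
  rw [hp, hN]
  simp only [card_filter]
  rw [← sum_add_distrib, ← sum_add_distrib, ← sum_add_distrib]
  refine sum_congr rfl fun p _ => ?_
  by_cases h1 : (i, p.1) ∈ S <;> by_cases h2 : (j, p.2) ∈ S <;>
    by_cases h3 : G.Adj (i, p.1) (j, p.2) <;> simp [h1, h2, h3]

lemma N_lower {H : Finset (Fin 3 → Fin n)} {m : Fin N → Fin 3 → Fin n} (h : MM H m)
    (hn : 0 < n) (hd : ∀ i v, (1 / 2 : ℝ) * n ^ 2 ≤ dg H i v) : (n : ℝ) ≤ 6 * N := by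
  have hc : ∀ i, #(univ.image (fun k => m k i)) ≤ N := fun i =>
    card_image_le.trans (by simp)
  have h1 : H ⊆ univ.biUnion (fun i : Fin 3 => ({e | e i ∈ univ.image (fun k => m k i)} :
      Finset (Fin 3 → Fin n))) := by
    intro e he
    by_contra hcon
    simp only [mem_biUnion, mem_univ, true_and, mem_filter, mem_image, not_exists] at hcon
    have h2 : IsMat H {e} := ⟨by simpa using he, by
      intro a ha b hb _ _; rw [mem_singleton.1 ha, mem_singleton.1 hb]⟩
    have := h.aug0 ∅ _ h2 (by
      intro a ha s
      rw [mem_singleton.1 ha]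
      left
      by_contra hs
      obtain ⟨k, hk⟩ := notin_L hs
      exact hcon s k hk.symm)
    simp at this
  have h2 : #H ≤ 3 * (N * n ^ 2) := by
    refine (card_le_card h1).trans (card_biUnion_le.trans ?_)
    refine (sum_le_card_nsmul univ _ (N * n ^ 2) ?_).trans (by simp)
    intro i _
    rw [card_in]
    exact Nat.mul_le_mul_right _ (hc i)
  have h3 : #H = ∑ v, dg H 0 v := by
    rw [card_eq_sum_card_fiberwise (f := fun e => e 0) (t := univ) (fun _ _ => by simp)]
    rfl
  have h4 : (n : ℝ) * ((1 / 2 : ℝ) * n ^ 2) ≤ (#H : ℝ) := by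
    rw [h3]; push_cast
    calc (n : ℝ) * ((1 / 2 : ℝ) * n ^ 2) = ∑ _v : Fin n, ((1 / 2 : ℝ) * n ^ 2) := by simp
      _ ≤ _ := sum_le_sum fun v _ => hd 0 v
  have h5 : (#H : ℝ) ≤ 3 * (N * n ^ 2) := by exact_mod_cast h2
  have hn' : (0 : ℝ) < n := by exact_mod_cast hn
  have h6 : (n : ℝ) ^ 2 * (n - 6 * N) ≤ 0 := by nlinarith
  have := nonpos_of_mul_nonpos_right h6 (by positivity)
  linarith

end LM

namespace LM
variable {n N : ℕ}

open Classical in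
/-- Core density inequality for the Gallai–Edmonds-like sets. -/
lemma core_ineq {H : Finset (Fin 3 → Fin n)} {m : Fin N → Fin 3 → Fin n} (h : MM H m) (D K : ℕ)
    (ε μ : ℝ) (hl : N < n)
    (hd : ∀ i v, (5 / 9 - ε) * (n : ℝ) ^ 2 ≤ dg H i v) (hε : ε ≤ 1 / 36)
    (hD : (D : ℝ) ≤ μ * ((n - N : ℕ) : ℝ))
    (S R : Finset (Fin 3 × Fin N))
    (hK : ∀ x ∈ R, #{y | y ∉ S ∧ (LG H m D).Adj x y} ≤ K) {i j : Fin 3} (hij : i ≠ j) :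
    (#{p : Fin N × Fin N | ((i, p.1) ∈ S ∨ (j, p.2) ∈ S) ∧ ¬ (LG H m D).Adj (i, p.1) (j, p.2)} : ℝ)
      + (#{k | (i, k) ∉ S} : ℝ) * (#{k | (j, k) ∉ S} : ℝ)
      - (#{k | (i, k) ∉ S ∧ (i, k) ∉ R} : ℝ) * (#{k | (j, k) ∉ S ∧ (j, k) ∉ R} : ℝ)
      + (N : ℝ) * ((n - N : ℕ) : ℝ) / 18 ≤ (4 / 9 + ε + μ) * (N : ℝ) ^ 2 + (2 * K + 1) * N := by
  have h1 := adj_avoid (LG H m D) S R K hK i j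
  have h2 := adj_split (LG H m D) S i j
  have h3 := dens h D ⌈(5 / 9 - ε) * (n : ℝ) ^ 2⌉₊ (fun i v => Nat.ceil_le.2 (hd i v)) hij
  obtain ⟨l, hl'⟩ : ∃ l, l = n - N := ⟨_, rfl⟩
  have hn : n = N + l := by omega
  have hlpos : 0 < l := by omega
  rw [← hl'] at h3 hD ⊢
  obtain ⟨e, he⟩ : ∃ e, e = #{p : Fin N × Fin N | (LG H m D).Adj (i, p.1) (j, p.2)} := ⟨_, rfl⟩
  rw [← he] at h2 h3
  have h3' : (l : ℝ) * ((5 / 9 - ε) * (n : ℝ) ^ 2) ≤ e * l + N ^ 2 * D + N * (l ^ 2 + l) := by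
    calc (l : ℝ) * ((5 / 9 - ε) * (n : ℝ) ^ 2) ≤ l * (⌈(5 / 9 - ε) * (n : ℝ) ^ 2⌉₊ : ℝ) := by
          gcongr; exact Nat.le_ceil _
      _ ≤ _ := by exact_mod_cast h3
  have hlr : (0 : ℝ) < l := by exact_mod_cast hlpos
  have h4 : (5 / 9 - ε) * (n : ℝ) ^ 2 ≤ e + μ * N ^ 2 + N * (l + 1) := by
    have : (l : ℝ) * ((5 / 9 - ε) * (n : ℝ) ^ 2) ≤ l * (e + μ * N ^ 2 + N * (l + 1)) := by
      have : (N : ℝ) ^ 2 * D ≤ N ^ 2 * (μ * l) := by gcongr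
      nlinarith
    exact le_of_mul_le_mul_left this hlr
  have hnr : (n : ℝ) = N + l := by exact_mod_cast hn
  rw [hnr] at h4
  have hNr : (0 : ℝ) ≤ N := by positivity
  have h5 : (5 / 9 - ε) * (N : ℝ) ^ 2 + (10 / 9 - 2 * ε) * (N * l) ≤ e + μ * N ^ 2 + N * (l + 1) := by
    have : 0 ≤ (5 / 9 - ε) * (l : ℝ) ^ 2 := by
      have : 0 ≤ 5 / 9 - ε := by linarith
      positivity
    nlinarith
  have hNl : (0 : ℝ) ≤ N * l := by positivity
  have h6 : ε * (N * l) ≤ 1 / 36 * ((N : ℝ) * l) := by gcongr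
  have h1' := (Nat.cast_le (α := ℝ)).2 h1
  have h2' := congrArg (Nat.cast (R := ℝ)) h2
  push_cast at h1' h2'
  linarith

open Classical in
set_option maxHeartbeats 2000000 in
lemma struct (κ : ℝ) (hκ : 0 < κ) : ∃ ε : ℝ, 0 < ε ∧ ε ≤ 1 / 36 ∧ ∀ η : ℝ, 0 < η → ∃ n0 : ℕ, ∀ n ≥ n0,
    ∀ N (H : Finset (Fin 3 → Fin n)) (m : Fin N → Fin 3 → Fin n), MM H m →
    (∀ i v, (5 / 9 - ε) * (n : ℝ) ^ 2 ≤ dg H i v) → (N : ℝ) ≤ (1 - η) * n →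
    ∃ (D : ℕ) (S : Finset (Fin 3 × Fin N)), 4 ≤ D ∧ (n : ℝ) ≤ 6 * N ∧
      ((n - N : ℕ) : ℝ) ≤ κ * N ∧ (∀ i, |(#{k | (i, k) ∈ S} : ℝ) - N / 3| ≤ κ * N) ∧
      ∀ i j, i ≠ j → (#{p : Fin N × Fin N | ((i, p.1) ∈ S ∨ (j, p.2) ∈ S) ∧
        ¬ (LG H m D).Adj (i, p.1) (j, p.2)} : ℝ) ≤ κ * N ^ 2 := by
  obtain ⟨κ', hκ'0, hκ'1, hκ'2⟩ : ∃ κ' : ℝ, 0 < κ' ∧ κ' ≤ κ / 36 ∧ κ' ≤ 1 / 2 :=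
    ⟨min (κ / 36) (1 / 2), by positivity, min_le_left _ _, min_le_right _ _⟩
  obtain ⟨ε1, hε1, hst⟩ := stab κ' hκ'0
  obtain ⟨e, he0, he1, he2, he3⟩ : ∃ e : ℝ, 0 < e ∧ e ≤ ε1 ∧ e ≤ κ' ∧ e ≤ 1 / 9 :=
    ⟨min ε1 (min κ' (1 / 9)), by positivity, min_le_left _ _,
      (min_le_right _ _).trans (min_le_left _ _), (min_le_right _ _).trans (min_le_right _ _)⟩
  refine ⟨e / 8, by positivity, by linarith, fun η hη => ?_⟩
  obtain ⟨N1, hN1⟩ := nu_bound (e / 16) (e / 8 * η / 2) (by positivity) (by positivity)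
  obtain ⟨K, hK⟩ := exists_nat_ge (16 / e)
  have hK0 : (0 : ℝ) < K := lt_of_lt_of_le (by positivity) hK
  obtain ⟨N2, hN2⟩ := exists_nat_ge (8 * (2 * K + 1) / e)
  obtain ⟨N3, hN3⟩ := exists_nat_ge (16 / e)
  obtain ⟨n4, hn4⟩ := exists_nat_ge (5 / (e / 8 * η / 2))
  refine ⟨6 * N1 + 6 * N2 + 6 * N3 + n4 + 6, fun n hn N H m hm hd hNη => ?_⟩
  have hnN : (n : ℝ) ≤ 6 * N := N_lower hm (by omega) (fun i v => le_trans (by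
    gcongr; linarith) (hd i v))
  have hnN' : n ≤ 6 * N := by exact_mod_cast hnN
  have hNpos : (0 : ℝ) < N := by
    have : 0 < N := by omega
    exact_mod_cast this
  have hNn : N < n := by
    have h1 : (N : ℝ) < n := by
      have : (0 : ℝ) < n := by
        have : 0 < n := by omega
        exact_mod_cast this
      nlinarith
    exact_mod_cast h1
  have hlr : ((n - N : ℕ) : ℝ) = n - N := by push_cast [hNn.le]; ring
  have hlη : η * n ≤ ((n - N : ℕ) : ℝ) := by rw [hlr]; linarith
  obtain ⟨D, hD⟩ : ∃ D, D = ⌊e / 8 * ((n - N : ℕ) : ℝ)⌋₊ := ⟨_, rfl⟩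
  have hD1 : (D : ℝ) ≤ e / 8 * ((n - N : ℕ) : ℝ) := by
    rw [hD]; exact Nat.floor_le (by positivity)
  have hD2 : e / 8 * ((n - N : ℕ) : ℝ) < D + 1 := by
    rw [hD]; exact Nat.lt_floor_add_one _
  have hn4' : 5 ≤ (e / 8 * η / 2) * n := by
    have h1 : (n4 : ℝ) ≤ n := by
      have : n4 ≤ n := by omega
      exact_mod_cast this
    have := (div_le_iff₀ (by positivity)).1 (hn4.trans h1)
    linarith
  have hNr : (N : ℝ) ≤ n := by exact_mod_cast hNn.le
  have hlD : e / 8 * (η * n) ≤ e / 8 * ((n - N : ℕ) : ℝ) := by gcongr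
  have hDc : e / 8 * η / 2 * N + 1 ≤ D := by
    have : e / 8 * η / 2 * N ≤ e / 8 * η / 2 * n := by gcongr
    nlinarith
  have hD4 : 4 ≤ D := by
    have : (3 : ℝ) < D := by nlinarith
    exact_mod_cast this
  have hnu := hN1 N (by omega) n D H m hm hDc
  obtain ⟨t, ht⟩ : ∃ t, t = ⌈(1 + e / 16) * N⌉₊ := ⟨_, rfl⟩
  have ht1 : (1 + e / 16) * N ≤ t := by rw [ht]; exact Nat.le_ceil _
  have ht2 : (t : ℝ) < (1 + e / 16) * N + 1 := by rw [ht]; exact Nat.ceil_lt_add_one (by positivity)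
  have hN3' : 16 / e ≤ N := hN3.trans (by
    have : N3 ≤ N := by omega
    exact_mod_cast this)
  have hN3'' : 16 ≤ e * N := by rw [div_le_iff₀ he0] at hN3'; linarith
  have h2t : 2 * t ≤ 3 * N := by
    have : (2 * t : ℝ) ≤ 3 * N := by nlinarith
    exact_mod_cast this
  have htb := tutte_berge (LG H m D) t (3 * N - 2 * t) K (by simp; omega) (by
    rintro ⟨F, hF, hFt⟩
    have := hnu F hF
    rw [hFt] at this
    linarith)
  obtain ⟨S, R, hSR, hcard, hR⟩ := htb
  have hN2' : (2 * K + 1) * (N : ℝ) ≤ e / 8 * N ^ 2 := by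
    have h1 : (N2 : ℝ) ≤ N := by
      have : N2 ≤ N := by omega
      exact_mod_cast this
    have := (div_le_iff₀ he0).1 (hN2.trans h1)
    nlinarith
  have hcore : ∀ i j, i ≠ j → _ := fun i j hij => core_ineq hm D K (e / 8) (e / 8) hNn hd (by linarith) hD1 S R
    (fun x hx => by convert hR x hx) (i := i) (j := j) hij
  -- slices
  have hu : ∀ i, #{k | (i, k) ∈ S} + #{k | (i, k) ∉ S} = N := by
    intro i
    have := card_filter_add_card_filter_not (s := (univ : Finset (Fin N))) (fun k => (i, k) ∈ S)
    simpa using this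
  have hq : ∀ i, #{k | (i, k) ∉ S ∧ (i, k) ∉ R} + #{k | (i, k) ∈ R} = #{k | (i, k) ∉ S} := by
    intro i
    rw [← card_union_of_disjoint]
    · congr 1
      ext k
      simp only [mem_union, mem_filter, mem_univ, true_and]
      constructor
      · rintro (h | h)
        · exact h.1
        · exact fun h' => disjoint_left.1 hSR h' h
      · intro h
        by_cases h' : (i, k) ∈ R
        · exact Or.inr h'
        · exact Or.inl ⟨h, h'⟩
    · refine disjoint_left.2 fun k hk hk' => ?_
      exact (mem_filter.1 hk).2.2 (mem_filter.1 hk').2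
  obtain ⟨u, hu'⟩ : ∃ u : Fin 3 → ℝ, ∀ i, u i = (#{k | (i, k) ∉ S} : ℝ) := ⟨_, fun i => rfl⟩
  obtain ⟨q, hq'⟩ : ∃ q : Fin 3 → ℝ, ∀ i, q i = (#{k | (i, k) ∉ S ∧ (i, k) ∉ R} : ℝ) := ⟨_, fun i => rfl⟩
  have hur : ∀ i, (#{k | (i, k) ∈ S} : ℝ) = N - u i := fun i => by
    have h1 := congrArg (Nat.cast (R := ℝ)) (hu i)
    push_cast at h1
    rw [hu']; linarith
  have hrr : ∀ i, (#{k | (i, k) ∈ R} : ℝ) = u i - q i := fun i => by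
    have h1 := congrArg (Nat.cast (R := ℝ)) (hq i)
    push_cast at h1
    rw [hu', hq']; linarith
  have hu0 : ∀ i, 0 ≤ u i := fun i => by rw [hu']; positivity
  have hq0 : ∀ i, 0 ≤ q i := fun i => by rw [hq']; positivity
  have hqu : ∀ i, q i ≤ u i := fun i => by
    have := hrr i
    have h2 : (0 : ℝ) ≤ (#{k | (i, k) ∈ R} : ℝ) := by positivity
    linarith
  have huN : ∀ i, u i ≤ N := fun i => by
    have := hur i
    have h2 : (0 : ℝ) ≤ (#{k | (i, k) ∈ S} : ℝ) := by positivity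
    linarith
  simp only [← hu', ← hq'] at hcore
  have hcore' : ∀ i j, i ≠ j → (#{p : Fin N × Fin N | ((i, p.1) ∈ S ∨ (j, p.2) ∈ S) ∧
        ¬ (LG H m D).Adj (i, p.1) (j, p.2)} : ℝ) + N * ((n - N : ℕ) : ℝ) / 18 + u i * u j - q i * q j
        ≤ (4 / 9 + 3 * e / 8) * N ^ 2 := by
    intro i j hij
    have := hcore i j hij
    linarith
  have hsum : (4 - e) * N ≤ ∑ i, (2 * u i - q i) := by
    have h1 : (#S : ℝ) = 3 * N - ∑ i, u i := by
      rw [card_slices S]; push_cast; simp only [hur]; rw [sum_sub_distrib]; simp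
    have h2 : (#R : ℝ) = ∑ i, u i - ∑ i, q i := by
      rw [card_slices R]; push_cast; simp only [hrr]; rw [sum_sub_distrib]
    have h3 : (K : ℝ) * (#S + (3 * N - 2 * t)) ≤ K * #R + 3 * N := by
      have := (Nat.cast_le (α := ℝ)).2 hcard
      push_cast [h2t] at this
      simpa using this
    have h4 : (3 * N : ℝ) ≤ K * (e / 4 * N) := by
      have : 16 ≤ K * e := by rw [div_le_iff₀ he0] at hK; linarith
      nlinarith
    have h5 : (#S : ℝ) + (3 * N - 2 * t) ≤ #R + e / 4 * N := by
      have : (K : ℝ) * (#S + (3 * N - 2 * t)) ≤ K * (#R + e / 4 * N) := by linarith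
      exact le_of_mul_le_mul_left this hK0
    rw [h1, h2] at h5
    rw [sum_sub_distrib, ← mul_sum]
    nlinarith
  have hstab := hst (fun i => u i / N) (fun i => q i / N) (fun i => by have := hu0 i; positivity)
    (fun i => by rw [div_le_one hNpos]; exact huN i) (fun i => by have := hq0 i; positivity)
    (fun i => by rw [div_le_one hNpos]; exact (hqu i).trans (huN i))
    (fun i j hij => by
      have h1 := hcore' i j hij
      have h2 : u i / N * (u j / N) - q i / N * (q j / N) = (u i * u j - q i * q j) / N ^ 2 := by
        field_simp
      rw [h2, div_le_iff₀ (by positivity)]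
      have h3 : (4 / 9 + 3 * e / 8) * (N : ℝ) ^ 2 ≤ (4 / 9 + ε1) * N ^ 2 := by
        gcongr; linarith
      have h4 : (0 : ℝ) ≤ N * ((n - N : ℕ) : ℝ) / 18 := by positivity
      have h5 : (0 : ℝ) ≤ (#{p : Fin N × Fin N | ((i, p.1) ∈ S ∨ (j, p.2) ∈ S) ∧
        ¬ (LG H m D).Adj (i, p.1) (j, p.2)} : ℝ) := by positivity
      linarith)
    (by
      have h1 : ∑ i, (2 * (u i / N) - q i / N) = (∑ i, (2 * u i - q i)) / N := by
        rw [sum_div]; refine sum_congr rfl fun i _ => ?_; ring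
      rw [h1, le_div_iff₀ hNpos]
      nlinarith)
  have hu2 : ∀ i, |u i - 2 / 3 * N| ≤ κ' * N := by
    intro i
    have := (hstab i).1
    have h2 : u i - 2 / 3 * N = (u i / N - 2 / 3) * N := by field_simp
    rw [h2, abs_mul, abs_of_pos hNpos]
    gcongr
  have hq2 : ∀ i, q i ≤ κ' * N := by
    intro i
    have := (hstab i).2
    rwa [div_le_iff₀ hNpos] at this
  have hfin : ∀ i j, i ≠ j → (#{p : Fin N × Fin N | ((i, p.1) ∈ S ∨ (j, p.2) ∈ S) ∧
        ¬ (LG H m D).Adj (i, p.1) (j, p.2)} : ℝ) + N * ((n - N : ℕ) : ℝ) / 18 ≤ 2 * κ' * N ^ 2 := by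
    intro i j hij
    have h1 := hcore' i j hij
    have h2 : (2 / 3 - κ') * N * ((2 / 3 - κ') * N) ≤ u i * u j := by
      have hp : 0 ≤ (2 / 3 - κ') * N := by
        have : 0 ≤ 2 / 3 - κ' := by linarith
        positivity
      have a1 := (abs_le.1 (hu2 i)).1
      have a2 := (abs_le.1 (hu2 j)).1
      exact mul_le_mul (by linarith) (by linarith) hp (hu0 i)
    have h3 : q i * q j ≤ (κ' * N) * (κ' * N) :=
      mul_le_mul (hq2 i) (hq2 j) (hq0 j) (by positivity)
    have h4 : 3 * e / 8 * (N : ℝ) ^ 2 ≤ 3 * κ' / 8 * N ^ 2 := by gcongr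
    nlinarith [sq_nonneg (N : ℝ), mul_nonneg hκ'0.le (sq_nonneg (N : ℝ))]
  refine ⟨D, S, hD4, hnN, ?_, ?_, ?_⟩
  · have h1 := hfin 0 1 (by decide)
    have h5 : (0 : ℝ) ≤ (#{p : Fin N × Fin N | (((0 : Fin 3), p.1) ∈ S ∨ ((1 : Fin 3), p.2) ∈ S) ∧
        ¬ (LG H m D).Adj (0, p.1) (1, p.2)} : ℝ) := by positivity
    have h2 : (N : ℝ) * ((n - N : ℕ) : ℝ) ≤ N * (36 * κ' * N) := by nlinarith
    have h3 := le_of_mul_le_mul_left h2 hNpos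
    refine h3.trans ?_
    gcongr; linarith
  · intro i
    rw [hur]
    have h1 := hu2 i
    have h2 : (N : ℝ) - u i - N / 3 = -(u i - 2 / 3 * N) := by ring
    rw [h2, abs_neg]
    refine h1.trans ?_
    gcongr; linarith
  · intro i j hij
    have h1 := hfin i j hij
    have h4 : (0 : ℝ) ≤ N * ((n - N : ℕ) : ℝ) / 18 := by positivity
    have : 2 * κ' * (N : ℝ) ^ 2 ≤ κ * N ^ 2 := by gcongr; linarith
    linarith

end LM

namespace LM
variable {n N : ℕ}

open Classical in
lemma Z_small {H : Finset (Fin 3 → Fin n)} {m : Fin N → Fin 3 → Fin n} (hm : MM H m) {D : ℕ}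
    (hD : 4 ≤ D) (S : Finset (Fin 3 × Fin N)) (x : ℕ)
    (hNA : ∀ i j, i ≠ j → #{p : Fin N × Fin N | ((i, p.1) ∈ S ∨ (j, p.2) ∈ S) ∧
        ¬ (LG H m D).Adj (i, p.1) (j, p.2)} ≤ x) {i j : Fin 3} (hij : i ≠ j) :
    #{k | (i, k) ∈ S ∧ (j, k) ∈ S} * (#{k | (i, k) ∈ S} - 1) ≤ 3 * x := by
  obtain ⟨t, ht⟩ : ∃ t, t = -(i + j) := ⟨_, rfl⟩
  obtain ⟨hti, htj⟩ := third_ne i j hij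
  rw [← ht] at hti htj
  let Q : Finset (Fin N × Fin N) := {p | ((i, p.1) ∈ S ∧ (j, p.1) ∈ S) ∧ (i, p.2) ∈ S ∧ p.1 ≠ p.2}
  have h1 : #{k | (i, k) ∈ S ∧ (j, k) ∈ S} * (#{k | (i, k) ∈ S} - 1) ≤ #Q := by
    have : Q = ({k | (i, k) ∈ S ∧ (j, k) ∈ S} : Finset (Fin N)).biUnion
        (fun k => (({l | (i, l) ∈ S} : Finset (Fin N)).erase k).image (fun l => (k, l))) := by
      ext p
      simp only [Q, mem_filter, mem_univ, true_and, mem_biUnion, mem_image, mem_erase]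
      constructor
      · rintro ⟨h1, h2, h3⟩
        exact ⟨p.1, h1, p.2, ⟨h3.symm, h2⟩, rfl⟩
      · rintro ⟨k, hk, l, ⟨hl1, hl2⟩, rfl⟩
        exact ⟨hk, hl2, hl1.symm⟩
    rw [this, card_biUnion]
    · rw [← smul_eq_mul]
      refine card_nsmul_le_sum _ _ _ fun k hk => ?_
      rw [card_image_of_injective _ (fun a b hab => (Prod.ext_iff.1 hab).2), card_erase_of_mem]
      simp only [mem_filter, mem_univ, true_and] at hk ⊢
      exact hk.1
    · intro k _ l _ hkl
      refine disjoint_left.2 fun p hp hq => hkl ?_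
      obtain ⟨_, _, rfl⟩ := mem_image.1 hp
      obtain ⟨_, _, h⟩ := mem_image.1 hq
      exact (Prod.ext_iff.1 h).1.symm
  let B : Fin 3 → Fin 3 → Finset (Fin N × Fin N) := fun i j =>
    {p : Fin N × Fin N | ((i, p.1) ∈ S ∨ (j, p.2) ∈ S) ∧ ¬ (LG H m D).Adj (i, p.1) (j, p.2)}
  have h2 : Q ⊆ B j t ∪ (B i j ∪ (B i t).image Prod.swap) := by
    rintro ⟨k, l⟩ hp
    obtain ⟨⟨hk1, hk2⟩, hl, hkl⟩ := (mem_filter.1 hp).2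
    simp only at hk1 hk2 hl hkl
    by_contra hcon
    simp only [mem_union, not_or, mem_image, not_exists, not_and] at hcon
    obtain ⟨c1, c2, c3⟩ := hcon
    have a1 : (LG H m D).Adj (j, k) (t, l) := by
      by_contra h; exact c1 (mem_filter.2 ⟨mem_univ _, Or.inl hk2, h⟩)
    have a2 : (LG H m D).Adj (i, k) (j, l) := by
      by_contra h; exact c2 (mem_filter.2 ⟨mem_univ _, Or.inl hk1, h⟩)
    have a3 : (LG H m D).Adj (i, l) (t, k) := by
      by_contra h; exact c3 (l, k) (mem_filter.2 ⟨mem_univ _, Or.inl hl, h⟩) rfl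
    let p1 : (Fin 3 × Fin N) × (Fin 3 × Fin N) := ((j, k), (t, l))
    let p2 : (Fin 3 × Fin N) × (Fin 3 × Fin N) := ((i, k), (j, l))
    let p3 : (Fin 3 × Fin N) × (Fin 3 × Fin N) := ((i, l), (t, k))
    have d12 : p1 ≠ p2 := by simp [p1, p2, hij.symm]
    have d13 : p1 ≠ p3 := by simp [p1, p3, hij.symm]
    have d23 : p2 ≠ p3 := by simp [p2, p3, hkl]
    have hcard : #({p1, p2, p3} : Finset _) = 3 := by
      rw [card_insert_of_notMem, card_insert_of_notMem, card_singleton]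
      · simpa using d23
      · simp [d12, d13]
    have hij' := hij.symm
    have hti' := hti.symm
    have htj' := htj.symm
    have hkl' := fun h : l = k => hkl h.symm
    have := hm.aug1 (D := D) {k, l} {p1, p2, p3} ⟨by
        intro p hp
        simp only [mem_insert, mem_singleton] at hp
        rcases hp with rfl | rfl | rfl
        · exact a1
        · exact a2
        · exact a3, by
        intro p hp q hq hpq
        simp only [mem_insert, mem_singleton] at hp hq
        rcases hp with rfl | rfl | rfl <;> rcases hq with rfl | rfl | rfl <;>
          first
          | exact absurd rfl hpq
          | (simp only [p1, p2, p3, ne_eq, Prod.mk.injEq, not_and]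
             refine ⟨?_, ?_, ?_, ?_⟩ <;> intro h <;>
               first
               | exact absurd h hij | exact absurd h hij' | exact absurd h hti
               | exact absurd h hti' | exact absurd h htj | exact absurd h htj'
               | exact hkl | exact hkl')⟩
      (by
        intro p hp
        simp only [mem_insert, mem_singleton] at hp
        rcases hp with rfl | rfl | rfl <;> simp [p1, p2, p3])
      (by omega) ∅ (by simp) (by simp) (by simp)
    rw [hcard, card_pair hkl] at this
    simp at this
  have h3 : #(B j t) ≤ x := hNA j t htj.symm
  have h4 : #(B i j) ≤ x := hNA i j hij
  have h5 : #((B i t).image Prod.swap) ≤ x := card_image_le.trans (hNA i t hti.symm)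
  have h6 := (card_le_card h2).trans ((card_union_le _ _).trans
    (Nat.add_le_add_left (card_union_le _ _) _))
  omega

/-- blocks with exactly one coordinate in S, distinct, etc. -/
lemma sigma_choice : ∀ α : Fin 3 → Fin 3, (∀ i, α i ≠ i) →
    ∃ σ : Fin 3, σ ≠ 0 ∧ ∀ i, α i ≠ -((i + σ) + α (i + σ)) := by decide

lemma good_contra {H : Finset (Fin 3 → Fin n)} {m : Fin N → Fin 3 → Fin n} (hm : MM H m) {D : ℕ}
    (hD : 4 ≤ D) (S : Finset (Fin 3 × Fin N)) (κ : Fin 3 → Fin N) (hκ : (fun i => m (κ i) i) ∈ H)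
    (hS : ∀ i, (i, κ i) ∉ S) (hinj : Function.Injective κ) (hone : ∀ i, ∃ a, (a, κ i) ∈ S)
    (hadj : ∀ i j a b, i ≠ j → a ≠ b → ((a, κ i) ∈ S ∨ (b, κ j) ∈ S) →
      (LG H m D).Adj (a, κ i) (b, κ j)) : False := by
  classical
  choose α hα using hone
  have hαi : ∀ i, α i ≠ i := fun i h => hS i (by have := hα i; rwa [h] at this)
  obtain ⟨σ, hσ, hch⟩ := sigma_choice α hαi
  obtain ⟨β, hβ⟩ : ∃ β : Fin 3 → Fin 3, ∀ i, β i = -(i + α i) := ⟨_, fun i => rfl⟩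
  have hβ1 : ∀ i, β i ≠ i ∧ β i ≠ α i := fun i => by rw [hβ]; exact third_ne i (α i) (hαi i).symm
  let P : Fin 3 → (Fin 3 × Fin N) × (Fin 3 × Fin N) :=
    fun i => ((α i, κ i), (β (i + σ), κ (i + σ)))
  have hP : Function.Injective P := by
    intro i j h
    exact hinj (Prod.ext_iff.1 (Prod.ext_iff.1 h).1).2
  have hshift : ∀ i, i ≠ i + σ := fun i h => hσ (by simpa using h)
  have := hm.aug1 (D := D) (univ.image κ) (univ.image P) ⟨by
      intro p hp
      obtain ⟨i, _, rfl⟩ := mem_image.1 hp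
      exact hadj i (i + σ) _ _ (hshift i) (by rw [hβ]; exact hch i) (Or.inl (hα i)), by
      intro p hp q hq hpq
      obtain ⟨i, _, rfl⟩ := mem_image.1 hp
      obtain ⟨j, _, rfl⟩ := mem_image.1 hq
      have hij : i ≠ j := fun h => hpq (by rw [h])
      refine ⟨fun h => ?_, fun h => ?_, fun h => ?_, fun h => ?_⟩
      · exact hij (hinj (Prod.ext_iff.1 h).2)
      · have h1 : i = j + σ := hinj (Prod.ext_iff.1 h).2
        have h2 : α i = β (j + σ) := (Prod.ext_iff.1 h).1
        rw [← h1] at h2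
        exact (hβ1 i).2 h2.symm
      · have h1 : i + σ = j := hinj (Prod.ext_iff.1 h).2
        have h2 : β (i + σ) = α j := (Prod.ext_iff.1 h).1
        rw [h1] at h2
        exact (hβ1 j).2 h2
      · exact hij (add_right_cancel (hinj (Prod.ext_iff.1 h).2))⟩
    (by
      intro p hp
      obtain ⟨i, _, rfl⟩ := mem_image.1 hp
      exact ⟨mem_image_of_mem _ (mem_univ _), mem_image_of_mem _ (mem_univ _)⟩)
    (by
      refine card_image_le.trans ?_
      simp; omega) {κ}
    (by
      intro k hk
      rw [mem_singleton.1 hk]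
      exact ⟨fun i => mem_image_of_mem _ (mem_univ _), hκ⟩)
    (by
      intro a ha b hb i _
      rw [mem_singleton.1 ha, mem_singleton.1 hb])
    (by
      intro k hk p hp i
      rw [mem_singleton.1 hk]
      obtain ⟨j, _, rfl⟩ := mem_image.1 hp
      refine ⟨fun h => ?_, fun h => ?_⟩
      · have h1 : j = i := hinj (Prod.ext_iff.1 h).2
        have h2 : α j = i := (Prod.ext_iff.1 h).1
        exact hαi j (h2.trans h1.symm)
      · have h1 : j + σ = i := hinj (Prod.ext_iff.1 h).2
        have h2 : β (j + σ) = i := (Prod.ext_iff.1 h).1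
        exact (hβ1 (j + σ)).1 (h2.trans h1.symm))
  rw [card_image_of_injective _ hP, card_image_of_injective _ hinj] at this
  simp at this

end LM

namespace LM
variable {n N : ℕ}

lemma card_pair_fix {i j : Fin 3} (hij : i ≠ j) (P : Finset (Fin N × Fin N)) :
    #{κ : Fin 3 → Fin N | (κ i, κ j) ∈ P} ≤ #P * N := by
  calc _ ≤ #(P ×ˢ (univ : Finset (Fin N))) := by
        refine card_le_card_of_injOn (fun κ => ((κ i, κ j), κ (-(i + j)))) ?_ ?_
        · intro κ hκ
          have := (mem_filter.1 (mem_coe.1 hκ)).2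
          exact mem_coe.2 (mem_product.2 ⟨this, mem_univ _⟩)
        · intro κ _ κ' _ h
          have h1 := (Prod.ext_iff.1 h).1
          have h2 := (Prod.ext_iff.1 h).2
          funext s
          rcases fin3_cases i j s hij with rfl | rfl | rfl
          · exact (Prod.ext_iff.1 h1).1
          · exact (Prod.ext_iff.1 h1).2
          · exact h2
    _ = _ := by rw [card_product]; simp

lemma b0_le (S : Finset (Fin 3 × Fin N)) :
    #{k | ∀ a, (a, k) ∉ S} + ∑ i, #{k | (i, k) ∈ S} ≤ N + #{k | ((0 : Fin 3), k) ∈ S ∧ (1, k) ∈ S} +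
      #{k | ((0 : Fin 3), k) ∈ S ∧ (2, k) ∈ S} + #{k | ((1 : Fin 3), k) ∈ S ∧ (2, k) ∈ S} := by
  suffices h : #{k | ∀ a, (a, k) ∉ S} + ∑ i, #{k | (i, k) ∈ S} ≤ (∑ _p : Fin N, 1) +
      #{k | ((0 : Fin 3), k) ∈ S ∧ (1, k) ∈ S} +
      #{k | ((0 : Fin 3), k) ∈ S ∧ (2, k) ∈ S} + #{k | ((1 : Fin 3), k) ∈ S ∧ (2, k) ∈ S} by
    simpa using h
  rw [Fin.sum_univ_three]
  simp only [card_filter]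
  rw [← sum_add_distrib, ← sum_add_distrib, ← sum_add_distrib, ← sum_add_distrib,
    ← sum_add_distrib, ← sum_add_distrib]
  refine sum_le_sum fun k _ => ?_
  simp only [Fin.forall_fin_succ, Fin.isValue]
  by_cases h0 : ((0 : Fin 3), k) ∈ S <;> by_cases h1 : ((1 : Fin 3), k) ∈ S <;>
    by_cases h2 : ((2 : Fin 3), k) ∈ S <;> simp [h0, h1, h2]

open Classical in
lemma avoid_count {H : Finset (Fin 3 → Fin n)} {m : Fin N → Fin 3 → Fin n} (hm : MM H m) {D : ℕ}
    (hD : 4 ≤ D) (S : Finset (Fin 3 × Fin N)) (x : ℕ)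
    (hNA : ∀ i j, i ≠ j → #{p : Fin N × Fin N | ((i, p.1) ∈ S ∨ (j, p.2) ∈ S) ∧
        ¬ (LG H m D).Adj (i, p.1) (j, p.2)} ≤ x) :
    #{κ : Fin 3 → Fin N | (∀ i, (i, κ i) ∉ S) ∧ (fun i => m (κ i) i) ∈ H} ≤
      9 * N ^ 2 + 3 * (#{k | ∀ a, (a, k) ∉ S} * N ^ 2) + 81 * (x * N) := by
  let X1 : Finset (Fin 3 → Fin N) := (univ : Finset (Fin 3 × Fin 3)).biUnion (fun q =>
    if q.1 = q.2 then ∅ else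
      ({κ : Fin 3 → Fin N | (κ q.1, κ q.2) ∈ (univ : Finset (Fin N)).image (fun k => (k, k))} : Finset _))
  let X2 : Finset (Fin 3 → Fin N) := (univ : Finset (Fin 3)).biUnion (fun i =>
    {κ : Fin 3 → Fin N | κ i ∈ ({k | ∀ a, (a, k) ∉ S} : Finset (Fin N))})
  let X3 : Finset (Fin 3 → Fin N) := (univ : Finset ((Fin 3 × Fin 3) × (Fin 3 × Fin 3))).biUnion (fun q =>
    if q.1.1 = q.1.2 ∨ q.2.1 = q.2.2 then ∅ else ({κ : Fin 3 → Fin N | (κ q.1.1, κ q.1.2) ∈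
      ({p : Fin N × Fin N | ((q.2.1, p.1) ∈ S ∨ (q.2.2, p.2) ∈ S) ∧
        ¬ (LG H m D).Adj (q.2.1, p.1) (q.2.2, p.2)} : Finset _)} : Finset _))
  have h1 : #X1 ≤ 9 * N ^ 2 := by
    refine card_biUnion_le.trans ?_
    refine (sum_le_card_nsmul univ _ (N ^ 2) ?_).trans (by simp)
    rintro ⟨i, j⟩ _
    split_ifs with h
    · simp
    · refine (card_pair_fix h _).trans ?_
      rw [sq]
      exact Nat.mul_le_mul_right _ (card_image_le.trans (by simp))
  have h2 : #X2 ≤ 3 * (#{k | ∀ a, (a, k) ∉ S} * N ^ 2) := by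
    refine card_biUnion_le.trans ?_
    refine (sum_le_card_nsmul univ _ (#{k | ∀ a, (a, k) ∉ S} * N ^ 2) ?_).trans (by simp)
    intro i _
    rw [card_in]
  have h3 : #X3 ≤ 81 * (x * N) := by
    refine card_biUnion_le.trans ?_
    refine (sum_le_card_nsmul univ _ (x * N) ?_).trans (by simp)
    rintro ⟨⟨i, j⟩, ⟨a, b⟩⟩ _
    split_ifs with h
    · simp
    · push Not at h
      refine (card_pair_fix h.1 _).trans ?_
      exact Nat.mul_le_mul_right _ (hNA a b h.2)
  have h4 : ({κ : Fin 3 → Fin N | (∀ i, (i, κ i) ∉ S) ∧ (fun i => m (κ i) i) ∈ H} : Finset _) ⊆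
      (X1 ∪ X2) ∪ X3 := by
    intro κ hκ
    obtain ⟨hκ1, hκ2⟩ := (mem_filter.1 hκ).2
    by_contra hcon
    rw [mem_union, mem_union, not_or, not_or] at hcon
    obtain ⟨⟨c1, c2⟩, c3⟩ := hcon
    refine good_contra hm hD S κ hκ2 hκ1 ?_ ?_ ?_
    · intro i j h
      by_contra hij
      refine c1 (mem_biUnion.2 ⟨(i, j), mem_univ _, ?_⟩)
      simp only [hij, if_false, mem_filter, mem_univ, true_and, mem_image]
      exact ⟨κ i, by rw [h]⟩
    · intro i
      by_contra h
      push Not at h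
      refine c2 (mem_biUnion.2 ⟨i, mem_univ _, ?_⟩)
      simp only [mem_filter, mem_univ, true_and]
      exact h
    · intro i j a b hij hab h
      by_contra hn
      refine c3 (mem_biUnion.2 ⟨((i, j), (a, b)), mem_univ _, ?_⟩)
      simp only [hij, hab, or_self, if_false, mem_filter, mem_univ, true_and]
      exact ⟨h, hn⟩
  have h5 := (card_le_card h4).trans ((card_union_le _ _).trans
    (Nat.add_le_add_right (card_union_le _ _) _))
  omega

lemma lift_count {H : Finset (Fin 3 → Fin n)} {m : Fin N → Fin 3 → Fin n} (hm : MM H m)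
    (S : Finset (Fin 3 × Fin N)) :
    #{e ∈ H | ∀ i, e i ∉ ({k | (i, k) ∈ S} : Finset (Fin N)).image (fun k => m k i)} ≤
      3 * ((n - N) * n ^ 2) +
      #{κ : Fin 3 → Fin N | (∀ i, (i, κ i) ∉ S) ∧ (fun i => m (κ i) i) ∈ H} := by
  have hL : ∀ s, #(Lf m s) = n - N := fun s => by have := hm.card_L s; omega
  have h1 : ({e ∈ H | ∀ i, e i ∉ ({k | (i, k) ∈ S} : Finset (Fin N)).image (fun k => m k i)} :
      Finset _) ⊆ (univ.biUnion (fun i : Fin 3 => ({e | e i ∈ Lf m i} : Finset (Fin 3 → Fin n)))) ∪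
      ({κ : Fin 3 → Fin N | (∀ i, (i, κ i) ∉ S) ∧ (fun i => m (κ i) i) ∈ H} : Finset _).image
        (fun κ i => m (κ i) i) := by
    intro e he
    obtain ⟨heH, he2⟩ := mem_filter.1 he
    by_cases hc : ∃ i, e i ∈ Lf m i
    · obtain ⟨i, hi⟩ := hc
      refine mem_union_left _ (mem_biUnion.2 ⟨i, mem_univ _, ?_⟩)
      simpa using hi
    · push Not at hc
      have : ∀ i, ∃ k, e i = m k i := fun i => notin_L (hc i)
      choose κ hκ using this
      have hek : (fun i => m (κ i) i) = e := by funext i; exact (hκ i).symm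
      refine mem_union_right _ (mem_image.2 ⟨κ, ?_, hek⟩)
      simp only [mem_filter, mem_univ, true_and]
      refine ⟨fun i hi => he2 i ?_, by rw [hek]; exact heH⟩
      exact mem_image.2 ⟨κ i, by simpa using hi, (hκ i).symm⟩
  refine (card_le_card h1).trans ((card_union_le _ _).trans (Nat.add_le_add ?_ card_image_le))
  refine card_biUnion_le.trans ?_
  refine (sum_le_card_nsmul univ _ ((n - N) * n ^ 2) ?_).trans (by simp)
  intro i _
  rw [card_in, hL]

/-- **Part 2**: almost perfect matching or near-extremal. -/
lemma part2 (ρ : ℝ) (hρ : 0 < ρ) : ∃ ε : ℝ, 0 < ε ∧ ∀ η : ℝ, 0 < η → ∃ n0 : ℕ, ∀ n ≥ n0,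
    ∀ H : Finset (Fin 3 → Fin n), (∀ i v, (5 / 9 - ε) * (n : ℝ) ^ 2 ≤ dg H i v) →
    (∃ M, IsMat H M ∧ (1 - η) * (n : ℝ) ≤ #M) ∨
    ∃ A : Fin 3 → Finset (Fin n), (∀ i, |(#(A i) : ℝ) - n / 3| ≤ ρ * n) ∧
      (#{e ∈ H | ∀ i, e i ∉ A i} : ℝ) ≤ ρ * n ^ 3 := by
  classical
  obtain ⟨κ, hκ0, hκ1, hκ2⟩ : ∃ κ : ℝ, 0 < κ ∧ κ ≤ ρ / 1000 ∧ κ ≤ 1 / 100 :=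
    ⟨min (ρ / 1000) (1 / 100), by positivity, min_le_left _ _, min_le_right _ _⟩
  obtain ⟨ε, hε, _, hst⟩ := struct κ hκ0
  refine ⟨ε, hε, fun η hη => ?_⟩
  obtain ⟨n1, hn1⟩ := hst η hη
  obtain ⟨n2, hn2⟩ := exists_nat_ge (6 * (9 / κ))
  refine ⟨n1 + n2 + 1000, fun n hn H hd => ?_⟩
  obtain ⟨N, m, hm⟩ := exists_MM H
  by_cases hNη : (1 - η) * (n : ℝ) ≤ N
  · left
    refine ⟨univ.image m, ⟨?_, ?_⟩, ?_⟩
    · intro e he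
      obtain ⟨k, _, rfl⟩ := mem_image.1 he
      exact hm.hmH k
    · intro e he f hf i hi
      obtain ⟨k, _, rfl⟩ := mem_image.1 he
      obtain ⟨l, _, rfl⟩ := mem_image.1 hf
      rw [hm.hinj i k l hi]
    · rw [card_image_of_injective _ (fun k l hkl => hm.hinj 0 k l (congrFun hkl 0))]
      simpa using hNη
  right
  obtain ⟨D, S, hD, hnN, hl, hA, hNA⟩ := hn1 n (by omega) N H m hm hd (by linarith)
  have hNn : N ≤ n := by have := hm.card_L 0; omega
  have hNr : (N : ℝ) ≤ n := by exact_mod_cast hNn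
  have hnN' : n ≤ 6 * N := by exact_mod_cast hnN
  have hN100 : (100 : ℝ) ≤ N := by
    have : 100 ≤ N := by omega
    exact_mod_cast this
  have hN9 : 9 ≤ κ * N := by
    have h1 : (n2 : ℝ) ≤ n := by
      have : n2 ≤ n := by omega
      exact_mod_cast this
    have h2 : 9 / κ ≤ N := by linarith
    rw [div_le_iff₀ hκ0] at h2
    linarith
  have hlr : ((n - N : ℕ) : ℝ) = n - N := by push_cast [hNn]; ring
  -- the nonadjacency bound in ℕ
  obtain ⟨x, hx⟩ : ∃ x, x = ⌊κ * (N : ℝ) ^ 2⌋₊ := ⟨_, rfl⟩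
  have hxr : (x : ℝ) ≤ κ * N ^ 2 := by rw [hx]; exact Nat.floor_le (by positivity)
  have hNA' : ∀ i j, i ≠ j → #{p : Fin N × Fin N | ((i, p.1) ∈ S ∨ (j, p.2) ∈ S) ∧
        ¬ (LG H m D).Adj (i, p.1) (j, p.2)} ≤ x := by
    intro i j hij
    rw [hx]
    exact Nat.le_floor (hNA i j hij)
  have hZ : ∀ i j : Fin 3, i ≠ j → (#{k | (i, k) ∈ S ∧ (j, k) ∈ S} : ℝ) ≤ 12 * κ * N := by
    intro i j hij
    have h1 := Z_small hm hD S x hNA' hij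
    have h2 := (abs_le.1 (hA i)).1
    have h3 : (1 : ℝ) ≤ #{k | (i, k) ∈ S} := by nlinarith
    have h3' : 1 ≤ #{k | (i, k) ∈ S} := by exact_mod_cast h3
    have h4 := (Nat.cast_le (α := ℝ)).2 h1
    push_cast [h3'] at h4
    have h5 : (N : ℝ) / 4 ≤ #{k | (i, k) ∈ S} - 1 := by nlinarith
    have h6 : (#{k | (i, k) ∈ S ∧ (j, k) ∈ S} : ℝ) * (N / 4) ≤ 3 * (κ * N ^ 2) := by
      calc _ ≤ (#{k | (i, k) ∈ S ∧ (j, k) ∈ S} : ℝ) * (#{k | (i, k) ∈ S} - 1) := by gcongr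
        _ ≤ 3 * x := h4
        _ ≤ _ := by gcongr
    have hN0 : (0 : ℝ) < N / 4 := by linarith
    refine le_of_mul_le_mul_right (h6.trans (le_of_eq ?_)) hN0
    ring
  have hb0 : (#{k | ∀ a, (a, k) ∉ S} : ℝ) ≤ 39 * κ * N := by
    have h1 := (Nat.cast_le (α := ℝ)).2 (b0_le S)
    rw [Fin.sum_univ_three] at h1
    push_cast at h1
    have a0 := (abs_le.1 (hA 0)).1
    have a1 := (abs_le.1 (hA 1)).1
    have a2 := (abs_le.1 (hA 2)).1
    have z1 := hZ 0 1 (by decide)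
    have z2 := hZ 0 2 (by decide)
    have z3 := hZ 1 2 (by decide)
    linarith
  refine ⟨fun i => ({k | (i, k) ∈ S} : Finset (Fin N)).image (fun k => m k i), ?_, ?_⟩
  · intro i
    rw [card_image_of_injective _ (fun k l hkl => hm.hinj i k l hkl)]
    have h1 := hA i
    rw [hlr] at hl
    have h2 : κ * N ≤ κ * n := by gcongr
    have h3 : 3 * κ * n ≤ ρ * n := by gcongr; linarith
    rw [abs_le] at h1 ⊢
    constructor <;> linarith [h1.1, h1.2]
  · have h1 := lift_count hm S
    have h2 := avoid_count hm hD S x hNA'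
    have h3 := (Nat.cast_le (α := ℝ)).2 (h1.trans (Nat.add_le_add_left h2 _))
    push_cast at h3
    refine h3.trans ?_
    have hn0 : (0 : ℝ) ≤ n := by positivity
    have t1 : ((n - N : ℕ) : ℝ) * n ^ 2 ≤ κ * n ^ 3 := by
      calc ((n - N : ℕ) : ℝ) * n ^ 2 ≤ (κ * n) * n ^ 2 := by
            gcongr; exact hl.trans (by gcongr)
        _ = _ := by ring
    have t2 : 9 * (N : ℝ) ^ 2 ≤ κ * n ^ 3 := by
      calc 9 * (N : ℝ) ^ 2 ≤ (κ * N) * N ^ 2 := by gcongr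
        _ ≤ (κ * n) * n ^ 2 := by gcongr
        _ = _ := by ring
    have t3 : (#{k | ∀ a, (a, k) ∉ S} : ℝ) * N ^ 2 ≤ 39 * κ * n ^ 3 := by
      calc (#{k | ∀ a, (a, k) ∉ S} : ℝ) * N ^ 2 ≤ (39 * κ * N) * N ^ 2 := by gcongr
        _ ≤ (39 * κ * n) * n ^ 2 := by gcongr
        _ = _ := by ring
    have t4 : (x : ℝ) * N ≤ κ * n ^ 3 := by
      calc (x : ℝ) * N ≤ (κ * N ^ 2) * N := by gcongr
        _ ≤ (κ * n ^ 2) * n := by gcongr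
        _ = _ := by ring
    have t5 : 300 * κ * (n : ℝ) ^ 3 ≤ ρ * n ^ 3 := by gcongr; linarith
    have t6 : 0 ≤ κ * (n : ℝ) ^ 3 := by positivity
    linarith

end LM

namespace LM
variable {n : ℕ}

lemma dense_match (H : Finset (Fin 3 → Fin n)) (U : Fin 3 → Finset (Fin n)) (M : ℕ) (hM : 20 ≤ M)
    (hU : ∀ i, #(U i) = M)
    (hd : ∀ i, ∀ v ∈ U i, 20 * #{e ∈ Fintype.piFinset U | e ∉ H ∧ e i = v} ≤ M ^ 2) :
    ∃ F, IsMat H F ∧ ∀ i, F.image (fun e => e i) = U i := by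
  classical
  obtain ⟨N, m, hm⟩ := exists_MM (H ∩ Fintype.piFinset U)
  have hmU : ∀ k i, m k i ∈ U i := fun k i =>
    Fintype.mem_piFinset.1 (mem_inter.1 (hm.hmH k)).2 i
  have hinj : ∀ i, Function.Injective (fun k => m k i) := fun i k l h => hm.hinj i k l h
  have himg : ∀ i, (univ.image (fun k => m k i)) ⊆ U i := by
    intro i v hv
    obtain ⟨k, _, rfl⟩ := mem_image.1 hv
    exact hmU k i
  have hcimg : ∀ i, #(univ.image (fun k => m k i)) = N := fun i => by
    rw [card_image_of_injective _ (hinj i)]; simp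
  have hNM : N ≤ M := by
    rw [← hcimg 0, ← hU 0]; exact card_le_card (himg 0)
  have hsd : ∀ i, #(U i \ univ.image (fun k => m k i)) = M - N := fun i => by
    rw [card_sdiff_of_subset (himg i), hU, hcimg]
  have hL : ∀ i v, v ∈ U i \ univ.image (fun k => m k i) → v ∈ U i ∧ v ∈ Lf m i := by
    intro i v hv
    rw [mem_sdiff] at hv
    refine ⟨hv.1, mem_filter.2 ⟨mem_univ _, fun k hk => hv.2 (mem_image.2 ⟨k, mem_univ _, hk⟩)⟩⟩
  by_cases hlt : N = M
  · refine ⟨univ.image m, ⟨?_, ?_⟩, ?_⟩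
    · intro e he
      obtain ⟨k, _, rfl⟩ := mem_image.1 he
      exact (mem_inter.1 (hm.hmH k)).1
    · intro e he f hf i hi
      obtain ⟨k, _, rfl⟩ := mem_image.1 he
      obtain ⟨l, _, rfl⟩ := mem_image.1 hf
      rw [hm.hinj i k l hi]
    · intro i
      rw [image_image]
      exact eq_of_subset_of_card_le (himg i) (by
        have h1 := hcimg i
        rw [hU, ← hlt]
        exact h1.ge)
  exfalso
  have hx : ∀ i, ∃ v, v ∈ U i \ univ.image (fun k => m k i) := by
    intro i
    apply card_pos.1
    rw [hsd]; omega
  choose x hx using hx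
  have hxU := fun i => (hL i _ (hx i)).1
  have hxL := fun i => (hL i _ (hx i)).2
  by_cases h2 : 2 * N < M
  · -- an edge inside the leftover
    let P := (U 1 \ univ.image (fun k => m k 1)) ×ˢ (U 2 \ univ.image (fun k => m k 2))
    have hP : #P ≤ #{e ∈ Fintype.piFinset U | e ∉ H ∧ e 0 = x 0} := by
      refine card_le_card_of_injOn (fun p => ![x 0, p.1, p.2]) ?_ ?_
      · intro p hp
        obtain ⟨hp1, hp2⟩ := mem_product.1 (mem_coe.1 hp)
        have hpi : (![x 0, p.1, p.2] : Fin 3 → Fin n) ∈ Fintype.piFinset U := by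
          rw [Fintype.mem_piFinset]
          intro i
          fin_cases i
          · exact hxU 0
          · exact (hL 1 _ hp1).1
          · exact (hL 2 _ hp2).1
        refine mem_coe.2 (mem_filter.2 ⟨hpi, ?_, rfl⟩)
        intro hH
        have h1 : IsMat (H ∩ Fintype.piFinset U) {![x 0, p.1, p.2]} :=
          ⟨by simpa using ⟨hH, Fintype.mem_piFinset.1 hpi⟩, by
            intro a ha b hb _ _; rw [mem_singleton.1 ha, mem_singleton.1 hb]⟩
        have := hm.aug0 ∅ _ h1 (by
          intro a ha s
          rw [mem_singleton.1 ha]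
          left
          fin_cases s
          · exact hxL 0
          · exact (hL 1 _ hp1).2
          · exact (hL 2 _ hp2).2)
        simp at this
      · intro p _ q _ hpq
        have h1 := congrFun hpq 1
        have h2 := congrFun hpq 2
        exact Prod.ext h1 h2
    have h3 := hd 0 (x 0) (hxU 0)
    rw [card_product, hsd, hsd] at hP
    obtain ⟨y, hy⟩ : ∃ y, M = N + y := ⟨M - N, by omega⟩
    rw [show M - N = y by omega] at hP
    have : M < 2 * y := by omega
    nlinarith
  · let Q : Fin 3 → Finset (Fin N × Fin N) := fun i => {p | (fun s : Fin 3 =>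
      if s = i then x i else if s = i + 1 then m p.1 s else m p.2 s) ∉ H}
    have hQ : ∀ i, 20 * #(Q i) ≤ M ^ 2 := by
      intro i
      refine le_trans (Nat.mul_le_mul_left 20 ?_) (hd i (x i) (hxU i))
      refine card_le_card_of_injOn (fun p => (fun s : Fin 3 =>
        if s = i then x i else if s = i + 1 then m p.1 s else m p.2 s)) ?_ ?_
      · intro p hp
        refine mem_coe.2 (mem_filter.2 ⟨?_, (mem_filter.1 (mem_coe.1 hp)).2, by simp⟩)
        rw [Fintype.mem_piFinset]
        intro s
        beta_reduce
        split_ifs with h1 h2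
        · rw [h1]; exact hxU i
        · exact hmU _ _
        · exact hmU _ _
      · intro p _ q _ hpq
        have h1 := congrFun hpq (i + 1)
        have h2 := congrFun hpq (i + 2)
        have e1 := (by decide : ∀ i : Fin 3, i + 1 ≠ i) i
        have e2 := (by decide : ∀ i : Fin 3, i + 2 ≠ i) i
        have e3 := (by decide : ∀ i : Fin 3, i + 2 ≠ i + 1) i
        simp only [e1, e2, e3, if_false, if_true] at h1 h2
        exact Prod.ext (hm.hinj _ _ _ h1) (hm.hinj _ _ _ h2)
    let Dg : Finset (Fin N × Fin N) := univ.image (fun k => (k, k))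
    have hDg : #Dg ≤ N := card_image_le.trans (by simp)
    have hex : ∃ p : Fin N × Fin N, p ∉ Dg ∪ (Q 0 ∪ (Q 1 ∪ Q 2)) := by
      by_contra hcon
      push Not at hcon
      have h3 : #(univ : Finset (Fin N × Fin N)) ≤ #(Dg ∪ (Q 0 ∪ (Q 1 ∪ Q 2))) :=
        card_le_card (fun p _ => hcon p)
      have h4 : #(Dg ∪ (Q 0 ∪ (Q 1 ∪ Q 2))) ≤ #Dg + (#(Q 0) + (#(Q 1) + #(Q 2))) :=
        (card_union_le _ _).trans (Nat.add_le_add_left ((card_union_le _ _).trans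
          (Nat.add_le_add_left (card_union_le _ _) _)) _)
      have h5 : #(univ : Finset (Fin N × Fin N)) = N * N := by simp
      have q0 := hQ 0
      have q1 := hQ 1
      have q2 := hQ 2
      have : M ≤ 2 * N := by omega
      have h6 : 20 * (N * N) ≤ 20 * N + 3 * M ^ 2 := by omega
      nlinarith
    obtain ⟨⟨k, l⟩, hp⟩ := hex
    simp only [mem_union, not_or] at hp
    obtain ⟨hp0, hp1, hp2, hp3⟩ := hp
    have hkl : k ≠ l := fun h => hp0 (mem_image.2 ⟨k, mem_univ _, by rw [h]⟩)
    have hH : ∀ i, (fun s : Fin 3 =>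
      if s = i then x i else if s = i + 1 then m k s else m l s) ∈ H ∩ Fintype.piFinset U := by
      intro i
      refine mem_inter.2 ⟨?_, ?_⟩
      · by_contra h
        have : (k, l) ∈ Q i := mem_filter.2 ⟨mem_univ _, h⟩
        fin_cases i
        · exact hp1 this
        · exact hp2 this
        · exact hp3 this
      · rw [Fintype.mem_piFinset]
        intro s
        beta_reduce
        split_ifs with h1 h2
        · rw [h1]; exact hxU i
        · exact hmU _ _
        · exact hmU _ _
    have hxm : ∀ i k, x i ≠ m k i := fun i k => L_ne (hxL i) k
    have hmkl : ∀ i, m k i ≠ m l i := fun i h => hkl (hm.hinj i k l h)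
    have hne : ∀ i j s : Fin 3, i ≠ j → (if s = i then x i else if s = i + 1 then m k s else m l s) ≠
        (if s = j then x j else if s = j + 1 then m k s else m l s) := by
      intro i j s hij
      have := (by decide : ∀ i j s : Fin 3, i ≠ j → s = i ∨ s = j ∨ (s = i + 1 ∧ s ≠ j + 1) ∨ (s ≠ i + 1 ∧ s = j + 1)) i j s hij
      split_ifs with h1 h2 h3 h4 h5 h6 h7
      · exact absurd (h1.symm.trans h2) hij
      · subst h1; exact hxm _ _
      · subst h1; exact hxm _ _
      · subst h5; exact (hxm _ _).symm
      · exfalso; rw [h4] at h6; exact hij (add_right_cancel h6)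
      · exact hmkl _
      · subst h7; exact (hxm _ _).symm
      · exact (hmkl _).symm
      · exfalso; tauto
    have := insert3_mat (IsMat.empty (H ∩ Fintype.piFinset U)) (hH 0) (hH 1) (hH 2) (by simp)
      (fun s => ⟨hne 0 1 s (by decide), hne 0 2 s (by decide), hne 1 2 s (by decide)⟩)
    have hc := hm.aug0 {k, l} _ this.1 (by
      intro a ha s
      have : ∃ i, a = (fun s : Fin 3 => if s = i then x i else if s = i + 1 then m k s else m l s) := by
        simp only [mem_insert, notMem_empty, or_false] at ha
        rcases ha with h | h | h
        · exact ⟨2, h⟩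
        · exact ⟨1, h⟩
        · exact ⟨0, h⟩
      obtain ⟨i, rfl⟩ := this
      simp only
      split_ifs with h1 h2
      · subst h1; exact Or.inl (hxL _)
      · exact Or.inr ⟨k, by simp, rfl⟩
      · exact Or.inr ⟨l, by simp, rfl⟩)
    rw [this.2, card_pair hkl] at hc
    simp at hc

end LM

namespace LM
variable {n : ℕ}

lemma typical (H : Finset (Fin 3 → Fin n)) (A B : Fin 3 → Finset (Fin n)) (m : ℕ) (hn : 80 ≤ n)
    (hdis : ∀ i, Disjoint (A i) (B i)) (hm : ∀ i, #(A i) + #(B i) = m)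
    (hs : #(A 0) + #(A 1) + #(A 2) = m) (hbig : ∀ i, n ≤ 4 * #(A i))
    (hA : ∀ i, ∀ v ∈ A i, 320 * #{e | e ∉ H ∧ e i = v ∧ ∀ j, j ≠ i → e j ∈ B j} ≤ n ^ 2)
    (hB : ∀ i, ∀ v ∈ B i, 320 * #{e | e ∉ H ∧ e i = v ∧ ∃ j, j ≠ i ∧ e j ∈ A j} ≤ n ^ 2) :
    ∃ F, IsMat H F ∧ ∀ i, F.image (fun e => e i) = A i ∪ B i := by
  classical
  have hsum : ∀ i : Fin 3, #(A i) + #(A (i+1)) + #(A (i+2)) = m := by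
    intro i
    fin_cases i
    · exact hs
    · change #(A 1) + #(A 2) + #(A 0) = m; omega
    · change #(A 2) + #(A 0) + #(A 1) = m; omega
  have hC : ∀ i, ∃ C ⊆ B i, #C = #(A (i+1)) := fun i =>
    exists_subset_card_eq (by have := hsum i; have := hm i; omega)
  choose C hCB hCc using hC
  let U : Fin 3 → Fin 3 → Finset (Fin n) := fun j i =>
    if i = j then A j else if i + 1 = j then C i else B i \ C i
  have hUB : ∀ i j, i ≠ j → U j i ⊆ B i := by
    intro i j hij
    simp only [U, hij, if_false]
    split_ifs
    · exact hCB i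
    · exact sdiff_subset
  have hUA : ∀ j, U j j = A j := fun j => by simp [U]
  have hUc : ∀ j i, #(U j i) = #(A j) := by
    intro j i
    simp only [U]
    split_ifs with h1 h2
    · rfl
    · rw [hCc, h2]
    · rw [card_sdiff_of_subset (hCB i), hCc]
      have : j = i + 2 := (by decide : ∀ i j : Fin 3, ¬ i = j → ¬ i + 1 = j → j = i + 2) i j h1 h2
      subst this
      have := hsum i
      have := hm i
      omega
  have hF : ∀ j, ∃ F, IsMat H F ∧ ∀ i, F.image (fun e => e i) = U j i := by
    intro j
    refine dense_match H (U j) #(A j) (by have := hbig j; omega) (hUc j) ?_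
    intro i v hv
    have hb : n ^ 2 ≤ 16 * #(A j) ^ 2 := by
      have := Nat.pow_le_pow_left (hbig j) 2
      rw [mul_pow] at this
      simpa using this
    have key : 320 * #{e ∈ Fintype.piFinset (U j) | e ∉ H ∧ e i = v} ≤ n ^ 2 := by
      by_cases hij : i = j
      · subst hij
        rw [hUA] at hv
        refine le_trans (Nat.mul_le_mul_left _ (card_le_card ?_)) (hA i v hv)
        intro e he
        obtain ⟨h1, h2, h3⟩ := mem_filter.1 he
        rw [Fintype.mem_piFinset] at h1
        exact mem_filter.2 ⟨mem_univ _, h2, h3, fun t ht => hUB t i ht (h1 t)⟩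
      · refine le_trans (Nat.mul_le_mul_left _ (card_le_card ?_)) (hB i v (hUB i j hij hv))
        intro e he
        obtain ⟨h1, h2, h3⟩ := mem_filter.1 he
        rw [Fintype.mem_piFinset] at h1
        exact mem_filter.2 ⟨mem_univ _, h2, h3, j, fun h => hij h.symm, hUA j ▸ h1 j⟩
    omega
  choose F hF hFi using hF
  have hmem : ∀ j i, ∀ e ∈ F j, e i ∈ U j i := fun j i e he => by
    rw [← hFi j i]; exact mem_image_of_mem _ he
  have hUd : ∀ j k i, j ≠ k → Disjoint (U j i) (U k i) := by
    intro j k i hjk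
    rw [disjoint_left]
    intro v hv hv'
    by_cases h1 : i = j
    · subst h1
      rw [hUA] at hv
      exact disjoint_left.1 (hdis i) hv (hUB i k hjk hv')
    by_cases h2 : i = k
    · subst h2
      rw [hUA] at hv'
      exact disjoint_left.1 (hdis i) hv' (hUB i j h1 hv)
    simp only [U, h1, h2, if_false] at hv hv'
    by_cases h3 : i + 1 = j
    · have h4 : i + 1 ≠ k := fun h => hjk (h3.symm.trans h)
      simp only [h3, if_true] at hv
      rw [if_neg h4] at hv'
      exact (mem_sdiff.1 hv').2 hv
    · have h4 : i + 1 = k := (by decide : ∀ i j k : Fin 3, ¬ i = j → ¬ i = k → j ≠ k → ¬ i + 1 = j → i + 1 = k) i j k h1 h2 hjk h3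
      rw [if_pos h4] at hv'
      rw [if_neg h3] at hv
      exact (mem_sdiff.1 hv).2 hv'
  have hne : ∀ j k, j ≠ k → ∀ e ∈ F j, ∀ f ∈ F k, ∀ i, e i ≠ f i := by
    intro j k hjk e he f hf i h
    exact disjoint_left.1 (hUd j k i hjk) (hmem j i e he) (h ▸ hmem k i f hf)
  have u1 := (hF 0).union (hF 1) (hne 0 1 (by decide))
  have u2 := u1.1.union (hF 2) (by
    intro e he
    rcases mem_union.1 he with h | h
    · exact hne 0 2 (by decide) e h
    · exact hne 1 2 (by decide) e h)
  refine ⟨_, u2.1, ?_⟩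
  intro i
  rw [image_union, image_union, hFi, hFi, hFi]
  have hBC : C i ∪ B i \ C i = B i := union_sdiff_of_subset (hCB i)
  fin_cases i
  · change A 0 ∪ C 0 ∪ (B 0 \ C 0) = _
    rw [union_assoc]; exact congrArg _ hBC
  · change (B 1 \ C 1) ∪ A 1 ∪ C 1 = A 1 ∪ B 1
    rw [← show C 1 ∪ B 1 \ C 1 = B 1 from hBC]
    ext v; simp only [mem_union, mem_sdiff]; tauto
  · change C 2 ∪ (B 2 \ C 2) ∪ A 2 = A 2 ∪ B 2
    rw [show C 2 ∪ B 2 \ C 2 = B 2 from hBC, union_comm]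

lemma greedy (M0 : Finset (Fin 3 → Fin n)) (q : ℕ) (T : Finset (Fin 3 × Fin n))
    (E : Fin 3 × Fin n → Finset (Fin 3 → Fin n))
    (hE : ∀ x ∈ T, (∀ e ∈ E x, e x.1 = x.2) ∧ 2 * q * n < #(E x))
    (hT : ∀ x ∈ T, ∀ e ∈ M0, e x.1 ≠ x.2) (hq : #M0 + 2 * #T ≤ q) :
    ∀ S ⊆ T, ∃ g : Fin 3 × Fin n → (Fin 3 → Fin n), (∀ x ∈ S, g x ∈ E x) ∧
      (∀ x ∈ S, ∀ e ∈ M0, ∀ j, e j ≠ g x j) ∧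
      (∀ x ∈ S, ∀ y ∈ S, x ≠ y → ∀ j, g x j ≠ g y j) ∧
      (∀ x ∈ S, ∀ y ∈ T, y ≠ x → g x y.1 ≠ y.2) := by
  classical
  intro S
  induction S using Finset.induction_on with
  | empty => intro _; exact ⟨fun x => fun _ => x.2, by simp, by simp, by simp, by simp⟩
  | insert x S hxS ih =>
    intro hST
    obtain ⟨g, h1, h2, h3, h4⟩ := ih (fun y hy => hST (mem_insert_of_mem hy))
    have hxT : x ∈ T := hST (mem_insert_self _ _)
    let Fb : Fin 3 → Finset (Fin n) := fun j =>
      M0.image (fun e => e j) ∪ (S.image (fun y => g y j) ∪ T.image (fun y => y.2))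
    have hFb : ∀ j, #(Fb j) ≤ q := by
      intro j
      have a1 : #(M0.image (fun e => e j)) ≤ #M0 := card_image_le
      have a2 : #(S.image (fun y => g y j)) ≤ #S := card_image_le
      have a3 : #(T.image (fun y => y.2)) ≤ #T := card_image_le
      have a4 : #S ≤ #T := card_le_card (fun y hy => hST (mem_insert_of_mem hy))
      have a5 := card_union_le (M0.image (fun e => e j)) (S.image (fun y => g y j) ∪ T.image (fun y => y.2))
      have a6 := card_union_le (S.image (fun y => g y j)) (T.image (fun y => y.2))
      change #(M0.image (fun e => e j) ∪ (S.image (fun y => g y j) ∪ T.image (fun y => y.2))) ≤ q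
      omega
    have hex : ∃ e ∈ E x, ∀ j, j ≠ x.1 → e j ∉ Fb j := by
      by_contra hcon
      push Not at hcon
      have hsub : E x ⊆ ({e | e x.1 = x.2 ∧ e (x.1 + 1) ∈ Fb (x.1 + 1)} : Finset (Fin 3 → Fin n)) ∪
          ({e | e x.1 = x.2 ∧ e (x.1 + 2) ∈ Fb (x.1 + 2)} : Finset (Fin 3 → Fin n)) := by
        intro e he
        obtain ⟨j, hj, hjF⟩ := hcon e he
        have hex := (hE x hxT).1 e he
        rcases (by decide : ∀ i j : Fin 3, j ≠ i → j = i + 1 ∨ j = i + 2) x.1 j hj with h | h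
        · exact mem_union_left _ (mem_filter.2 ⟨mem_univ _, hex, h ▸ hjF⟩)
        · exact mem_union_right _ (mem_filter.2 ⟨mem_univ _, hex, h ▸ hjF⟩)
      have := (card_le_card hsub).trans (card_union_le _ _)
      rw [card_fix_in ((by decide : ∀ i : Fin 3, i ≠ i + 1) _),
        card_fix_in ((by decide : ∀ i : Fin 3, i ≠ i + 2) _)] at this
      have b1 := Nat.mul_le_mul_right n (hFb (x.1 + 1))
      have b2 := Nat.mul_le_mul_right n (hFb (x.1 + 2))
      have b3 := (hE x hxT).2
      have b4 : 2 * q * n = q * n + q * n := by ring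
      omega
    obtain ⟨e, heE, heF⟩ := hex
    have hei := (hE x hxT).1 e heE
    have hgS : ∀ y ∈ S, Function.update g x e y = g y := fun y hy =>
      Function.update_of_ne (by rintro rfl; exact hxS hy) _ _
    have hgx : Function.update g x e x = e := Function.update_self _ _ _
    have hSe : ∀ y ∈ S, ∀ j, g y j ≠ e j := by
      intro y hy j h
      by_cases hj : j = x.1
      · subst hj
        rw [hei] at h
        exact h4 y hy x hxT (fun h' => hxS (h' ▸ hy)) h
      · exact heF j hj (mem_union_right _ (mem_union_left _ (mem_image.2 ⟨y, hy, h⟩)))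
    refine ⟨Function.update g x e, ?_, ?_, ?_, ?_⟩
    · intro y hy
      rcases mem_insert.1 hy with rfl | hy
      · rw [hgx]; exact heE
      · rw [hgS y hy]; exact h1 y hy
    · intro y hy f hf j
      rcases mem_insert.1 hy with rfl | hy
      · rw [hgx]
        by_cases hj : j = y.1
        · subst hj; rw [hei]; exact hT y hxT f hf
        · intro h
          exact heF j hj (mem_union_left _ (mem_image.2 ⟨f, hf, h⟩))
      · rw [hgS y hy]; exact h2 y hy f hf j
    · intro y hy z hz hyz j
      rcases mem_insert.1 hy with hy' | hy' <;> rcases mem_insert.1 hz with hz' | hz'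
      · exact absurd (hy'.trans hz'.symm) hyz
      · rw [hy', hgx, hgS z hz']; exact (hSe z hz' j).symm
      · rw [hz', hgx, hgS y hy']; exact hSe y hy' j
      · rw [hgS y hy', hgS z hz']; exact h3 y hy' z hz' hyz j
    · intro y hy z hz hzy
      rcases mem_insert.1 hy with rfl | hy
      · rw [hgx]
        by_cases hj : z.1 = y.1
        · rw [hj, hei]; intro h; exact hzy (Prod.ext hj h.symm)
        · intro h
          exact heF z.1 hj (mem_union_right _ (mem_union_right _ (mem_image.2 ⟨z, hz, h.symm⟩)))
      · rw [hgS y hy]; exact h4 y hy z hz hzy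

end LM

namespace LM
variable {n : ℕ}

lemma card_fix_two (i : Fin 3) (v : Fin n) (A : Fin 3 → Finset (Fin n)) :
    #{e : Fin 3 → Fin n | e i = v ∧ ∀ j, j ≠ i → e j ∈ A j} = #(A (i+1)) * #(A (i+2)) := by
  classical
  have : ({e : Fin 3 → Fin n | e i = v ∧ ∀ j, j ≠ i → e j ∈ A j} : Finset _) =
      Fintype.piFinset (Function.update A i ({v} : Finset (Fin n))) := by
    ext e
    simp only [mem_filter, mem_univ, true_and, Fintype.mem_piFinset]
    constructor
    · rintro ⟨h, h'⟩ j
      by_cases hj : j = i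
      · subst hj; simp [h]
      · rw [Function.update_of_ne hj]; exact h' j hj
    · intro h
      refine ⟨by simpa using h i, fun j hj => ?_⟩
      have := h j
      rwa [Function.update_of_ne hj] at this
  rw [this, card_pi]
  fin_cases i
  · simp
  · simp; exact mul_comm _ _
  · simp

lemma card_pairs (P : Fin 3 → Finset (Fin n)) (c : ℝ) (h : ∀ i, (#(P i) : ℝ) ≤ c) :
    (#{x : Fin 3 × Fin n | x.2 ∈ P x.1} : ℝ) ≤ 3 * c := by
  classical
  have : ({x : Fin 3 × Fin n | x.2 ∈ P x.1} : Finset _) ⊆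
      univ.biUnion (fun i => (P i).image (fun v => (i, v))) := by
    intro x hx
    exact mem_biUnion.2 ⟨x.1, mem_univ _, mem_image.2 ⟨x.2, (mem_filter.1 hx).2, rfl⟩⟩
  have h1 := (card_le_card this).trans card_biUnion_le
  rw [Fin.sum_univ_three] at h1
  have h2 : ∀ i : Fin 3, #((P i).image (fun v => (i, v))) ≤ #(P i) := fun i => card_image_le
  have a := h2 0
  have b := h2 1
  have c' := h2 2
  have h3 : #{x : Fin 3 × Fin n | x.2 ∈ P x.1} ≤ #(P 0) + #(P 1) + #(P 2) := by omega
  have h4 : (#{x : Fin 3 × Fin n | x.2 ∈ P x.1} : ℝ) ≤ #(P 0) + #(P 1) + #(P 2) := by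
    exact_mod_cast h3
  linarith [h 0, h 1, h 2]

set_option maxHeartbeats 2000000 in
lemma ext_finish (H : Finset (Fin 3 → Fin n)) (A : Fin 3 → Finset (Fin n)) (hn : 80 ≤ n)
    (hA : ∀ i, |(#(A i) : ℝ) - n / 3| ≤ 1 / 1000000 * n)
    (h2 : ∀ i, (#{v ∈ A i | n ^ 2 < 320 * #{e | e ∉ H ∧ e i = v ∧ ∀ j, j ≠ i → e j ∉ A j}} : ℝ)
      ≤ 1 / 1000000 * n)
    (h3 : ∀ i, ∀ v ∈ A i, 1 / 10000 * (n : ℝ) ^ 2 ≤ #{e ∈ H | e i = v ∧ ∀ j, j ≠ i → e j ∉ A j})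
    (h5 : ∀ i, ∀ v ∉ A i, 320 * #{e | e ∉ H ∧ e i = v ∧ ∃ j, j ≠ i ∧ e j ∈ A j} ≤ n ^ 2)
    (M0 : Finset (Fin 3 → Fin n)) (hM0 : IsMat H M0) (hM0B : ∀ e ∈ M0, ∀ i, e i ∉ A i)
    (hM0c : #M0 = n - (#(A 0) + #(A 1) + #(A 2))) :
    ∃ M, IsMat H M ∧ #M = n := by
  classical
  have hnR : (80 : ℝ) ≤ n := by exact_mod_cast hn
  have hAl : ∀ i, (n : ℝ) / 3 - 1 / 1000000 * n ≤ #(A i) := fun i => by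
    have := (abs_le.1 (hA i)).1; linarith
  have hAu : ∀ i, (#(A i) : ℝ) ≤ (n : ℝ) / 3 + 1 / 1000000 * n := fun i => by
    have := (abs_le.1 (hA i)).2; linarith
  let at' : Fin 3 → Finset (Fin n) := fun i =>
    {v ∈ A i | n ^ 2 < 320 * #{e | e ∉ H ∧ e i = v ∧ ∀ j, j ≠ i → e j ∉ A j}}
  obtain ⟨Ta, hTa⟩ : ∃ Ta : Finset (Fin 3 × Fin n), Ta = ({x | x.2 ∈ at' x.1} : Finset _) := ⟨_, rfl⟩
  have hTac : (#Ta : ℝ) ≤ 3 * (1 / 1000000 * n) := by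
    rw [hTa]; exact card_pairs at' _ h2
  have hTaA : ∀ x ∈ Ta, x.2 ∈ A x.1 := by
    intro x hx
    rw [hTa] at hx
    exact (mem_filter.1 (mem_filter.1 hx).2).1
  have hA0n : #(A 0)ᶜ = n - #(A 0) := by rw [card_compl, Fintype.card_fin]
  have hA12 : #(A 1) + #(A 2) ≤ n := by
    have h1 := hAu 1
    have h2 := hAu 2
    have : (#(A 1) : ℝ) + #(A 2) ≤ n := by linarith
    exact_mod_cast this
  obtain ⟨D, hDs, hDc⟩ := exists_subset_card_eq (s := (A 0)ᶜ)
    (n := (#(A 0) + #(A 1) + #(A 2)) - n) (by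
      rw [hA0n]
      have h1 := hAu 0
      have h2 := hAu 1
      have h3 := hAu 2
      have : 2 * (#(A 0) : ℝ) + #(A 1) + #(A 2) ≤ 2 * n := by linarith
      have : 2 * #(A 0) + #(A 1) + #(A 2) ≤ 2 * n := by exact_mod_cast this
      omega)
  obtain ⟨Tb, hTb⟩ : ∃ Tb : Finset (Fin 3 × Fin n), Tb = D.image (fun v => ((0 : Fin 3), v)) := ⟨_, rfl⟩
  have hTbc : #Tb = #D := by
    rw [hTb]; exact card_image_of_injective _ (fun a b h => (Prod.ext_iff.1 h).2)
  have hTbA : ∀ x ∈ Tb, x.2 ∉ A x.1 := by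
    intro x hx
    rw [hTb] at hx
    obtain ⟨v, hv, rfl⟩ := mem_image.1 hx
    exact mem_compl.1 (hDs hv)
  have hdisj : Disjoint Ta Tb := disjoint_left.2 fun x hx hx' => hTbA x hx' (hTaA x hx)
  let E : Fin 3 × Fin n → Finset (Fin 3 → Fin n) := fun x =>
    if x.2 ∈ A x.1 then ({e ∈ H | e x.1 = x.2 ∧ ∀ j, j ≠ x.1 → e j ∉ A j} : Finset _)
    else ({e ∈ H | e x.1 = x.2 ∧ ∀ j, j ≠ x.1 → e j ∈ A j} : Finset _)
  have hEH : ∀ x, ∀ e ∈ E x, e ∈ H ∧ e x.1 = x.2 := by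
    intro x e he
    simp only [E] at he
    split_ifs at he
    · exact ⟨(mem_filter.1 he).1, (mem_filter.1 he).2.1⟩
    · exact ⟨(mem_filter.1 he).1, (mem_filter.1 he).2.1⟩
  have hEc : ∀ x, 1 / 10000 * (n : ℝ) ^ 2 ≤ #(E x) := by
    intro x
    by_cases hx : x.2 ∈ A x.1
    · simp only [E, hx, if_true]; exact h3 x.1 x.2 hx
    · simp only [E, hx, if_false]
      have g1 := card_fix_two x.1 x.2 A
      have g2 := h5 x.1 x.2 hx
      have g3 : ({e : Fin 3 → Fin n | e x.1 = x.2 ∧ ∀ j, j ≠ x.1 → e j ∈ A j} : Finset _) ⊆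
          ({e ∈ H | e x.1 = x.2 ∧ ∀ j, j ≠ x.1 → e j ∈ A j} : Finset _) ∪
          ({e | e ∉ H ∧ e x.1 = x.2 ∧ ∃ j, j ≠ x.1 ∧ e j ∈ A j} : Finset _) := by
        intro e he
        obtain ⟨-, ha, hb⟩ := mem_filter.1 he
        by_cases hH : e ∈ H
        · exact mem_union_left _ (mem_filter.2 ⟨hH, ha, hb⟩)
        · refine mem_union_right _ (mem_filter.2 ⟨mem_univ _, hH, ha, x.1 + 1, ?_, hb _ ?_⟩) <;>
          exact (by decide : ∀ i : Fin 3, i + 1 ≠ i) _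
      have g4 := (card_le_card g3).trans (card_union_le _ _)
      rw [g1] at g4
      have g5 : (#(A (x.1+1)) : ℝ) * #(A (x.1+2)) ≤
        (#{e ∈ H | e x.1 = x.2 ∧ ∀ j, j ≠ x.1 → e j ∈ A j} : ℝ) +
        #{e | e ∉ H ∧ e x.1 = x.2 ∧ ∃ j, j ≠ x.1 ∧ e j ∈ A j} := by exact_mod_cast g4
      have g6 : 320 * (#{e | e ∉ H ∧ e x.1 = x.2 ∧ ∃ j, j ≠ x.1 ∧ e j ∈ A j} : ℝ) ≤ (n : ℝ) ^ 2 := by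
        exact_mod_cast g2
      have g7 : (n : ℝ) / 4 ≤ #(A (x.1+1)) := by have := hAl (x.1+1); linarith
      have g8 : (n : ℝ) / 4 ≤ #(A (x.1+2)) := by have := hAl (x.1+2); linarith
      have g9 : (n : ℝ) / 4 * (n / 4) ≤ (#(A (x.1+1)) : ℝ) * #(A (x.1+2)) :=
        mul_le_mul g7 g8 (by positivity) (Nat.cast_nonneg _)
      clear hEH
      nlinarith only [g9, g5, g6, sq_nonneg (n : ℝ)]
  have hDR : (#D : ℝ) ≤ 3 * (1 / 1000000 * n) := by
    by_cases h : #(A 0) + #(A 1) + #(A 2) ≤ n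
    · rw [hDc, Nat.sub_eq_zero_of_le h]; simp
    · push Not at h
      rw [hDc, Nat.cast_sub h.le]
      push_cast
      linarith [hAu 0, hAu 1, hAu 2]
  have hMR : (#M0 : ℝ) ≤ 3 * (1 / 1000000 * n) := by
    by_cases h : n ≤ #(A 0) + #(A 1) + #(A 2)
    · rw [hM0c, Nat.sub_eq_zero_of_le h]; simp
    · push Not at h
      rw [hM0c, Nat.cast_sub h.le]
      push_cast
      linarith [hAl 0, hAl 1, hAl 2]
  obtain ⟨T, hT⟩ : ∃ T, T = Ta ∪ Tb := ⟨_, rfl⟩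
  have hTc : #T = #Ta + #D := by rw [hT, card_union_of_disjoint hdisj, hTbc]
  have hTR : (#T : ℝ) = #Ta + #D := by rw [hTc]; push_cast; ring
  obtain ⟨g, k1, k2, k3, -⟩ := greedy M0 (#M0 + 2 * #T) T E (by
    intro x hx
    refine ⟨fun e he => (hEH x e he).2, ?_⟩
    have := hEc x
    have hh : (2 * (#M0 + 2 * #T : ℕ) * n : ℝ) < #(E x) := by
      push_cast
      rw [hTR]
      nlinarith only [hnR, this, hMR, hTac, hDR]
    exact_mod_cast hh) (by
    intro x hx e he
    rw [hT] at hx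
    rcases mem_union.1 hx with hx | hx
    · intro h
      exact hM0B e he x.1 (h ▸ hTaA x hx)
    · exfalso
      have a1 : 0 < #D := by rw [← hTbc]; exact card_pos.2 ⟨x, hx⟩
      have a2 : 0 < #M0 := card_pos.2 ⟨e, he⟩
      omega) le_rfl T (Finset.Subset.refl _)
  have hginj : Set.InjOn g (T : Set _) := by
    intro x hx y hy hxy
    by_contra hne
    exact k3 x hx y hy hne 0 (congrFun hxy 0)
  have hMT : IsMat H (T.image g) := by
    refine ⟨?_, ?_⟩
    · intro e he
      obtain ⟨x, hx, rfl⟩ := mem_image.1 he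
      exact (hEH x _ (k1 x hx)).1
    · intro e he f hf i hi
      obtain ⟨x, hx, rfl⟩ := mem_image.1 he
      obtain ⟨y, hy, rfl⟩ := mem_image.1 hf
      by_contra hne
      exact k3 x hx y hy (fun h => hne (by rw [h])) i hi
  have hU := hM0.union hMT (by
    intro e he f hf i
    obtain ⟨x, hx, rfl⟩ := mem_image.1 hf
    exact k2 x hx e he i)
  rw [card_image_of_injOn hginj] at hU
  obtain ⟨M1, hM1⟩ : ∃ M1, M1 = M0 ∪ T.image g := ⟨_, rfl⟩
  rw [← hM1] at hU
  obtain ⟨hM1m, hM1c⟩ := hU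
  let A' : Fin 3 → Finset (Fin n) := fun i => A i \ M1.image (fun e => e i)
  let B' : Fin 3 → Finset (Fin n) := fun i => (A i)ᶜ \ M1.image (fun e => e i)
  have himg := fun i => hM1m.image_card i
  have hA'c : ∀ i, #(A' i) + #{e ∈ M1 | e i ∈ A i} = #(A i) := by
    intro i
    have e1 : #(A i ∩ M1.image (fun e => e i)) = #{e ∈ M1 | e i ∈ A i} := by
      have : A i ∩ M1.image (fun e => e i) = ({e ∈ M1 | e i ∈ A i} : Finset _).image (fun e => e i) := by
        ext v
        simp only [mem_inter, mem_image, mem_filter]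
        constructor
        · rintro ⟨hv, e, he, rfl⟩; exact ⟨e, ⟨he, hv⟩, rfl⟩
        · rintro ⟨e, ⟨he, hv⟩, rfl⟩; exact ⟨hv, e, he, rfl⟩
      rw [this]
      exact (hM1m.sub (filter_subset _ _)).image_card i
    rw [← e1]
    exact card_sdiff_add_card_inter _ _
  have hAB : ∀ i, A' i ∪ B' i = univ \ M1.image (fun e => e i) := by
    intro i; ext v; simp only [A', B', mem_union, mem_sdiff, mem_compl, mem_univ, true_and]; tauto
  have hdisAB : ∀ i, Disjoint (A' i) (B' i) := fun i =>
    disjoint_left.2 fun v hv hv' => (mem_compl.1 (mem_sdiff.1 hv').1) (mem_sdiff.1 hv).1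
  have hABc : ∀ i, #(A' i) + #(B' i) = n - #M1 := by
    intro i
    rw [← card_union_of_disjoint (hdisAB i), hAB, card_sdiff_of_subset (subset_univ _), himg]
    simp
  have hM1n : #M1 ≤ n := hM1m.card_le
  -- the weight count
  have hw : #{e ∈ M1 | e 0 ∈ A 0} + #{e ∈ M1 | e 1 ∈ A 1} + #{e ∈ M1 | e 2 ∈ A 2} = #Ta + 2 * #D := by
    have s1 : #{e ∈ M1 | e 0 ∈ A 0} + #{e ∈ M1 | e 1 ∈ A 1} + #{e ∈ M1 | e 2 ∈ A 2} =
        ∑ e ∈ M1, #{i : Fin 3 | e i ∈ A i} := by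
      have : ∀ e : Fin 3 → Fin n, #{i : Fin 3 | e i ∈ A i} =
          (if e 0 ∈ A 0 then 1 else 0) + (if e 1 ∈ A 1 then 1 else 0) + (if e 2 ∈ A 2 then 1 else 0) := by
        intro e
        rw [card_filter, Fin.sum_univ_three]
      simp only [this, sum_add_distrib, card_filter]
    have hdM : Disjoint M0 (T.image g) := disjoint_left.2 (by
      intro e he hf
      obtain ⟨x, hx, rfl⟩ := mem_image.1 hf
      exact k2 x hx _ he 0 rfl)
    rw [s1, hM1, sum_union hdM, sum_image hginj, hT, sum_union hdisj]
    have w0 : ∑ e ∈ M0, #{i : Fin 3 | e i ∈ A i} = 0 := by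
      apply sum_eq_zero
      intro e he
      rw [card_eq_zero, filter_eq_empty_iff]
      intro i _; exact hM0B e he i
    have w1 : ∑ x ∈ Ta, #{i : Fin 3 | g x i ∈ A i} = #Ta := by
      rw [card_eq_sum_ones]
      apply sum_congr rfl
      intro x hx
      have hk := k1 x (hT ▸ mem_union_left _ hx)
      have hxA := hTaA x hx
      simp only [E, hxA, if_true] at hk
      obtain ⟨-, ha, hb⟩ := mem_filter.1 hk
      rw [card_eq_one]
      refine ⟨x.1, ?_⟩
      ext j
      simp only [mem_filter, mem_univ, true_and, mem_singleton]
      constructor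
      · intro h; by_contra hj; exact hb j hj h
      · rintro rfl; rw [ha]; exact hxA
    have w2 : ∑ x ∈ Tb, #{i : Fin 3 | g x i ∈ A i} = 2 * #D := by
      rw [← hTbc, mul_comm, ← smul_eq_mul]
      apply sum_eq_card_nsmul
      intro x hx
      have hk := k1 x (hT ▸ mem_union_right _ hx)
      have hxA := hTbA x hx
      simp only [E, hxA, if_false] at hk
      obtain ⟨-, ha, hb⟩ := mem_filter.1 hk
      have : ({i : Fin 3 | g x i ∈ A i} : Finset _) = univ.erase x.1 := by
        ext j
        simp only [mem_filter, mem_univ, true_and, mem_erase, and_true]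
        constructor
        · rintro h rfl; rw [ha] at h; exact hxA h
        · intro h; exact hb j h
      rw [this, card_erase_of_mem (mem_univ _)]; simp
    rw [w0, w1, w2]; ring
  have hcov : ∀ x ∈ T, x.2 ∈ M1.image (fun e => e x.1) := by
    intro x hx
    rw [hM1]
    exact mem_image.2 ⟨g x, mem_union_right _ (mem_image_of_mem _ hx), (hEH x _ (k1 x hx)).2⟩
  obtain ⟨F, hF, hFi⟩ := typical H A' B' (n - #M1) hn hdisAB hABc (by
    have a0 := hA'c 0
    have a1 := hA'c 1
    have a2 := hA'c 2
    omega) (by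
    intro i
    have a0 := hA'c i
    have a1 : #{e ∈ M1 | e i ∈ A i} ≤ #M1 := card_filter_le _ _
    have a2 : (#(A' i) : ℝ) + #M1 ≥ #(A i) := by
      have : #(A i) ≤ #(A' i) + #M1 := by omega
      exact_mod_cast this
    have a3 : (#M1 : ℝ) = #M0 + (#Ta + #D) := by rw [hM1c, Nat.cast_add, hTR]
    have a4 := hAl i
    have : (n : ℝ) ≤ 4 * #(A' i) := by linarith
    exact_mod_cast this) (by
    intro i v hv
    obtain ⟨hvA, hvM⟩ := mem_sdiff.1 hv
    have : v ∉ at' i := by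
      intro h
      apply hvM
      exact hcov (i, v) (hT ▸ mem_union_left _ (hTa ▸ mem_filter.2 ⟨mem_univ _, h⟩))
    have h' : ¬ (n ^ 2 < 320 * #{e | e ∉ H ∧ e i = v ∧ ∀ j, j ≠ i → e j ∉ A j}) := fun h =>
      this (mem_filter.2 ⟨hvA, h⟩)
    refine le_trans (Nat.mul_le_mul_left _ (card_le_card ?_)) (not_lt.1 h')
    intro e he
    obtain ⟨-, b1, b2, b3⟩ := mem_filter.1 he
    exact mem_filter.2 ⟨mem_univ _, b1, b2, fun j hj => mem_compl.1 (mem_sdiff.1 (b3 j hj)).1⟩) (by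
    intro i v hv
    obtain ⟨hvA, hvM⟩ := mem_sdiff.1 hv
    refine le_trans (Nat.mul_le_mul_left _ (card_le_card ?_)) (h5 i v (mem_compl.1 hvA))
    intro e he
    obtain ⟨-, b1, b2, j, hj, b3⟩ := mem_filter.1 he
    exact mem_filter.2 ⟨mem_univ _, b1, b2, j, hj, (mem_sdiff.1 b3).1⟩)
  have hfin := hM1m.union hF (by
    intro e he f hf i h
    have : f i ∈ A' i ∪ B' i := by rw [← hFi i]; exact mem_image_of_mem _ hf
    rw [hAB] at this
    exact (mem_sdiff.1 this).2 (mem_image.2 ⟨e, he, h⟩))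
  refine ⟨_, hfin.1, ?_⟩
  rw [hfin.2, ← hF.image_card 0, hFi, hAB, card_sdiff_of_subset (subset_univ _), himg]
  simp
  omega

end LM

namespace LM
variable {n : ℕ}

lemma two_disj_aux (G : Finset (Fin 3 → Fin n)) (hpair : ∀ e ∈ G, ∀ f ∈ G, ∃ s, e s = f s)
    (i j t : Fin 3) (hc : ∀ s : Fin 3, s = i ∨ s = j ∨ s = t)
    {e f g : Fin 3 → Fin n} (he : e ∈ G) (hf : f ∈ G) (hg : g ∈ G) (hi : e i = f i) (hj : e j = f j)
    (ht : e t ≠ f t) (hgi : g i ≠ e i) : g j = e j := by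
  obtain ⟨s, hs⟩ := hpair g hg e he
  obtain ⟨s', hs'⟩ := hpair g hg f hf
  rcases hc s with rfl | rfl | rfl
  · exact absurd hs hgi
  · exact hs
  rcases hc s' with rfl | rfl | rfl
  · exact absurd (hs'.trans hi.symm) hgi
  · exact hs'.trans hj.symm
  · exact absurd (hs.symm.trans hs') ht

lemma two_disj (G : Finset (Fin 3 → Fin n)) (B : Fin 3 → Finset (Fin n)) (hB : ∀ i, 4 ≤ #(B i))
    (hdeg : ∀ i, ∀ v ∈ B i, ∃ e ∈ G, ∃ f ∈ G, e ≠ f ∧ e i = v ∧ f i = v) :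
    ∃ e ∈ G, ∃ f ∈ G, ∀ s, e s ≠ f s := by
  classical
  by_contra hcon
  push Not at hcon
  have hpick : ∀ i (u v : Fin n), ∃ w ∈ B i, w ≠ u ∧ w ≠ v := by
    intro i u v
    have : 0 < #(B i \ {u, v}) := by
      have h1 := le_card_sdiff ({u, v} : Finset (Fin n)) (B i)
      have h2 : #({u, v} : Finset (Fin n)) ≤ 2 := card_le_two
      have := hB i
      omega
    obtain ⟨w, hw⟩ := card_pos.1 this
    simp only [mem_sdiff, mem_insert, mem_singleton, not_or] at hw
    exact ⟨w, hw.1, hw.2.1, hw.2.2⟩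
  have c1 : ∀ i j t : Fin 3, (∀ s : Fin 3, s = i ∨ s = j ∨ s = t) → ∀ e ∈ G, ∀ f ∈ G, e i = f i →
      e j ≠ f j → e t ≠ f t → False := by
    intro i j t hc e he f hf hi hj ht
    have key : ∀ g ∈ G, g i ≠ e i → (g j = e j ∧ g t = f t) ∨ (g j = f j ∧ g t = e t) := by
      intro g hg hgi
      obtain ⟨s, hs⟩ := hcon g hg e he
      obtain ⟨s', hs'⟩ := hcon g hg f hf
      rcases hc s with rfl | rfl | rfl
      · exact absurd hs hgi
      · rcases hc s' with rfl | rfl | rfl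
        · exact absurd (hs'.trans hi.symm) hgi
        · exact absurd (hs.symm.trans hs') hj
        · exact Or.inl ⟨hs, hs'⟩
      · rcases hc s' with rfl | rfl | rfl
        · exact absurd (hs'.trans hi.symm) hgi
        · exact Or.inr ⟨hs', hs⟩
        · exact absurd (hs.symm.trans hs') ht
    have hdis : ∀ g ∈ G, ∀ h ∈ G, g i ≠ h i → g j = e j ∧ g t = f t → h j = f j ∧ h t = e t → False := by
      intro g hg h hh hne h1 h2
      obtain ⟨s, hs⟩ := hcon g hg h hh
      rcases hc s with rfl | rfl | rfl
      · exact hne hs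
      · exact hj (by rw [← h1.1, hs, h2.1])
      · exact ht (by rw [← h2.2, ← hs, h1.2])
    obtain ⟨w, hw, hwe, -⟩ := hpick i (e i) (e i)
    obtain ⟨g, hg, g', hg', hne, hgw, hgw'⟩ := hdeg i w hw
    obtain ⟨u, hu, hue, huw⟩ := hpick i (e i) w
    obtain ⟨h, hh, -, -, -, hhu, -⟩ := hdeg i u hu
    have heq : ∀ a b : Fin 3 → Fin n, a i = b i → a j = b j → a t = b t → a = b := by
      intro a b h1 h2 h3
      funext s
      rcases hc s with rfl | rfl | rfl <;> assumption
    have d1 : g i ≠ h i := by rw [hgw, hhu]; exact huw.symm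
    have d2 : g' i ≠ h i := by rw [hgw', hhu]; exact huw.symm
    rcases key g hg (by rw [hgw]; exact hwe) with k | k <;>
    rcases key g' hg' (by rw [hgw']; exact hwe) with k' | k'
    · exact hne (heq _ _ (hgw.trans hgw'.symm) (k.1.trans k'.1.symm) (k.2.trans k'.2.symm))
    · rcases key h hh (by rw [hhu]; exact hue) with k2 | k2
      · exact hdis h hh g' hg' d2.symm k2 k'
      · exact hdis g hg h hh d1 k k2
    · rcases key h hh (by rw [hhu]; exact hue) with k2 | k2
      · exact hdis h hh g hg d1.symm k2 k
      · exact hdis g' hg' h hh d2 k' k2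
    · exact hne (heq _ _ (hgw.trans hgw'.symm) (k.1.trans k'.1.symm) (k.2.trans k'.2.symm))
  have c2 : ∀ i j t : Fin 3, (∀ s : Fin 3, s = i ∨ s = j ∨ s = t) → ∀ e ∈ G, ∀ f ∈ G, e i = f i →
      e j = f j → e t ≠ f t → False := by
    intro i j t hc e he f hf hi hj ht
    obtain ⟨v, hv, hve, -⟩ := hpick j (e j) (e j)
    obtain ⟨h, hh, h', hh', hne, hhv, hhv'⟩ := hdeg j v hv
    have a1 : h i = e i := by
      by_contra hcc
      exact hve (hhv ▸ two_disj_aux G hcon i j t hc he hf hh hi hj ht hcc)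
    have a2 : h' i = e i := by
      by_contra hcc
      exact hve (hhv' ▸ two_disj_aux G hcon i j t hc he hf hh' hi hj ht hcc)
    have a3 : h t ≠ h' t := by
      intro h3
      apply hne
      funext s
      rcases hc s with rfl | rfl | rfl
      · exact a1.trans a2.symm
      · exact hhv.trans hhv'.symm
      · exact h3
    obtain ⟨w, hw, hwe, -⟩ := hpick i (e i) (e i)
    obtain ⟨g, hg, -, -, -, hgw, -⟩ := hdeg i w hw
    have b1 := two_disj_aux G hcon i j t hc he hf hg hi hj ht (by rw [hgw]; exact hwe)
    have b2 := two_disj_aux G hcon i j t hc hh hh' hg (a1.trans a2.symm) (hhv.trans hhv'.symm) a3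
      (by rw [hgw, a1]; exact hwe)
    exact hve (by rw [← hhv, ← b2, b1])
  obtain ⟨v, hv, -⟩ := hpick 0 ⟨0, by
    obtain ⟨v, _⟩ := card_pos.1 (show 0 < #(B 0) by have := hB 0; omega)
    exact v.pos⟩ ⟨0, by
    obtain ⟨v, _⟩ := card_pos.1 (show 0 < #(B 0) by have := hB 0; omega)
    exact v.pos⟩
  obtain ⟨e, he, f, hf, hne, h1, h2⟩ := hdeg 0 v hv
  by_cases hj : e 1 = f 1
  · by_cases ht : e 2 = f 2
    · apply hne; funext s; fin_cases s
      · exact h1.trans h2.symm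
      · exact hj
      · exact ht
    · exact c2 0 1 2 (by decide) e he f hf (h1.trans h2.symm) hj ht
  · by_cases ht : e 2 = f 2
    · exact c2 0 2 1 (by decide) e he f hf (h1.trans h2.symm) ht hj
    · exact c1 0 1 2 (by decide) e he f hf (h1.trans h2.symm) hj ht

/-- Many disjoint edges from a degree condition. -/
lemma many_disj (G : Finset (Fin 3 → Fin n)) (B : Finset (Fin n)) (i : Fin 3) (d : ℕ) (hd : 0 < d)
    (hn : 0 < n) (hB : (n : ℝ) / 2 ≤ #B) (hlow : ∀ v ∈ B, (n : ℝ) * d / 100 ≤ #{e ∈ G | e i = v})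
    (hup : ∀ j v, (#{e ∈ G | e j = v} : ℝ) ≤ 3 / 10000 * (n : ℝ) ^ 2) :
    ∃ M, IsMat G M ∧ d ≤ #M := by
  classical
  obtain ⟨M, hM, hmax⟩ := exists_max G
  refine ⟨M, hM, ?_⟩
  by_contra hlt
  push Not at hlt
  have hsub : G ⊆ (M ×ˢ (univ : Finset (Fin 3))).biUnion (fun p => ({e ∈ G | e p.2 = p.1 p.2} : Finset _)) := by
    intro e he
    by_contra hne
    have hh : ∀ f ∈ M, ∀ j, f j ≠ e j := by
      intro f hf j h
      exact hne (mem_biUnion.2 ⟨(f, j), mem_product.2 ⟨hf, mem_univ _⟩, mem_filter.2 ⟨he, h.symm⟩⟩)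
    have := hM.insert he hh
    have := hmax _ this.1
    omega
  have h1 : (#G : ℝ) ≤ #M * 3 * (3 / 10000 * (n : ℝ) ^ 2) := by
    have h2 := (card_le_card hsub).trans card_biUnion_le
    have h3 : (#G : ℝ) ≤ ∑ p ∈ M ×ˢ (univ : Finset (Fin 3)), (#{e ∈ G | e p.2 = p.1 p.2} : ℝ) := by
      exact_mod_cast h2
    refine h3.trans ((sum_le_card_nsmul _ _ _ (fun p _ => hup p.2 (p.1 p.2))).trans ?_)
    rw [card_product, nsmul_eq_mul]
    simp
  have h2 : (#B : ℝ) * (n * d / 100) ≤ #G := by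
    have e1 : ∑ v ∈ B, #{e ∈ G | e i = v} ≤ #G := by
      rw [← card_biUnion]
      · exact card_le_card (biUnion_subset.2 fun v _ => filter_subset _ _)
      · intro u _ v _ huv
        exact disjoint_left.2 fun e he he' => huv ((mem_filter.1 he).2.symm.trans (mem_filter.1 he').2)
    have e2 : ∑ v ∈ B, (#{e ∈ G | e i = v} : ℝ) ≤ #G := by exact_mod_cast e1
    refine le_trans ?_ e2
    rw [← nsmul_eq_mul]
    exact card_nsmul_le_sum _ _ _ hlow
  have hM' : (#M : ℝ) ≤ d := by exact_mod_cast hlt.le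
  have hdR : (0 : ℝ) < d := by exact_mod_cast hd
  have hnR : (0 : ℝ) < n := by exact_mod_cast hn
  have h3 : (n : ℝ) / 2 * (n * d / 100) ≤ #B * (n * d / 100) :=
    mul_le_mul_of_nonneg_right hB (by positivity)
  have h4 : (#M : ℝ) * 3 * (3 / 10000 * (n : ℝ) ^ 2) ≤ d * 3 * (3 / 10000 * (n : ℝ) ^ 2) := by
    gcongr
  have h5 : 0 < (d : ℝ) * (n : ℝ) ^ 2 := by positivity
  nlinarith only [h1, h2, h3, h4, h5]

end LM

namespace LM
variable {n : ℕ}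

/-- `n² - δ(n,r,s)`. -/
def muLM (r s : ℤ) : ℤ :=
  if s = 1 then (2 * r + 1) ^ 2 else if s = 2 then (2 * r + 3) * (2 * r + 1)
  else (2 * r + 3) * (2 * r + 2)

lemma muLM_eq (n r s : ℕ) (hn : n = 3 * r + s) (h1 : 1 ≤ s) (h3 : s ≤ 3) :
    (n : ℤ) ^ 2 - deltaLM n r s = muLM r s := by
  unfold deltaLM muLM
  interval_cases s
  · simp only [if_true]
    have : n - r = 2 * r + 1 := by omega
    rw [this, Nat.cast_sub (by subst hn; nlinarith)]
    push_cast
    simp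
  · have e1 : n - r + 1 = 2 * r + 3 := by omega
    have e2 : n - r - 1 = 2 * r + 1 := by omega
    rw [e1, e2]
    norm_num
    rw [Nat.cast_sub (by subst hn; nlinarith)]
    push_cast
    ring
  · have e1 : n - r = 2 * r + 3 := by omega
    have e2 : n - r - 1 = 2 * r + 2 := by omega
    rw [e2, e1]
    norm_num
    rw [Nat.cast_sub (by subst hn; nlinarith)]
    push_cast
    ring

lemma arith_prod (r a b c : ℤ) (hr : 0 ≤ r) (hab : a ≤ b) (hac : a ≤ c) (hb : 10 * b ≤ r)
    (hc : 10 * c ≤ r) (ha : a ≤ 0) : a * r ≤ 10 * (b * c) := by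
  rcases le_total 0 b with h | h <;> rcases le_total 0 c with h' | h'
  · nlinarith [mul_nonneg h h', mul_nonneg (neg_nonneg.2 ha) hr]
  · nlinarith [mul_nonneg (sub_nonneg.2 hac) hr, mul_nonneg (neg_nonneg.2 h') (sub_nonneg.2 hb)]
  · nlinarith [mul_nonneg (sub_nonneg.2 hab) hr, mul_nonneg (neg_nonneg.2 h) (sub_nonneg.2 hc)]
  · nlinarith [mul_nonneg (neg_nonneg.2 h) (neg_nonneg.2 h'), mul_nonneg (neg_nonneg.2 ha) hr]

/-- the generic large case -/
lemma arith_big (r d K a b c : ℤ) (hr : 1000 ≤ r) (hd : 1 ≤ d) (hK : d ≤ 6 * K)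
    (hab : a ≤ b) (hac : a ≤ c) (hb : 10 * b ≤ r) (hc : 10 * c ≤ r) (hKa : a ≤ 0 → -a ≤ K) :
    (3 * r + 3) * d ≤ 100 * (2 * r * K - 5 + b * c) := by
  have h1 : - (K * r) ≤ 10 * (b * c) := by
    rcases le_total a 0 with h | h
    · have := arith_prod r a b c (by linarith) hab hac hb hc h
      nlinarith [hKa h]
    · have : 0 ≤ b * c := mul_nonneg (by linarith) (by linarith)
      nlinarith
  have h2 : r * d ≤ 6 * (r * K) := by nlinarith
  nlinarith

lemma arith (r s d a b c : ℤ) (hr : 1000 ≤ r) (hs1 : 1 ≤ s) (hs3 : s ≤ 3) (hd : 1 ≤ d)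
    (hsum : a + b + c = 2 * s + d) (hab : a ≤ b) (hac : a ≤ c) (hb : 10 * b ≤ r)
    (hc : 10 * c ≤ r) :
    (3 * r + s) * d ≤ 100 * ((2 * r + b) * (2 * r + c) + 1 - muLM r s) ∨
    (d = 1 ∧ 1 ≤ (2 * r + b) * (2 * r + c) + 1 - muLM r s) ∨
    (s = 2 ∧ d = 2 ∧ a = 2 ∧ b = 2 ∧ c = 2) := by
  have hs : s = 1 ∨ s = 2 ∨ s = 3 := by omega
  rcases hs with rfl | rfl | rfl
  · have e : (2 * r + b) * (2 * r + c) + 1 - muLM r 1 = 2 * r * (d - a) + b * c := by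
      have : b = 2 + d - a - c := by linarith
      simp only [muLM, if_true]; rw [this]; ring
    rw [e]
    by_cases h : d ≤ 6 * (d - a)
    · left
      have := arith_big r d (d - a) a b c hr hd h hab hac hb hc (by intro; linarith)
      nlinarith
    · right; left
      have : d = 1 := by omega
      have : a = 1 := by omega
      have : b = 1 := by omega
      have : c = 1 := by omega
      subst_vars; simp
  · have e : (2 * r + b) * (2 * r + c) + 1 - muLM r 2 = 2 * r * (d - a) - 2 + b * c := by
      have : b = 4 + d - a - c := by linarith
      simp [muLM]; rw [this]; ring
    rw [e]
    by_cases h : d ≤ 6 * (d - a)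
    · left
      have := arith_big r d (d - a) a b c hr hd h hab hac hb hc (by intro; linarith)
      nlinarith
    · right
      have : d = 1 ∨ d = 2 := by omega
      rcases this with rfl | rfl
      · left
        have h1 : a = 1 := by omega
        have h2 : b = 4 - c := by omega
        have h3 : c = 1 ∨ c = 2 ∨ c = 3 := by omega
        refine ⟨rfl, ?_⟩
        rcases h3 with rfl | rfl | rfl <;> subst_vars <;> norm_num
      · right
        omega
  · have e : (2 * r + b) * (2 * r + c) + 1 - muLM r 3 = 2 * r * (d + 1 - a) - 5 + b * c := by
      have : b = 6 + d - a - c := by linarith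
      simp [muLM]; rw [this]; ring
    rw [e]
    by_cases h : d ≤ 6 * (d + 1 - a)
    · left
      exact arith_big r d (d + 1 - a) a b c hr hd h hab hac hb hc (by intro; linarith)
    · right; left
      have h0 : d = 1 := by omega
      subst h0
      have h1 : a = 2 := by omega
      have h2 : b = 5 - c := by omega
      have h3 : c = 2 ∨ c = 3 := by omega
      refine ⟨rfl, ?_⟩
      rcases h3 with rfl | rfl <;> subst_vars <;> norm_num

lemma bb_low (H : Finset (Fin 3 → Fin n)) (A : Fin 3 → Finset (Fin n)) (i : Fin 3) (v : Fin n) :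
    dg H i v + #(A (i+1))ᶜ * #(A (i+2))ᶜ ≤ #{e ∈ H | e i = v ∧ ∀ j, j ≠ i → e j ∉ A j} + n ^ 2 := by
  classical
  have h1 := card_fix_two i v (fun j => (A j)ᶜ)
  have h2 := card_union_add_card_inter ({e ∈ H | e i = v} : Finset _)
    ({e : Fin 3 → Fin n | e i = v ∧ ∀ j, j ≠ i → e j ∈ (A j)ᶜ} : Finset _)
  have h3 : #(({e ∈ H | e i = v} : Finset _) ∪
    ({e : Fin 3 → Fin n | e i = v ∧ ∀ j, j ≠ i → e j ∈ (A j)ᶜ} : Finset _)) ≤ n ^ 2 := by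
    rw [← card_fix i v]
    apply card_le_card
    intro e he
    rcases mem_union.1 he with h | h
    · exact mem_filter.2 ⟨mem_univ _, (mem_filter.1 h).2⟩
    · exact mem_filter.2 ⟨mem_univ _, (mem_filter.1 h).2.1⟩
  have h4 : #(({e ∈ H | e i = v} : Finset _) ∩
    ({e : Fin 3 → Fin n | e i = v ∧ ∀ j, j ≠ i → e j ∈ (A j)ᶜ} : Finset _)) ≤
    #{e ∈ H | e i = v ∧ ∀ j, j ≠ i → e j ∉ A j} := by
    apply card_le_card
    intro e he
    obtain ⟨h, h'⟩ := mem_inter.1 he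
    exact mem_filter.2 ⟨(mem_filter.1 h).1, (mem_filter.1 h).2, fun j hj =>
      mem_compl.1 ((mem_filter.1 h').2.2 j hj)⟩
  unfold dg
  rw [h1] at h2
  omega

lemma bbb_edges (H : Finset (Fin 3 → Fin n)) (A : Fin 3 → Finset (Fin n)) (r s : ℕ)
    (hnr : n = 3 * r + s) (hs1 : 1 ≤ s) (hs3 : s ≤ 3) (hn : 10000 ≤ n)
    (hdeg : ∀ i v, deltaLM n r s < dg H i v)
    (hA : ∀ i, |(#(A i) : ℝ) - n / 3| ≤ 1 / 1000000 * n)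
    (h4 : ∀ i, ∀ v ∉ A i, (#{e ∈ H | e i = v ∧ ∀ j, j ≠ i → e j ∉ A j} : ℝ) ≤ 3 / 10000 * (n : ℝ) ^ 2) :
    ∃ M0, IsMat H M0 ∧ (∀ e ∈ M0, ∀ i, e i ∉ A i) ∧ #M0 = n - (#(A 0) + #(A 1) + #(A 2)) := by
  classical
  obtain ⟨d, hd⟩ : ∃ d, d = n - (#(A 0) + #(A 1) + #(A 2)) := ⟨_, rfl⟩
  rw [← hd]
  obtain ⟨G, hG⟩ : ∃ G : Finset (Fin 3 → Fin n), G = {e ∈ H | ∀ i, e i ∉ A i} := ⟨_, rfl⟩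
  have hGH : G ⊆ H := hG ▸ filter_subset _ _
  suffices h : ∃ M, IsMat G M ∧ d ≤ #M by
    obtain ⟨M, hM, hMd⟩ := h
    obtain ⟨M', hM's, hM'c⟩ := exists_subset_card_eq hMd
    refine ⟨M', (hM.sub hM's).mono hGH, ?_, hM'c⟩
    intro e he
    have := hM.1 (hM's he)
    rw [hG] at this
    exact (mem_filter.1 this).2
  by_cases hd0 : d = 0
  · exact ⟨∅, IsMat.empty _, by simp [hd0]⟩
  have hnR : (10000 : ℝ) ≤ n := by exact_mod_cast hn
  have hAn : ∀ i, #(A i) ≤ n := fun i => by simpa using card_le_univ (A i)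
  have hBc : ∀ i, (#(A i)ᶜ : ℤ) = n - #(A i) := fun i => by
    have h0 := hAn i
    have : #(A i)ᶜ = n - #(A i) := by rw [card_compl, Fintype.card_fin]
    omega
  obtain ⟨c, hc⟩ : ∃ c : Fin 3 → ℤ, ∀ i, (#(A i)ᶜ : ℤ) = 2 * r + c i :=
    ⟨fun i => (#(A i)ᶜ : ℤ) - 2 * r, fun i => by ring⟩
  have hcu : ∀ i, 10 * c i ≤ r := by
    intro i
    have h1 := (abs_le.1 (hA i)).1
    have h2 : ((#(A i)ᶜ : ℤ) : ℝ) = ((n - #(A i) : ℤ) : ℝ) := by rw [hBc]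
    have h3 : ((#(A i)ᶜ : ℤ) : ℝ) = ((2 * r + c i : ℤ) : ℝ) := by rw [hc]
    have h4 : (n : ℝ) = 3 * r + s := by exact_mod_cast hnr
    have h5 : (s : ℝ) ≤ 3 := by exact_mod_cast hs3
    push_cast at h2 h3
    have : 10 * ((c i : ℤ) : ℝ) ≤ r := by linarith
    exact_mod_cast this
  have hbl : ∀ i, (n : ℝ) / 2 ≤ #(A i)ᶜ := by
    intro i
    have h1 := (abs_le.1 (hA i)).2
    have h2 : ((#(A i)ᶜ : ℤ) : ℝ) = ((n - #(A i) : ℤ) : ℝ) := by rw [hBc]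
    push_cast at h2
    linarith
  have hsum : ∀ i : Fin 3, c i + c (i+1) + c (i+2) = 2 * s + d := by
    intro i
    have h0 := hBc 0
    have h1 := hBc 1
    have h2 := hBc 2
    rw [hc] at h0 h1 h2
    have : c 0 + c 1 + c 2 = 2 * s + d := by omega
    fin_cases i
    · exact this
    · change c 1 + c 2 + c 0 = _; linarith
    · change c 2 + c 0 + c 1 = _; linarith
  have hGdeg : ∀ i, ∀ v ∉ A i, #{e ∈ G | e i = v} = #{e ∈ H | e i = v ∧ ∀ j, j ≠ i → e j ∉ A j} := by
    intro i v hv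
    congr 1
    ext e
    rw [hG]
    simp only [mem_filter]
    constructor
    · rintro ⟨⟨a, b⟩, rfl⟩; exact ⟨a, rfl, fun j _ => b j⟩
    · rintro ⟨a, rfl, b⟩
      refine ⟨⟨a, fun j => ?_⟩, rfl⟩
      by_cases hj : j = i
      · rw [hj]; exact hv
      · exact b j hj
  have hlow : ∀ i, ∀ v ∉ A i, (2 * r + c (i+1)) * (2 * r + c (i+2)) + 1 - muLM r s ≤
      (#{e ∈ G | e i = v} : ℤ) := by
    intro i v hv
    rw [hGdeg i v hv, ← muLM_eq n r s hnr hs1 hs3, ← hc, ← hc]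
    have h1 := bb_low H A i v
    have h2 := hdeg i v
    have h1' : (dg H i v : ℤ) + #(A (i+1))ᶜ * #(A (i+2))ᶜ ≤ #{e ∈ H | e i = v ∧ ∀ j, j ≠ i → e j ∉ A j} + (n : ℤ) ^ 2 := by
      exact_mod_cast h1
    have h2' : (deltaLM n r s : ℤ) + 1 ≤ dg H i v := by exact_mod_cast h2
    linarith
  obtain ⟨i, hi⟩ := Finite.exists_min c
  have hr : (1000 : ℤ) ≤ r := by omega
  rcases arith r s d (c i) (c (i+1)) (c (i+2)) hr (by exact_mod_cast hs1) (by exact_mod_cast hs3)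
    (by omega) (hsum i) (hi _) (hi _) (hcu _) (hcu _) with h | ⟨h, h'⟩ | ⟨hs, h, a1, a2, a3⟩
  · refine many_disj G (A i)ᶜ i d (by omega) (by omega) (hbl i) ?_ ?_
    · intro v hv
      have := hlow i v (mem_compl.1 hv)
      have h1 : ((3 * r + s : ℤ)) * d ≤ 100 * (#{e ∈ G | e i = v} : ℤ) := by linarith
      have h2 : ((3 * r + s : ℕ) : ℝ) * d ≤ 100 * (#{e ∈ G | e i = v} : ℝ) := by
        push_cast
        exact_mod_cast h1
      rw [← hnr] at h2
      linarith
    · intro j v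
      by_cases hv : v ∈ A j
      · have : ({e ∈ G | e j = v} : Finset _) = ∅ := by
          rw [filter_eq_empty_iff]
          rintro e he rfl
          rw [hG] at he
          exact (mem_filter.1 he).2 j hv
        rw [this]; simp
      · rw [hGdeg j v hv]; exact h4 j v hv
  · have : 0 < #(A i)ᶜ := by
      have := hbl i
      have : (0 : ℝ) < #(A i)ᶜ := by linarith
      exact_mod_cast this
    obtain ⟨v, hv⟩ := card_pos.1 this
    have := hlow i v (mem_compl.1 hv)
    have h0 : 0 < #{e ∈ G | e i = v} := by omega
    obtain ⟨e, he⟩ := card_pos.1 h0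
    refine ⟨{e}, ⟨by simpa using (mem_filter.1 he).1, ?_⟩, by rw [card_singleton]; omega⟩
    intro a ha b hb _ _
    rw [mem_singleton.1 ha, mem_singleton.1 hb]
  · have hc2 : ∀ j, c j = 2 := by
      intro j
      rcases (by decide : ∀ i j : Fin 3, j = i ∨ j = i + 1 ∨ j = i + 2) i j with h | h | h <;>
        rw [h] <;> assumption
    obtain ⟨e, he, f, hf, hef⟩ := two_disj G (fun i => (A i)ᶜ) (by
        intro j
        have := hc j
        rw [hc2] at this
        omega) (by
        intro j v hv
        have h1 := hlow j v (mem_compl.1 hv)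
        rw [hc2, hc2, hs] at h1
        simp only [muLM] at h1
        norm_num at h1
        have h2 : (2 : ℤ) ≤ #{e ∈ G | e j = v} := by nlinarith
        have h3 : 1 < #{e ∈ G | e j = v} := by omega
        obtain ⟨e, he, f, hf, hne⟩ := one_lt_card.1 h3
        exact ⟨e, (mem_filter.1 he).1, f, (mem_filter.1 hf).1, hne, (mem_filter.1 he).2, (mem_filter.1 hf).2⟩)
    have hm : IsMat G {e} := ⟨by simpa using he, by
      intro a ha b hb _ _; rw [mem_singleton.1 ha, mem_singleton.1 hb]⟩
    have hm2 := hm.insert hf (by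
      intro a ha s; rw [mem_singleton.1 ha]; exact hef s)
    refine ⟨_, hm2.1, ?_⟩
    rw [hm2.2, card_singleton]; omega

end LM

namespace LM
variable {n : ℕ}

lemma swapA (Q : Finset (Fin 3 → Fin n)) (A A' : Fin 3 → Finset (Fin n)) (i : Fin 3) (v : Fin n)
    (c : ℝ) (hc : ∀ j, (#(A' j \ A j) : ℝ) ≤ c * n) :
    (#{e ∈ Q | e i = v ∧ ∀ j, j ≠ i → e j ∉ A j} : ℝ) ≤
      #{e ∈ Q | e i = v ∧ ∀ j, j ≠ i → e j ∉ A' j} + 2 * c * (n : ℝ) ^ 2 := by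
  classical
  have hsub : ({e ∈ Q | e i = v ∧ ∀ j, j ≠ i → e j ∉ A j} : Finset _) ⊆
      ({e ∈ Q | e i = v ∧ ∀ j, j ≠ i → e j ∉ A' j} : Finset _) ∪
      (({e | e i = v ∧ e (i+1) ∈ A' (i+1) \ A (i+1)} : Finset (Fin 3 → Fin n)) ∪
      ({e | e i = v ∧ e (i+2) ∈ A' (i+2) \ A (i+2)} : Finset (Fin 3 → Fin n))) := by
    intro e he
    obtain ⟨h1, h2, h3⟩ := mem_filter.1 he
    by_cases h : ∀ j, j ≠ i → e j ∉ A' j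
    · exact mem_union_left _ (mem_filter.2 ⟨h1, h2, h⟩)
    · push Not at h
      obtain ⟨j, hj, hjA⟩ := h
      refine mem_union_right _ ?_
      rcases (by decide : ∀ i j : Fin 3, j ≠ i → j = i + 1 ∨ j = i + 2) i j hj with h | h
      · subst h
        exact mem_union_left _ (mem_filter.2 ⟨mem_univ _, h2, mem_sdiff.2 ⟨hjA, h3 _ hj⟩⟩)
      · subst h
        exact mem_union_right _ (mem_filter.2 ⟨mem_univ _, h2, mem_sdiff.2 ⟨hjA, h3 _ hj⟩⟩)
  have h1 := (card_le_card hsub).trans ((card_union_le _ _).trans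
    (Nat.add_le_add_left (card_union_le _ _) _))
  rw [card_fix_in ((by decide : ∀ i : Fin 3, i ≠ i + 1) _),
        card_fix_in ((by decide : ∀ i : Fin 3, i ≠ i + 2) _)] at h1
  have h2 : (#{e ∈ Q | e i = v ∧ ∀ j, j ≠ i → e j ∉ A j} : ℝ) ≤
      #{e ∈ Q | e i = v ∧ ∀ j, j ≠ i → e j ∉ A' j} +
      (#(A' (i+1) \ A (i+1)) * n + #(A' (i+2) \ A (i+2)) * n) := by exact_mod_cast h1
  have hn : (0 : ℝ) ≤ n := Nat.cast_nonneg _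
  nlinarith [mul_le_mul_of_nonneg_right (hc (i+1)) hn, mul_le_mul_of_nonneg_right (hc (i+2)) hn]

lemma markov_low (P : Finset (Fin 3 → Fin n)) (S : Finset (Fin n)) (i : Fin 3) (c : ℝ)
    (h : ∀ v ∈ S, c ≤ #{e ∈ P | e i = v}) : #S * c ≤ #P := by
  classical
  have e1 : ∑ v ∈ S, #{e ∈ P | e i = v} ≤ #P := by
    rw [← card_biUnion]
    · exact card_le_card (biUnion_subset.2 fun v _ => filter_subset _ _)
    · intro u _ v _ huv
      exact disjoint_left.2 fun e he he' => huv ((mem_filter.1 he).2.symm.trans (mem_filter.1 he').2)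
  have e2 : ∑ v ∈ S, (#{e ∈ P | e i = v} : ℝ) ≤ #P := by exact_mod_cast e1
  refine le_trans ?_ e2
  rw [← nsmul_eq_mul]
  exact card_nsmul_le_sum _ _ _ h

lemma markov_up (P : Finset (Fin 3 → Fin n)) (S : Finset (Fin n)) (i : Fin 3) (c : ℝ)
    (hP : ∀ e ∈ P, e i ∈ S) (h : ∀ v ∈ S, (#{e ∈ P | e i = v} : ℝ) ≤ c) : #P ≤ #S * c := by
  classical
  have e1 := card_eq_sum_card_fiberwise (s := P) (t := S) (f := fun e : Fin 3 → Fin n => e i)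
    (fun e he => hP e he)
  have e2 : (#P : ℝ) = ∑ v ∈ S, (#{e ∈ P | e i = v} : ℝ) := by exact_mod_cast e1
  rw [e2, ← nsmul_eq_mul]
  exact sum_le_card_nsmul _ _ _ h

lemma bb_split (H : Finset (Fin 3 → Fin n)) (A : Fin 3 → Finset (Fin n)) (i : Fin 3) (v : Fin n) :
    #{e ∈ H | e i = v ∧ ∀ j, j ≠ i → e j ∉ A j} + #{e | e ∉ H ∧ e i = v ∧ ∀ j, j ≠ i → e j ∉ A j}
      = #(A (i+1))ᶜ * #(A (i+2))ᶜ := by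
  classical
  rw [← card_fix_two i v (fun j => (A j)ᶜ), ← card_union_of_disjoint]
  · congr 1
    ext e
    simp only [mem_union, mem_filter, mem_univ, true_and, mem_compl]
    tauto
  · exact disjoint_left.2 fun e he he' => (mem_filter.1 he').2.1 (mem_filter.1 he).1

lemma dg_compl (H : Finset (Fin 3 → Fin n)) (i : Fin 3) (v : Fin n) :
    dg H i v + #{e | e ∉ H ∧ e i = v} = n ^ 2 := by
  classical
  unfold dg
  rw [← card_fix i v, ← card_union_of_disjoint]
  · congr 1
    ext e
    simp only [mem_union, mem_filter, mem_univ, true_and]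
    tauto
  · exact disjoint_left.2 fun e he he' => (mem_filter.1 he').2.1 (mem_filter.1 he).1

lemma compl_filter_eq (H : Finset (Fin 3 → Fin n)) (p : (Fin 3 → Fin n) → Prop) [DecidablePred p] :
    #{e | e ∉ H ∧ p e} = #{e ∈ Hᶜ | p e} := by
  congr 1
  ext e
  simp

set_option maxHeartbeats 2000000 in
lemma reclass (H : Finset (Fin 3 → Fin n)) (hn : 10000 ≤ n) (ρ : ℝ) (hρ : ρ = 1 / 100000000000)
    (hdeg : ∀ i v, (5 / 9 - ρ) * (n : ℝ) ^ 2 ≤ dg H i v)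
    (A₀ : Fin 3 → Finset (Fin n)) (hA₀ : ∀ i, |(#(A₀ i) : ℝ) - n / 3| ≤ ρ * n)
    (hB₀ : (#{e ∈ H | ∀ i, e i ∉ A₀ i} : ℝ) ≤ ρ * (n : ℝ) ^ 3) :
    ∃ A : Fin 3 → Finset (Fin n),
    (∀ i, |(#(A i) : ℝ) - n / 3| ≤ 1 / 1000000 * n) ∧
    (∀ i, (#{v ∈ A i | n ^ 2 < 320 * #{e | e ∉ H ∧ e i = v ∧ ∀ j, j ≠ i → e j ∉ A j}} : ℝ)
      ≤ 1 / 1000000 * n) ∧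
    (∀ i, ∀ v ∈ A i, 1 / 10000 * (n : ℝ) ^ 2 ≤ #{e ∈ H | e i = v ∧ ∀ j, j ≠ i → e j ∉ A j}) ∧
    (∀ i, ∀ v ∉ A i, (#{e ∈ H | e i = v ∧ ∀ j, j ≠ i → e j ∉ A j} : ℝ) ≤ 3 / 10000 * (n : ℝ) ^ 2) ∧
    (∀ i, ∀ v ∉ A i, 320 * #{e | e ∉ H ∧ e i = v ∧ ∃ j, j ≠ i ∧ e j ∈ A j} ≤ n ^ 2) := by
  classical
  have hnR : (10000 : ℝ) ≤ n := by exact_mod_cast hn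
  have hn0 : (0 : ℝ) < n := by linarith
  have hn2 : (0 : ℝ) < (n : ℝ) ^ 2 := by positivity
  have hcompl : ∀ S : Finset (Fin n), (#Sᶜ : ℝ) = n - #S := by
    intro S
    have h0 : #S ≤ n := by simpa using card_le_univ S
    rw [card_compl, Fintype.card_fin, Nat.cast_sub h0]
  have hb0l : ∀ i, (2 / 3 - ρ) * n ≤ (#(A₀ i)ᶜ : ℝ) := fun i => by
    have := (abs_le.1 (hA₀ i)).2; rw [hcompl]; linarith
  have hb0u : ∀ i, (#(A₀ i)ᶜ : ℝ) ≤ (2 / 3 + ρ) * n := fun i => by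
    have := (abs_le.1 (hA₀ i)).1; rw [hcompl]; linarith
  have hnon : ∀ i v, (#{e | e ∉ H ∧ e i = v} : ℝ) ≤ (4 / 9 + ρ) * (n : ℝ) ^ 2 := by
    intro i v
    have h1 := dg_compl H i v
    have h2 : (dg H i v : ℝ) + #{e | e ∉ H ∧ e i = v} = (n : ℝ) ^ 2 := by exact_mod_cast h1
    linarith [hdeg i v]
  -- the nonedges of type A B B
  let NE : Fin 3 → Finset (Fin 3 → Fin n) := fun i =>
    {e | e ∉ H ∧ e i ∈ A₀ i ∧ ∀ j, j ≠ i → e j ∉ A₀ j}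
  have hNE : ∀ i, (#(NE i) : ℝ) ≤ 4 * ρ * (n : ℝ) ^ 3 := by
    intro i
    obtain ⟨Z, hZ⟩ : ∃ Z : Finset (Fin 3 → Fin n), Z = ({e | e ∉ H ∧ ∀ j, e j ∉ A₀ j} : Finset (Fin 3 → Fin n)) := ⟨_, rfl⟩
    obtain ⟨P, hP⟩ : ∃ P : Finset (Fin 3 → Fin n), P = ({e | e ∉ H ∧ e (i+1) ∉ A₀ (i+1)} : Finset (Fin 3 → Fin n)) := ⟨_, rfl⟩
    have h1 : (#P : ℝ) ≤ #(A₀ (i+1))ᶜ * ((4 / 9 + ρ) * (n : ℝ) ^ 2) := by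
      refine markov_up P _ (i+1) _ ?_ ?_
      · intro e he
        rw [hP] at he
        exact mem_compl.2 (mem_filter.1 he).2.2
      · intro v _
        refine le_trans ?_ (hnon (i+1) v)
        have : #{e ∈ P | e (i+1) = v} ≤ #{e | e ∉ H ∧ e (i+1) = v} := by
          apply card_le_card
          intro e he
          rw [hP] at he
          exact mem_filter.2 ⟨mem_univ _, (mem_filter.1 (mem_filter.1 he).1).2.1, (mem_filter.1 he).2⟩
        exact_mod_cast this
    have h2 : #Z + #(NE i) ≤ #P := by
      rw [← card_union_of_disjoint]
      · apply card_le_card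
        intro e he
        rw [hP]
        rcases mem_union.1 he with h | h
        · rw [hZ] at h
          exact mem_filter.2 ⟨mem_univ _, (mem_filter.1 h).2.1, (mem_filter.1 h).2.2 _⟩
        · exact mem_filter.2 ⟨mem_univ _, (mem_filter.1 h).2.1,
            (mem_filter.1 h).2.2.2 _ ((by decide : ∀ i : Fin 3, i + 1 ≠ i) i)⟩
      · refine disjoint_left.2 fun e he he' => ?_
        rw [hZ] at he
        exact (mem_filter.1 he).2.2 i (mem_filter.1 he').2.2.1
    have h3 : #Z + #{e ∈ H | ∀ i, e i ∉ A₀ i} = #(A₀ 0)ᶜ * #(A₀ 1)ᶜ * #(A₀ 2)ᶜ := by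
      rw [← card_pi (fun j => (A₀ j)ᶜ), ← card_union_of_disjoint]
      · congr 1
        ext e
        rw [hZ]
        simp only [mem_union, mem_filter, mem_univ, true_and, Fintype.mem_piFinset, mem_compl]
        tauto
      · refine disjoint_left.2 fun e he he' => ?_
        rw [hZ] at he
        exact (mem_filter.1 he).2.1 (mem_filter.1 he').1
    have h4 : #(A₀ 0)ᶜ * #(A₀ 1)ᶜ * #(A₀ 2)ᶜ = #(A₀ (i+1))ᶜ * (#(A₀ i)ᶜ * #(A₀ (i+2))ᶜ) := by
      fin_cases i
      · change _ = #(A₀ 1)ᶜ * (#(A₀ 0)ᶜ * #(A₀ 2)ᶜ); ring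
      · change _ = #(A₀ 2)ᶜ * (#(A₀ 1)ᶜ * #(A₀ 0)ᶜ); ring
      · change _ = #(A₀ 0)ᶜ * (#(A₀ 2)ᶜ * #(A₀ 1)ᶜ); ring
    rw [h4] at h3
    have h2' : (#Z : ℝ) + #(NE i) ≤ #P := by exact_mod_cast h2
    have h3' : (#Z : ℝ) + #{e ∈ H | ∀ i, e i ∉ A₀ i} = #(A₀ (i+1))ᶜ * (#(A₀ i)ᶜ * #(A₀ (i+2))ᶜ) := by
      exact_mod_cast h3
    have h5 : ((2 / 3 - ρ) * n) * ((2 / 3 - ρ) * n) ≤ (#(A₀ i)ᶜ : ℝ) * #(A₀ (i+2))ᶜ :=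
      mul_le_mul (hb0l i) (hb0l _) (by rw [hρ]; positivity) (Nat.cast_nonneg _)
    have h6 := mul_le_mul_of_nonneg_left h5 (Nat.cast_nonneg (α := ℝ) #(A₀ (i+1))ᶜ)
    have h7 : (#(NE i) : ℝ) ≤ #(A₀ (i+1))ᶜ * (((4 / 9 + ρ) - (2 / 3 - ρ) ^ 2) * (n : ℝ) ^ 2) + ρ * (n : ℝ) ^ 3 := by
      nlinarith only [h1, h2', h3', h6, hB₀]
    have h8 : #(A₀ (i+1))ᶜ * (((4 / 9 + ρ) - (2 / 3 - ρ) ^ 2) * (n : ℝ) ^ 2) ≤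
        ((2 / 3 + ρ) * n) * (((4 / 9 + ρ) - (2 / 3 - ρ) ^ 2) * (n : ℝ) ^ 2) :=
      mul_le_mul_of_nonneg_right (hb0u _) (by
        apply mul_nonneg _ hn2.le
        rw [hρ]; norm_num)
    have h9 : ((2 / 3 + ρ) * n) * (((4 / 9 + ρ) - (2 / 3 - ρ) ^ 2) * (n : ℝ) ^ 2) ≤ 3 * ρ * (n : ℝ) ^ 3 := by
      have : ((2 / 3 + ρ) * n) * (((4 / 9 + ρ) - (2 / 3 - ρ) ^ 2) * (n : ℝ) ^ 2) =
        ((2 / 3 + ρ) * ((4 / 9 + ρ) - (2 / 3 - ρ) ^ 2)) * (n : ℝ) ^ 3 := by ring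
      rw [this]
      apply mul_le_mul_of_nonneg_right _ (by positivity)
      rw [hρ]; norm_num
    linarith
  have hNEbb : ∀ i, ∀ v ∈ A₀ i, #{e | e ∉ H ∧ e i = v ∧ ∀ j, j ≠ i → e j ∉ A₀ j} = #{e ∈ NE i | e i = v} := by
    intro i v hv
    congr 1
    ext e
    simp only [NE, mem_filter, mem_univ, true_and]
    constructor
    · rintro ⟨a, rfl, b⟩; exact ⟨⟨a, hv, b⟩, rfl⟩
    · rintro ⟨⟨a, _, b⟩, rfl⟩; exact ⟨a, rfl, b⟩
  obtain ⟨A, hA⟩ : ∃ A : Fin 3 → Finset (Fin n), ∀ i v, v ∈ A i ↔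
      2 / 10000 * (n : ℝ) ^ 2 ≤ #{e ∈ H | e i = v ∧ ∀ j, j ≠ i → e j ∉ A₀ j} :=
    ⟨fun i => {v | 2 / 10000 * (n : ℝ) ^ 2 ≤ #{e ∈ H | e i = v ∧ ∀ j, j ≠ i → e j ∉ A₀ j}}, by simp⟩
  have hX : ∀ i, (#(A i \ A₀ i) : ℝ) ≤ 5000 * ρ * n := by
    intro i
    have h1 := markov_low ({e ∈ H | ∀ i, e i ∉ A₀ i} : Finset _) (A i \ A₀ i) i (2 / 10000 * (n : ℝ) ^ 2) (by
      intro v hv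
      obtain ⟨hv1, hv2⟩ := mem_sdiff.1 hv
      refine ((hA i v).1 hv1).trans ?_
      have : #{e ∈ H | e i = v ∧ ∀ j, j ≠ i → e j ∉ A₀ j} ≤
          #{e ∈ ({e ∈ H | ∀ i, e i ∉ A₀ i} : Finset _) | e i = v} := by
        apply card_le_card
        intro e he
        obtain ⟨a, b, c⟩ := mem_filter.1 he
        refine mem_filter.2 ⟨mem_filter.2 ⟨a, fun j => ?_⟩, b⟩
        by_cases hj : j = i
        · rw [hj, b]; exact hv2
        · exact c j hj
      exact_mod_cast this)
    have h2 : (#(A i \ A₀ i) : ℝ) * (n : ℝ) ^ 2 ≤ (5000 * ρ * n) * (n : ℝ) ^ 2 := by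
      nlinarith only [h1, hB₀]
    exact le_of_mul_le_mul_right h2 hn2
  have hY : ∀ i, (#(A₀ i \ A i) : ℝ) ≤ 16 * ρ * n := by
    intro i
    have h1 := markov_low (NE i) (A₀ i \ A i) i (1 / 4 * (n : ℝ) ^ 2) (by
      intro v hv
      obtain ⟨hv1, hv2⟩ := mem_sdiff.1 hv
      rw [hA, not_le] at hv2
      rw [← hNEbb i v hv1]
      have h2 := bb_split H A₀ i v
      have h3 : (#{e ∈ H | e i = v ∧ ∀ j, j ≠ i → e j ∉ A₀ j} : ℝ) +
        #{e | e ∉ H ∧ e i = v ∧ ∀ j, j ≠ i → e j ∉ A₀ j} = #(A₀ (i+1))ᶜ * #(A₀ (i+2))ᶜ := by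
        exact_mod_cast h2
      have h5 : ((2 / 3 - ρ) * n) * ((2 / 3 - ρ) * n) ≤ (#(A₀ (i+1))ᶜ : ℝ) * #(A₀ (i+2))ᶜ :=
        mul_le_mul (hb0l _) (hb0l _) (by rw [hρ]; positivity) (Nat.cast_nonneg _)
      have h6 : (2 / 3 - ρ) ^ 2 ≥ 4 / 10 := by rw [hρ]; norm_num
      nlinarith only [h3, h5, hv2, mul_le_mul_of_nonneg_right h6 hn2.le])
    have h2 : (#(A₀ i \ A i) : ℝ) * (n : ℝ) ^ 2 ≤ (16 * ρ * n) * (n : ℝ) ^ 2 := by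
      nlinarith only [h1, hNE i]
    exact le_of_mul_le_mul_right h2 hn2
  have hX' : ∀ i, (#(A i \ A₀ i) : ℝ) ≤ (1 / 10000000) * n := fun i =>
    (hX i).trans (by rw [hρ]; nlinarith)
  have hY' : ∀ i, (#(A₀ i \ A i) : ℝ) ≤ (1 / 10000000) * n := fun i =>
    (hY i).trans (by rw [hρ]; nlinarith)
  have hAc : ∀ i, |(#(A i) : ℝ) - n / 3| ≤ 1 / 1000000 * n := by
    intro i
    have h1 := card_sdiff_add_card_inter (A i) (A₀ i)
    have h2 := card_sdiff_add_card_inter (A₀ i) (A i)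
    rw [inter_comm] at h2
    have h1' : (#(A i \ A₀ i) : ℝ) + #(A i ∩ A₀ i) = #(A i) := by exact_mod_cast h1
    have h2' : (#(A₀ i \ A i) : ℝ) + #(A i ∩ A₀ i) = #(A₀ i) := by exact_mod_cast h2
    have h3 := abs_le.1 (hA₀ i)
    have h4 : ρ * n ≤ 1 / 10000000 * n := by rw [hρ]; nlinarith
    have p1 : (0 : ℝ) ≤ #(A i \ A₀ i) := Nat.cast_nonneg _
    have p2 : (0 : ℝ) ≤ #(A₀ i \ A i) := Nat.cast_nonneg _
    rw [abs_le]
    constructor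
    · linarith [hX' i, hY' i, h3.1]
    · linarith [hX' i, hY' i, h3.2]
  have hA4 : ∀ i, ∀ v ∉ A i, (#{e ∈ H | e i = v ∧ ∀ j, j ≠ i → e j ∉ A j} : ℝ) ≤ 3 / 10000 * (n : ℝ) ^ 2 := by
    intro i v hv
    rw [hA, not_le] at hv
    have := swapA H A A₀ i v _ hY'
    nlinarith only [hv, this, hn2]
  refine ⟨A, hAc, ?_, ?_, hA4, ?_⟩
  · intro i
    obtain ⟨W, hW⟩ : ∃ W : Finset (Fin n), W = {v ∈ A₀ i | 1 / 400 * (n : ℝ) ^ 2 ≤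
      #{e ∈ NE i | e i = v}} := ⟨_, rfl⟩
    have hWc : (#W : ℝ) ≤ 1600 * ρ * n := by
      have h1 := markov_low (NE i) W i (1 / 400 * (n : ℝ) ^ 2) (by
        intro v hv
        rw [hW] at hv
        exact (mem_filter.1 hv).2)
      have h2 : (#W : ℝ) * (n : ℝ) ^ 2 ≤ (1600 * ρ * n) * (n : ℝ) ^ 2 := by
        nlinarith only [h1, hNE i]
      exact le_of_mul_le_mul_right h2 hn2
    have hsub : ({v ∈ A i | n ^ 2 < 320 * #{e | e ∉ H ∧ e i = v ∧ ∀ j, j ≠ i → e j ∉ A j}} : Finset _)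
        ⊆ W ∪ (A i \ A₀ i) := by
      intro v hv
      obtain ⟨h1, h2⟩ := mem_filter.1 hv
      by_cases hv0 : v ∈ A₀ i
      · refine mem_union_left _ ?_
        rw [hW]
        refine mem_filter.2 ⟨hv0, ?_⟩
        rw [← hNEbb i v hv0, compl_filter_eq]
        rw [compl_filter_eq] at h2
        have h3 := swapA Hᶜ A A₀ i v _ hY'
        have h4 : (n : ℝ) ^ 2 < 320 * #{e ∈ Hᶜ | e i = v ∧ ∀ j, j ≠ i → e j ∉ A j} := by
          exact_mod_cast h2
        nlinarith only [h3, h4, hn2]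
      · exact mem_union_right _ (mem_sdiff.2 ⟨h1, hv0⟩)
    have h1 := (card_le_card hsub).trans (card_union_le _ _)
    have h2 : (#{v ∈ A i | n ^ 2 < 320 * #{e | e ∉ H ∧ e i = v ∧ ∀ j, j ≠ i → e j ∉ A j}} : ℝ) ≤
      #W + #(A i \ A₀ i) := by exact_mod_cast h1
    have h3 : 1600 * ρ * n ≤ 1 / 10000000 * n := by rw [hρ]; nlinarith
    linarith [hX' i]
  · intro i v hv
    rw [hA] at hv
    have := swapA H A₀ A i v _ hX'
    nlinarith only [hv, this, hn2]
  · intro i v hv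
    have h1 := bb_split H A i v
    have h1' : (#{e ∈ H | e i = v ∧ ∀ j, j ≠ i → e j ∉ A j} : ℝ) +
        #{e | e ∉ H ∧ e i = v ∧ ∀ j, j ≠ i → e j ∉ A j} = #(A (i+1))ᶜ * #(A (i+2))ᶜ := by
        exact_mod_cast h1
    have hbl : ∀ j, (2 / 3 - 1 / 1000000) * (n : ℝ) ≤ #(A j)ᶜ := fun j => by
      have := (abs_le.1 (hAc j)).2; rw [hcompl]; linarith
    have h5 : ((2 / 3 - 1 / 1000000) * (n : ℝ)) * ((2 / 3 - 1 / 1000000) * n) ≤ (#(A (i+1))ᶜ : ℝ) * #(A (i+2))ᶜ :=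
      mul_le_mul (hbl _) (hbl _) (by positivity) (Nat.cast_nonneg _)
    have h2 : #{e | e ∉ H ∧ e i = v ∧ ∃ j, j ≠ i ∧ e j ∈ A j} +
        #{e | e ∉ H ∧ e i = v ∧ ∀ j, j ≠ i → e j ∉ A j} ≤ #{e | e ∉ H ∧ e i = v} := by
      rw [← card_union_of_disjoint]
      · apply card_le_card
        intro e he
        rcases mem_union.1 he with h | h
        · exact mem_filter.2 ⟨mem_univ _, (mem_filter.1 h).2.1, (mem_filter.1 h).2.2.1⟩
        · exact mem_filter.2 ⟨mem_univ _, (mem_filter.1 h).2.1, (mem_filter.1 h).2.2.1⟩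
      · refine disjoint_left.2 fun e he he' => ?_
        obtain ⟨j, hj, hjA⟩ := (mem_filter.1 he).2.2.2
        exact (mem_filter.1 he').2.2.2 j hj hjA
    have h2' : (#{e | e ∉ H ∧ e i = v ∧ ∃ j, j ≠ i ∧ e j ∈ A j} : ℝ) +
        #{e | e ∉ H ∧ e i = v ∧ ∀ j, j ≠ i → e j ∉ A j} ≤ #{e | e ∉ H ∧ e i = v} := by
      exact_mod_cast h2
    have h3 := hnon i v
    have h4 := hA4 i v hv
    have : 320 * (#{e | e ∉ H ∧ e i = v ∧ ∃ j, j ≠ i ∧ e j ∈ A j} : ℝ) ≤ (n : ℝ) ^ 2 := by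
      rw [hρ] at h3
      nlinarith only [h1', h5, h2', h3, h4, hn2]
    exact_mod_cast this

/-- The degree threshold is asymptotically `5/9 n²`. -/
lemma delta_asymp (ε : ℝ) (hε : 0 < ε) : ∃ n0 : ℕ, ∀ n ≥ n0, ∀ r s, n = 3 * r + s → 1 ≤ s → s ≤ 3 →
    (5 / 9 - ε) * (n : ℝ) ^ 2 ≤ deltaLM n r s := by
  obtain ⟨n0, hn0⟩ := exists_nat_gt (10 / ε)
  refine ⟨n0 + 10, ?_⟩
  intro n hn r s hnr h1 h3
  have hmu := muLM_eq n r s hnr h1 h3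
  have hmuR : (n : ℝ) ^ 2 - deltaLM n r s = (muLM r s : ℝ) := by exact_mod_cast hmu
  have hnR : (n0 : ℝ) + 10 ≤ n := by exact_mod_cast hn
  have hr : (n : ℝ) = 3 * r + s := by exact_mod_cast hnr
  have hb : 9 * (muLM r s : ℝ) ≤ 4 * (n : ℝ) ^ 2 + 30 * n := by
    rw [hr]
    have hr0 : (0 : ℝ) ≤ r := Nat.cast_nonneg _
    interval_cases s <;> simp [muLM] <;> nlinarith
  have h4 : 10 ≤ ε * n := by
    rw [div_lt_iff₀ hε] at hn0
    nlinarith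
  have h5 : (0 : ℝ) ≤ n := Nat.cast_nonneg _
  nlinarith [mul_le_mul_of_nonneg_right h4 h5]

/-- Part 3: the extremal case. -/
theorem part3 : ∃ ρ : ℝ, 0 < ρ ∧ ∃ n0 : ℕ, ∀ n ≥ n0, ∀ r s, n = 3 * r + s → 1 ≤ s → s ≤ 3 →
    ∀ H : Finset (Fin 3 → Fin n), (∀ i v, deltaLM n r s < dg H i v) →
    ∀ A₀ : Fin 3 → Finset (Fin n), (∀ i, |(#(A₀ i) : ℝ) - n / 3| ≤ ρ * n) →
    (#{e ∈ H | ∀ i, e i ∉ A₀ i} : ℝ) ≤ ρ * (n : ℝ) ^ 3 → ∃ M, IsMat H M ∧ #M = n := by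
  obtain ⟨n0, hn0⟩ := delta_asymp (1 / 100000000000) (by norm_num)
  refine ⟨1 / 100000000000, by norm_num, n0 + 10000, ?_⟩
  intro n hn r s hnr h1 h3 H hdeg A₀ hA₀ hB₀
  obtain ⟨A, a1, a2, a3, a4, a5⟩ := reclass H (by omega) _ rfl (fun i v =>
    (hn0 n (by omega) r s hnr h1 h3).trans (by exact_mod_cast (hdeg i v).le)) A₀ hA₀ hB₀
  obtain ⟨M0, m1, m2, m3⟩ := bbb_edges H A r s hnr h1 h3 (by omega) hdeg a1 a4
  exact ext_finish H A (by omega) a1 a2 a3 a5 M0 m1 m2 m3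

end LM

namespace LM
variable {n : ℕ}

section pull
variable {n' : ℕ} (φ : Fin 3 → Fin n' ↪ Fin n) (H : Finset (Fin 3 → Fin n))

/-- The pushforward of an edge. -/
def push (e : Fin 3 → Fin n') : Fin 3 → Fin n := fun i => φ i (e i)

lemma push_inj : Function.Injective (push φ) := by
  intro e f h
  funext i
  exact (φ i).injective (congrFun h i)

/-- The pullback of a 3-graph. -/
def pull : Finset (Fin 3 → Fin n') := {e | push φ e ∈ H}

lemma mem_pull (e : Fin 3 → Fin n') : e ∈ pull φ H ↔ push φ e ∈ H := by simp [pull]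

/-- The missed vertices. -/
def missed (i : Fin 3) : Finset (Fin n) := (univ.map (φ i))ᶜ

lemma lift_push (e : Fin 3 → Fin n) (he : ∀ i, e i ∉ missed φ i) : ∃ e', push φ e' = e := by
  have : ∀ i, ∃ x, φ i x = e i := by
    intro i
    have := he i
    simpa [missed] using this
  choose e' he' using this
  exact ⟨e', funext he'⟩

lemma dg_pull (k : ℕ) (hk : ∀ i, #(missed φ i) ≤ k) (i : Fin 3) (v : Fin n') :
    dg H i (φ i v) ≤ dg (pull φ H) i v + 2 * k * n := by
  classical
  have hsub : ({e ∈ H | e i = φ i v} : Finset _) ⊆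
      ({e ∈ pull φ H | e i = v} : Finset _).image (push φ) ∪
      (({e | e i = φ i v ∧ e (i+1) ∈ missed φ (i+1)} : Finset (Fin 3 → Fin n)) ∪
      ({e | e i = φ i v ∧ e (i+2) ∈ missed φ (i+2)} : Finset (Fin 3 → Fin n))) := by
    intro e he
    obtain ⟨h1, h2⟩ := mem_filter.1 he
    by_cases ha : e (i+1) ∈ missed φ (i+1)
    · exact mem_union_right _ (mem_union_left _ (mem_filter.2 ⟨mem_univ _, h2, ha⟩))
    by_cases hb : e (i+2) ∈ missed φ (i+2)
    · exact mem_union_right _ (mem_union_right _ (mem_filter.2 ⟨mem_univ _, h2, hb⟩))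
    refine mem_union_left _ ?_
    obtain ⟨e', he'⟩ := lift_push φ e (by
      intro s
      rcases (by decide : ∀ i j : Fin 3, j = i ∨ j = i + 1 ∨ j = i + 2) i s with rfl | rfl | rfl
      · rw [h2]; simp [missed]
      · exact ha
      · exact hb)
    refine mem_image.2 ⟨e', mem_filter.2 ⟨(mem_pull φ H e').2 (he' ▸ h1), ?_⟩, he'⟩
    apply (φ i).injective
    rw [← h2, ← he']; rfl
  have h1 := (card_le_card hsub).trans ((card_union_le _ _).trans
    (Nat.add_le_add_left (card_union_le _ _) _))
  rw [card_fix_in ((by decide : ∀ i : Fin 3, i ≠ i + 1) _),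
        card_fix_in ((by decide : ∀ i : Fin 3, i ≠ i + 2) _)] at h1
  have h2 := card_image_le (s := ({e ∈ pull φ H | e i = v} : Finset _)) (f := push φ)
  have h3 := Nat.mul_le_mul_right n (hk (i+1))
  have h4 := Nat.mul_le_mul_right n (hk (i+2))
  unfold dg
  have : 2 * k * n = k * n + k * n := by ring
  omega

lemma bbb_pull (k : ℕ) (hk : ∀ i, #(missed φ i) ≤ k) (A : Fin 3 → Finset (Fin n')) :
    #{e ∈ H | ∀ i, e i ∉ (A i).map (φ i)} ≤ #{e ∈ pull φ H | ∀ i, e i ∉ A i} + 3 * k * n ^ 2 := by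
  classical
  have hsub : ({e ∈ H | ∀ i, e i ∉ (A i).map (φ i)} : Finset _) ⊆
      ({e ∈ pull φ H | ∀ i, e i ∉ A i} : Finset _).image (push φ) ∪
      univ.biUnion (fun i => ({e | e i ∈ missed φ i} : Finset (Fin 3 → Fin n))) := by
    intro e he
    obtain ⟨h1, h2⟩ := mem_filter.1 he
    by_cases h : ∀ i, e i ∉ missed φ i
    · obtain ⟨e', rfl⟩ := lift_push φ e h
      refine mem_union_left _ (mem_image.2 ⟨e', mem_filter.2 ⟨(mem_pull φ H e').2 h1, ?_⟩, rfl⟩)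
      intro i hi
      exact h2 i (mem_map_of_mem _ hi)
    · push Not at h
      obtain ⟨i, hi⟩ := h
      exact mem_union_right _ (mem_biUnion.2 ⟨i, mem_univ _, mem_filter.2 ⟨mem_univ _, hi⟩⟩)
  have h1 := (card_le_card hsub).trans ((card_union_le _ _).trans
    (Nat.add_le_add card_image_le card_biUnion_le))
  refine h1.trans (Nat.add_le_add_left ?_ _)
  rw [Fin.sum_univ_three, card_in, card_in, card_in]
  have a := Nat.mul_le_mul_right (n^2) (hk 0)
  have b := Nat.mul_le_mul_right (n^2) (hk 1)
  have c := Nat.mul_le_mul_right (n^2) (hk 2)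
  have : 3 * k * n ^ 2 = k * n ^ 2 + k * n ^ 2 + k * n ^ 2 := by ring
  omega

lemma mat_push {M : Finset (Fin 3 → Fin n')} (hM : IsMat (pull φ H) M) :
    IsMat H (M.image (push φ)) := by
  refine ⟨?_, ?_⟩
  · intro e he
    obtain ⟨e', h, rfl⟩ := mem_image.1 he
    exact (mem_pull φ H e').1 (hM.1 h)
  · intro e he f hf i hi
    obtain ⟨e', h, rfl⟩ := mem_image.1 he
    obtain ⟨f', h', rfl⟩ := mem_image.1 hf
    rw [hM.2 e' h f' h' i ((φ i).injective hi)]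

end pull

theorem main_abs : ∃ n0 : ℕ, ∀ n ≥ n0, ∀ r s, n = 3 * r + s → 1 ≤ s → s ≤ 3 →
    ∀ H : Finset (Fin 3 → Fin n), (∀ i v, deltaLM n r s < dg H i v) →
    ∃ M, IsMat H M ∧ #M = n := by
  classical
  obtain ⟨ρ, hρ, N3, h3⟩ := part3
  obtain ⟨ε, hε, h2⟩ := part2 (ρ / 2) (by positivity)
  obtain ⟨γ, hγ0, hγ1, hγ2, hγ3⟩ : ∃ γ : ℝ, 0 < γ ∧ γ ≤ ε / 8 ∧ γ ≤ ρ / 12 ∧ γ ≤ 1 / 10 :=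
    ⟨min (ε / 8) (min (ρ / 12) (1 / 10)), by positivity, min_le_left _ _,
      (min_le_right _ _).trans (min_le_left _ _), (min_le_right _ _).trans (min_le_right _ _)⟩
  obtain ⟨η, hη, N1, h1⟩ := absorbing γ hγ0
  obtain ⟨N2, h2⟩ := h2 (η / 2) (by positivity)
  obtain ⟨N4, h4⟩ := delta_asymp (min (ε / 2) (5 / 1000)) (by positivity)
  refine ⟨N1 + 2 * N2 + N3 + N4 + 10, ?_⟩
  intro n hn r s hnr hs1 hs3 H hdeg
  have hnR : (0 : ℝ) < n := by exact_mod_cast (by omega : 0 < n)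
  have hn2 : (0 : ℝ) < (n : ℝ) ^ 2 := by positivity
  have hd : ∀ i v, (5 / 9 - min (ε / 2) (5 / 1000)) * (n : ℝ) ^ 2 ≤ dg H i v := fun i v =>
    (h4 n (by omega) r s hnr hs1 hs3).trans (by exact_mod_cast (hdeg i v).le)
  have m1 : min (ε / 2) (5 / 1000) ≤ ε / 2 := min_le_left _ _
  have m2 : min (ε / 2) (5 / 1000) ≤ 5 / 1000 := min_le_right _ _
  obtain ⟨AF, hAF, hAFc, hAFT⟩ := h1 n (by omega) H (fun i v => (hd i v).trans' (by
    apply mul_le_mul_of_nonneg_right _ hn2.le; linarith))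
  obtain ⟨M0, hM0, hM0i⟩ := hAF.mat
  obtain ⟨k, hk⟩ : ∃ k, k = #M0 := ⟨_, rfl⟩
  have hvs : ∀ i, #(vs AF i) = k := fun i => by rw [← hM0i, hM0.image_card, hk]
  have hkR : (k : ℝ) ≤ 2 * γ * n := by
    have := card_vs AF 0
    rw [hvs] at this
    have : (k : ℝ) ≤ 2 * #AF := by exact_mod_cast this
    linarith
  have hkn : k ≤ n := by rw [hk]; exact hM0.card_le
  obtain ⟨n', hn'⟩ : ∃ n', n' = n - k := ⟨_, rfl⟩
  have hn'R : (n' : ℝ) = n - k := by rw [hn', Nat.cast_sub hkn]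
  have hU : ∀ i, #(vs AF i)ᶜ = n' := fun i => by
    rw [card_compl, Fintype.card_fin, hvs, hn']
  let φ : Fin 3 → Fin n' ↪ Fin n := fun i => ((vs AF i)ᶜ.orderEmbOfFin (hU i)).toEmbedding
  have hφ : ∀ i, univ.map (φ i) = (vs AF i)ᶜ := by
    intro i
    exact map_orderEmbOfFin_univ _ _
  have hφm : ∀ i x, φ i x ∉ vs AF i := by
    intro i x h
    have : φ i x ∈ univ.map (φ i) := mem_map_of_mem _ (mem_univ _)
    rw [hφ] at this
    exact mem_compl.1 this h
  have hmiss : ∀ i, missed φ i = vs AF i := fun i => by rw [missed, hφ, compl_compl]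
  have hmk : ∀ i, #(missed φ i) ≤ k := fun i => by rw [hmiss, hvs]
  have hn'n : (n' : ℝ) ≤ n := by rw [hn'R]; linarith [Nat.cast_nonneg (α := ℝ) k]
  have hn'l : 2 * n' ≥ n := by
    have : 2 * (n' : ℝ) ≥ n := by rw [hn'R]; nlinarith
    exact_mod_cast this
  have hn'0 : (0 : ℝ) ≤ n' := Nat.cast_nonneg _
  rcases h2 n' (by omega) (pull φ H) (by
    intro i v
    have e1 := dg_pull φ H k hmk i v
    have e2 : (dg H i (φ i v) : ℝ) ≤ dg (pull φ H) i v + 2 * k * n := by exact_mod_cast e1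
    have e3 := hd i (φ i v)
    have e4 : (5 / 9 - ε / 2) * (n : ℝ) ^ 2 ≤ dg H i (φ i v) := e3.trans' (by
      apply mul_le_mul_of_nonneg_right _ hn2.le; linarith)
    have e5 : 2 * (k : ℝ) * n ≤ ε / 2 * (n : ℝ) ^ 2 := by
      have : (k : ℝ) ≤ ε / 4 * n := hkR.trans (by nlinarith)
      nlinarith
    have e6 : (5 / 9 - ε) * (n : ℝ) ^ 2 ≤ dg (pull φ H) i v := by linarith
    rcases le_total (5 / 9 - ε) 0 with h | h
    · exact (mul_nonpos_of_nonpos_of_nonneg h (by positivity)).trans (Nat.cast_nonneg _)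
    · refine le_trans ?_ e6
      apply mul_le_mul_of_nonneg_left _ h
      exact pow_le_pow_left₀ hn'0 hn'n 2) with ⟨M', hM', hM'c⟩ | ⟨A', hA', hB'⟩
  · have hM1 := mat_push φ H hM'
    obtain ⟨M1, hM1e⟩ : ∃ M1, M1 = M'.image (push φ) := ⟨_, rfl⟩
    rw [← hM1e] at hM1
    have hM1c : #M1 = #M' := by rw [hM1e]; exact card_image_of_injective _ (push_inj φ)
    have hM1s : ∀ i, M1.image (fun e => e i) ⊆ (vs AF i)ᶜ := by
      intro i x hx
      obtain ⟨e, he, rfl⟩ := mem_image.1 hx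
      rw [hM1e] at he
      obtain ⟨e', _, rfl⟩ := mem_image.1 he
      exact mem_compl.2 (hφm i _)
    have hM'n : #M' ≤ n' := hM'.card_le
    obtain ⟨M2, hM2, hM2i⟩ := absorb H (n' - #M') AF
      (fun i => (vs AF i)ᶜ \ M1.image (fun e => e i)) hAF (by
        intro i
        rw [card_sdiff_of_subset (hM1s i), hU, hM1.image_card, hM1c]) (by
        intro i
        exact disjoint_left.2 fun x hx hx' => (mem_compl.1 (mem_sdiff.1 hx).1) hx') (by
        intro T
        have a1 := hAFT T
        have a2 : ((n' - #M' : ℕ) : ℝ) ≤ η * n := by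
          rw [Nat.cast_sub hM'n]
          nlinarith
        have a3 := a2.trans a1
        exact_mod_cast a3)
    have hfin := hM1.union hM2 (by
      intro e he f hf i h
      have hf' : f i ∈ M2.image (fun e => e i) := mem_image_of_mem _ hf
      have he' : e i ∈ M1.image (fun e => e i) := mem_image_of_mem _ he
      rw [hM2i, ← h] at hf'
      rcases mem_union.1 hf' with hh | hh
      · exact mem_compl.1 (hM1s i he') hh
      · exact (mem_sdiff.1 hh).2 he')
    refine ⟨_, hfin.1, ?_⟩
    rw [hfin.2, ← hM2.image_card 0, hM2i, card_union_of_disjoint, card_sdiff_of_subset (hM1s 0),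
      hU, hM1.image_card, hvs, hM1c]
    · omega
    · exact disjoint_left.2 fun x hx hx' => (mem_compl.1 (mem_sdiff.1 hx').1) hx
  · refine h3 n (by omega) r s hnr hs1 hs3 H hdeg (fun i => (A' i).map (φ i)) ?_ ?_
    · intro i
      rw [card_map]
      have := abs_le.1 (hA' i)
      have k0 : (0 : ℝ) ≤ k := Nat.cast_nonneg _
      have e1 : (ρ / 2) * (n' : ℝ) ≤ (ρ / 2) * n := by gcongr
      have e2 : (k : ℝ) ≤ ρ / 6 * n := hkR.trans (by nlinarith)
      have e3 : (0:ℝ) ≤ ρ * n := by positivity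
      rw [abs_le]
      constructor
      · linarith [this.1]
      · linarith [this.2]
    · have e1 := bbb_pull φ H k hmk A'
      have e2 : (#{e ∈ H | ∀ i, e i ∉ (A' i).map (φ i)} : ℝ) ≤
        #{e ∈ pull φ H | ∀ i, e i ∉ A' i} + 3 * k * (n : ℝ) ^ 2 := by exact_mod_cast e1
      have e3 : (k : ℝ) ≤ ρ / 6 * n := hkR.trans (by nlinarith)
      have e4 := mul_le_mul_of_nonneg_right e3 hn2.le
      have e5 : (ρ / 2) * (n' : ℝ) ^ 3 ≤ (ρ / 2) * (n : ℝ) ^ 3 := by gcongr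
      nlinarith only [e2, e4, e5, hB']

end LM

namespace LM

/-- Transfer from the coordinate model to an abstract tripartite hypergraph. -/
lemma transfer {n d : ℕ} {α : Type} [DecidableEq α] (V : Fin 3 → Finset α)
    (hdisj : ∀ i j, i ≠ j → Disjoint (V i) (V j)) (hcard : ∀ i, #(V i) = n)
    (E : Finset (Finset α))
    (hE : ∀ e ∈ E, (∀ x ∈ e, ∃ i, x ∈ V i) ∧ ∀ i, #(e ∩ V i) = 1)
    (hdeg' : ∀ i, ∀ v ∈ V i, d < #(E.filter (fun e => v ∈ e)))
    (main : ∀ H : Finset (Fin 3 → Fin n), (∀ i v, d < LM.dg H i v) →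
      ∃ M, LM.IsMat H M ∧ #M = n) :
    ∃ M : Finset (Finset α), M ⊆ E ∧ (∀ e ∈ M, ∀ f ∈ M, e ≠ f → Disjoint e f) ∧
      #M = n ∧ ∀ i, ∀ v ∈ V i, ∃ e ∈ M, v ∈ e := by
  classical
  have hphi : ∀ i, ∃ φ : Fin n → α, Function.Injective φ ∧ (∀ x, φ x ∈ V i) ∧
      ∀ v ∈ V i, ∃ x, φ x = v := by
    intro i
    refine ⟨fun x => ((V i).equivFinOfCardEq (hcard i)).symm x, ?_, ?_, ?_⟩
    · intro x y h
      exact ((V i).equivFinOfCardEq (hcard i)).symm.injective (Subtype.ext h)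
    · intro x
      exact (((V i).equivFinOfCardEq (hcard i)).symm x).2
    · intro v hv
      exact ⟨(V i).equivFinOfCardEq (hcard i) ⟨v, hv⟩, by simp⟩
  choose φ hinj hmem hsurj using hphi
  have hij : ∀ i j x y, φ i x = φ j y → i = j := by
    intro i j x y h
    by_contra hne
    exact (Finset.disjoint_left.1 (hdisj i j hne)) (hmem i x) (h ▸ hmem j y)
  let S : (Fin 3 → Fin n) → Finset α := fun e => univ.image (fun i => φ i (e i))
  have hS : ∀ e v, v ∈ S e ↔ ∃ i, φ i (e i) = v := by
    intro e v; simp [S]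
  have hSi : ∀ e i x, φ i x ∈ S e ↔ e i = x := by
    intro e i x
    rw [hS]
    constructor
    · rintro ⟨j, hj⟩
      have := hij _ _ _ _ hj
      subst this
      exact hinj _ hj
    · rintro rfl
      exact ⟨i, rfl⟩
  have hSinj : Function.Injective S := by
    intro e f h
    funext i
    have : φ i (f i) ∈ S f := (hSi f i _).2 rfl
    rw [← h, hSi] at this
    exact this
  have hSsurj : ∀ f ∈ E, ∃ e, S e = f := by
    intro f hf
    obtain ⟨h1, h2⟩ := hE f hf
    have h3 : ∀ i, ∃ x, f ∩ V i = {φ i x} := by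
      intro i
      obtain ⟨a, ha⟩ := Finset.card_eq_one.1 (h2 i)
      have : a ∈ f ∩ V i := by rw [ha]; simp
      obtain ⟨x, rfl⟩ := hsurj i a (Finset.mem_inter.1 this).2
      exact ⟨x, ha⟩
    choose e he using h3
    refine ⟨e, ?_⟩
    ext v
    rw [hS]
    constructor
    · rintro ⟨i, rfl⟩
      have : φ i (e i) ∈ f ∩ V i := by rw [he]; simp
      exact (Finset.mem_inter.1 this).1
    · intro hv
      obtain ⟨i, hi⟩ := h1 v hv
      have : v ∈ f ∩ V i := Finset.mem_inter.2 ⟨hv, hi⟩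
      rw [he, Finset.mem_singleton] at this
      exact ⟨i, this.symm⟩
  obtain ⟨M, hM, hMn⟩ := main (univ.filter (fun e => S e ∈ E)) (by
    intro i x
    refine lt_of_lt_of_le (hdeg' i (φ i x) (hmem i x)) ?_
    unfold LM.dg
    rw [← Finset.card_image_of_injective _ hSinj]
    apply Finset.card_le_card
    intro f hf
    rw [Finset.mem_filter] at hf
    obtain ⟨e, rfl⟩ := hSsurj f hf.1
    refine Finset.mem_image.2 ⟨e, ?_, rfl⟩
    have := (hSi e i x).1 hf.2
    simp [hf.1, this])
  refine ⟨M.image S, ?_, ?_, ?_, ?_⟩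
  · intro f hf
    obtain ⟨e, he, rfl⟩ := Finset.mem_image.1 hf
    exact (Finset.mem_filter.1 (hM.1 he)).2
  · intro e he f hf hne
    obtain ⟨e, he', rfl⟩ := Finset.mem_image.1 he
    obtain ⟨f, hf', rfl⟩ := Finset.mem_image.1 hf
    rw [Finset.disjoint_left]
    intro v hv hv2
    obtain ⟨i, rfl⟩ := (hS e v).1 hv
    exact hne (congrArg S (hM.2 e he' f hf' i ((hSi f i _).1 hv2).symm))
  · rw [Finset.card_image_of_injective _ hSinj, hMn]
  · intro i v hv
    obtain ⟨x, rfl⟩ := hsurj i v hv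
    have h1 : M.image (fun e => e i) = univ := by
      apply Finset.eq_univ_of_card
      rw [hM.image_card i, hMn, Fintype.card_fin]
    have h2 : x ∈ M.image (fun e => e i) := by rw [h1]; simp
    obtain ⟨e, he, hx⟩ := Finset.mem_image.1 h2
    exact ⟨S e, Finset.mem_image_of_mem _ he, (hSi e i x).2 hx⟩

end LM

/-- There exists `n0` such that for all `n ≥ n0` with `n = 3r + s`, `1 ≤ s ≤ 3`:
every 3-partite 3-graph `H` with classes of size `n` and `δ₁(H) > δ(n,r,s)`
has a perfect matching: `n` pairwise disjoint edges covering all vertices. -/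
theorem perfect_matching_threshold :
    ∃ n0 : ℕ, ∀ n : ℕ, n0 ≤ n → ∀ r s : ℕ, n = 3 * r + s → 1 ≤ s → s ≤ 3 →
      ∀ (α : Type) [DecidableEq α], ∀ V1 V2 V3 : Finset α,
        Disjoint V1 V2 → Disjoint V1 V3 → Disjoint V2 V3 →
        V1.card = n → V2.card = n → V3.card = n →
        ∀ E : Finset (Finset α),
          IsPartite3 V1 V2 V3 E →
          (∀ v ∈ V1 ∪ V2 ∪ V3, deltaLM n r s < hdeg E v) →
          ∃ M : Finset (Finset α),
            M ⊆ E ∧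
            (∀ e ∈ M, ∀ f ∈ M, e ≠ f → Disjoint e f) ∧
            M.card = n ∧
            (∀ v ∈ V1 ∪ V2 ∪ V3, ∃ e ∈ M, v ∈ e) := by
  obtain ⟨n0, h0⟩ := LM.main_abs
  refine ⟨n0, ?_⟩
  intro n hn r s hrs hs1 hs3 α _ V1 V2 V3 h12 h13 h23 c1 c2 c3 E hE hdeg
  obtain ⟨M, hM1, hM2, hM3, hM4⟩ := LM.transfer (n := n) (d := deltaLM n r s) ![V1, V2, V3]
    (by
      intro i j hij
      fin_cases i <;> fin_cases j <;>
        first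
        | exact absurd rfl hij
        | exact h12
        | exact h13
        | exact h23
        | exact h12.symm
        | exact h13.symm
        | exact h23.symm)
    (by
      intro i
      fin_cases i
      · exact c1
      · exact c2
      · exact c3)
    E
    (by
      intro e he
      obtain ⟨g0, g1, g2, g3⟩ := hE e he
      refine ⟨?_, ?_⟩
      · intro x hx
        have hx' := g0 hx
        rw [Finset.mem_union, Finset.mem_union] at hx'
        rcases hx' with (h | h) | h
        · exact ⟨0, h⟩
        · exact ⟨1, h⟩
        · exact ⟨2, h⟩
      · intro i
        fin_cases i
        · exact g1
        · exact g2
        · exact g3)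
    (by
      intro i v hv
      apply hdeg v
      rw [Finset.mem_union, Finset.mem_union]
      fin_cases i
      · exact Or.inl (Or.inl hv)
      · exact Or.inl (Or.inr hv)
      · exact Or.inr hv)
    (h0 n hn r s hrs hs1 hs3)
  refine ⟨M, hM1, hM2, hM3, ?_⟩
  intro v hv
  rw [Finset.mem_union, Finset.mem_union] at hv
  rcases hv with (h | h) | h
  · exact hM4 0 v h
  · exact hM4 1 v h
  · exact hM4 2 v h
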